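/- arXiv:1301.4016 — 8 statements merged into one kernel-verified Lean document; each statement's English description precedes it below -/
import Mathlib

section
/- Suppose t = p^i·ℓ + 1 where i ≥ 1, ℓ > 1 is odd and not divisible by p, and gcd(ℓ, p^i − 1) < ℓ. Assume g_t(x,y) is irreducible in F_p[x,y]. If either (p ≥ 5 and i ≥ 1) or (p = 3 and i ≥ 2), then the image of g_t in F̄_p[x,y] is irreducible, i.e. g_t is absolutely irreducible. -/
open MvPolynomial

noncomputable section

open Finset in
/-- If a family of equivalence relations on a finite set, indexed by its points, is invariant under
a doubly transitive family of maps and no relation of the family is total off its index, then two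
distinct points are equivalent for fewer than half of the indices. -/
theorem two_mul_card_filter_rel_lt {α : Type*} [DecidableEq α] (s : Finset α)
    (rel : α → α → α → Prop) [∀ z x y, Decidable (rel z x y)]
    (hequiv : ∀ z, Equivalence (rel z))
    (hself : ∀ z y, rel z z y → y = z)
    (htrans : ∀ z ∈ s, ∀ x ∈ s, z ≠ x → ∀ z' ∈ s, ∀ x' ∈ s, z' ≠ x' →
      ∃ σ : α → α, Function.Injective σ ∧ (∀ a ∈ s, σ a ∈ s) ∧ σ z = z' ∧ σ x = x' ∧
        ∀ a b c, rel a b c → rel (σ a) (σ b) (σ c))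
    (hsplit : ∀ z ∈ s, ∃ x ∈ s, ∃ y ∈ s, x ≠ z ∧ y ≠ z ∧ ¬ rel z x y)
    {a b : α} (ha : a ∈ s) (hb : b ∈ s) (hab : a ≠ b) :
    2 * #{z ∈ s | rel z a b} < #s := by
  by_contra! hcon
  have hclass : ∀ z ∈ s, ∀ x ∈ s, x ≠ z → 2 * #{y ∈ s | rel z x y} ≤ #s - 1 := by
    intro z hz x hx hxz
    obtain ⟨w, hw, hwz, hwx⟩ : ∃ w ∈ s, w ≠ z ∧ ¬ rel z x w := by
      obtain ⟨x₁, h₁, x₂, h₂, h₁z, h₂z, h⟩ := hsplit z hz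
      by_cases h' : rel z x x₁
      · exact ⟨x₂, h₂, h₂z, fun h'' => h ((hequiv z).trans ((hequiv z).symm h') h'')⟩
      · exact ⟨x₁, h₁, h₁z, h'⟩
    obtain ⟨σ, hσ, hσs, hσz, hσx, hσr⟩ := htrans z hz x hx hxz.symm z hz w hw hwz.symm
    have hle : #{y ∈ s | rel z x y} ≤ #{y ∈ s | rel z w y} := by
      refine card_le_card_of_injOn σ ?_ hσ.injOn
      intro y hy
      simp only [coe_filter, Set.mem_ofPred_eq] at hy ⊢
      refine ⟨hσs _ hy.1, ?_⟩
      have := hσr _ _ _ hy.2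
      rwa [hσz, hσx] at this
    have hdisj : Disjoint {y ∈ s | rel z x y} {y ∈ s | rel z w y} := by
      rw [disjoint_filter]
      intro y _ h₁ h₂
      exact hwx ((hequiv z).trans h₁ ((hequiv z).symm h₂))
    have hsub : {y ∈ s | rel z x y} ∪ {y ∈ s | rel z w y} ⊆ s.erase z := by
      intro y hy
      simp only [mem_union, mem_filter] at hy
      rw [mem_erase]
      refine ⟨?_, by tauto⟩
      rintro rfl
      rcases hy with hy | hy
      · exact hxz (hself _ _ ((hequiv _).symm hy.2))
      · exact hwz (hself _ _ ((hequiv _).symm hy.2))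
    have := card_le_card hsub
    rw [card_union_of_disjoint hdisj, card_erase_of_mem hz] at this
    omega
  have hpair : ∀ x ∈ s, ∀ y ∈ s.erase x, #s ≤ 2 * #{z ∈ s | rel z x y} := by
    intro x hx y hy
    rw [mem_erase] at hy
    obtain ⟨σ, hσ, hσs, hσa, hσb, hσr⟩ := htrans a ha b hb hab x hx y hy.2 hy.1.symm
    refine hcon.trans (Nat.mul_le_mul_left _ (card_le_card_of_injOn σ ?_ hσ.injOn))
    intro z hz
    simp only [coe_filter, Set.mem_ofPred_eq] at hz ⊢
    refine ⟨hσs _ hz.1, ?_⟩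
    have := hσr _ _ _ hz.2
    rwa [hσa, hσb] at this
  have hcount : ∑ x ∈ s, ∑ y ∈ s.erase x, 2 * #{z ∈ s | rel z x y} =
      ∑ z ∈ s, ∑ x ∈ s, 2 * #{y ∈ s.erase x | rel z x y} := by
    simp only [card_filter, mul_sum]
    rw [sum_comm (s := s) (t := s)]
    exact sum_congr rfl fun x _ => sum_comm
  have hlow : #s * ((#s - 1) * #s) ≤ ∑ x ∈ s, ∑ y ∈ s.erase x, 2 * #{z ∈ s | rel z x y} := by
    rw [← smul_eq_mul]
    refine card_nsmul_le_sum _ _ _ fun x hx => ?_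
    rw [← smul_eq_mul, ← card_erase_of_mem hx]
    exact card_nsmul_le_sum _ _ _ fun y hy => hpair x hx y hy
  have hupp : ∑ z ∈ s, ∑ x ∈ s, 2 * #{y ∈ s.erase x | rel z x y} ≤
      #s * ((#s - 1) * (#s - 1)) := by
    rw [← smul_eq_mul]
    refine sum_le_card_nsmul _ _ _ fun z hz => ?_
    rw [← add_sum_erase _ _ hz]
    have h0 : #{y ∈ s.erase z | rel z z y} = 0 := by
      rw [card_eq_zero, filter_eq_empty_iff]
      exact fun y hy h => (mem_erase.1 hy).1 (hself _ _ h)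
    rw [h0, mul_zero, zero_add, ← smul_eq_mul (a := #s - 1), ← card_erase_of_mem hz]
    refine sum_le_card_nsmul _ _ _ fun x hx => ?_
    rw [mem_erase] at hx
    rw [card_erase_of_mem hz]
    refine le_trans (Nat.mul_le_mul_left _ (card_le_card ?_)) (hclass z hz x hx.2 hx.1)
    exact filter_subset_filter _ (erase_subset _ _)
  have hs : 1 < #s := one_lt_card.2 ⟨a, ha, b, hb, hab⟩
  have := hlow.trans (hcount.le.trans hupp)
  have h1 : (#s - 1) * #s ≤ (#s - 1) * (#s - 1) := Nat.le_of_mul_le_mul_left this (by omega)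
  have h2 : #s ≤ #s - 1 := Nat.le_of_mul_le_mul_left h1 (by omega)
  omega

namespace Valuation

variable {L Γ : Type*} [Field L] [LinearOrderedCommGroupWithZero Γ] (v : Valuation L Γ)

theorem map_natCast_le_one (n : ℕ) : v (n : L) ≤ 1 := by
  induction n with
  | zero => simp
  | succ n ih =>
    rw [Nat.cast_succ]
    exact v.map_add_le ih v.map_one.le

theorem map_pow_sub_pow_le {a b : L} {w : Γ} (ha : v a ≤ w) (hb : v b ≤ w) (n : ℕ) :
    v (a ^ (n + 1) - b ^ (n + 1)) ≤ v (a - b) * w ^ n := by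
  rw [← geom_sum₂_mul, map_mul, mul_comm]
  refine mul_le_mul_right (v.map_sum_le fun j hj => ?_) _
  rw [Finset.mem_range] at hj
  rw [map_mul, map_pow, map_pow]
  calc v a ^ j * v b ^ (n + 1 - 1 - j) ≤ w ^ j * w ^ (n + 1 - 1 - j) := by gcongr
    _ = w ^ n := by rw [← pow_add]; congr 1; omega

theorem map_pow_sub_pow_lt {a b : L} {w : Γ} (ha : v a = w) (hb : v b = w) (h : v (a - b) < w)
    (n : ℕ) : v (a ^ (n + 1) - b ^ (n + 1)) < w ^ (n + 1) := by
  have hw : 0 < w := zero_le.trans_lt h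
  refine (v.map_pow_sub_pow_le ha.le hb.le n).trans_lt ?_
  rw [pow_succ']
  exact mul_lt_mul_of_pos_right h (pow_pos hw n)

theorem map_pow_sub_pow_eq {a b : L} {w : Γ} (ha : v a = w) (hb : v b = w) (h : v (a - b) < w)
    (n : ℕ) (hn : v ((n + 1 : ℕ) : L) = 1) :
    v (a ^ (n + 1) - b ^ (n + 1)) = v (a - b) * w ^ n := by
  have hw : 0 < w := zero_le.trans_lt h
  rw [← geom_sum₂_mul, map_mul, mul_comm]
  congr 1
  have hlead : v (((n + 1 : ℕ) : L) * b ^ n) = w ^ n := by rw [map_mul, hn, map_pow, hb, one_mul]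
  rw [← hlead]
  refine v.map_eq_of_sub_lt ?_
  rw [hlead]
  have : (∑ j ∈ Finset.range (n + 1), a ^ j * b ^ (n + 1 - 1 - j)) - ((n + 1 : ℕ) : L) * b ^ n =
      ∑ j ∈ Finset.range (n + 1), (a ^ j - b ^ j) * b ^ (n - j) := by
    rw [← nsmul_eq_mul, ← Finset.card_range (n + 1), ← Finset.sum_const, Finset.card_range,
      ← Finset.sum_sub_distrib]
    refine Finset.sum_congr rfl fun j hj => ?_
    rw [Finset.mem_range] at hj
    rw [sub_mul, ← pow_add, Nat.add_sub_cancel, Nat.add_sub_cancel' (by omega)]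
  rw [this]
  refine v.map_sum_lt (pow_pos hw n).ne' fun j hj => ?_
  rw [Finset.mem_range] at hj
  rcases j with _ | j
  · simp [hw]
  · calc v ((a ^ (j + 1) - b ^ (j + 1)) * b ^ (n - (j + 1)))
        = v (a ^ (j + 1) - b ^ (j + 1)) * w ^ (n - (j + 1)) := by rw [map_mul, map_pow, hb]
      _ < w ^ (j + 1) * w ^ (n - (j + 1)) :=
        mul_lt_mul_of_pos_right (v.map_pow_sub_pow_lt ha hb h j) (pow_pos hw _)
      _ = w ^ n := by rw [← pow_add, Nat.add_sub_cancel' (by omega)]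

theorem map_prod_sub_pow [DecidableEq L] {w : Γ} {q : ℕ} (s : Finset L) (b : L)
    (hle : ∀ y ∈ s, v (y - b) ≤ w) (hlt : ∀ y ∈ s, v (y - b) < w → v (y - b) ^ q = w) :
    v (∏ y ∈ s, (b - y)) ^ q =
      w ^ ({y ∈ s | v (y - b) < w}.card + q * (s.card - {y ∈ s | v (y - b) < w}.card)) := by
  have : v (∏ y ∈ s, (b - y)) ^ q = ∏ y ∈ s, if v (y - b) < w then w else w ^ q := by
    rw [map_prod, ← Finset.prod_pow]
    refine Finset.prod_congr rfl fun y hy => ?_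
    rw [v.map_sub_swap]
    split_ifs with h
    · exact hlt y hy h
    · rw [le_antisymm (hle y hy) (not_lt.1 h)]
  rw [this, Finset.prod_ite, Finset.prod_const, Finset.prod_const, pow_add, pow_mul]
  congr 2
  have := Finset.card_filter_add_card_filter_not (s := s) (fun y => v (y - b) < w)
  omega

variable {K : Type*} [Field K] [Algebra K L]

theorem map_aeval_le {z : L} (hv : ∀ c : K, v (algebraMap K L c) ≤ 1) (hz : 1 ≤ v z)
    (r : Polynomial K) : v (Polynomial.aeval z r) ≤ v z ^ r.natDegree := by
  rw [Polynomial.aeval_eq_sum_range]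
  refine v.map_sum_le fun j hj => ?_
  rw [Finset.mem_range] at hj
  rw [Algebra.smul_def, map_mul, map_pow]
  calc _ ≤ 1 * v z ^ j := mul_le_mul_left (hv _) _
    _ ≤ _ := by rw [one_mul]; exact pow_le_pow_right₀ hz (by omega)

theorem map_aeval_eq {z : L} (hv : ∀ c : K, c ≠ 0 → v (algebraMap K L c) = 1) (hz : 1 < v z)
    {r : Polynomial K} (hr : r ≠ 0) : v (Polynomial.aeval z r) = v z ^ r.natDegree := by
  have hv' : ∀ c : K, v (algebraMap K L c) ≤ 1 := fun c => by
    rcases eq_or_ne c 0 with rfl | hc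
    · simp
    · exact (hv c hc).le
  have hlead : v (algebraMap K L r.leadingCoeff * z ^ r.natDegree) = v z ^ r.natDegree := by
    rw [map_mul, hv _ (Polynomial.leadingCoeff_ne_zero.2 hr), one_mul, map_pow]
  rw [← hlead]
  refine v.map_eq_of_sub_lt ?_
  rw [hlead]
  have : Polynomial.aeval z r - algebraMap K L r.leadingCoeff * z ^ r.natDegree =
      Polynomial.aeval z r.eraseLead := by
    have := congrArg (Polynomial.aeval z) r.eraseLead_add_C_mul_X_pow
    simp only [map_add, map_mul, Polynomial.aeval_C, map_pow, Polynomial.aeval_X] at this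
    rw [← this, add_sub_cancel_right]
  rw [this]
  rcases eq_or_ne r.eraseLead 0 with h0 | h0
  · rw [h0, map_zero, map_zero]
    exact pow_pos (zero_lt_one.trans hz) _
  · refine (v.map_aeval_le hv' hz.le _).trans_lt (pow_lt_pow_right₀ hz ?_)
    exact Polynomial.natDegree_lt_natDegree h0 (Polynomial.degree_eraseLead_lt hr)

theorem exists_map_eq_zpow_of_mem_adjoin {z : L} (hv : ∀ c : K, c ≠ 0 → v (algebraMap K L c) = 1)
    (hz : 1 < v z) {a : L} (ha : a ∈ IntermediateField.adjoin K {z}) (ha0 : a ≠ 0) :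
    ∃ d : ℤ, v a = v z ^ d := by
  obtain ⟨r, s, rfl⟩ := (IntermediateField.mem_adjoin_simple_iff K a).1 ha
  have hr : r ≠ 0 := by rintro rfl; simp at ha0
  have hs : s ≠ 0 := by rintro rfl; simp at ha0
  refine ⟨(r.natDegree : ℤ) - s.natDegree, ?_⟩
  rw [map_div₀, v.map_aeval_eq hv hz hr, v.map_aeval_eq hv hz hs,
    zpow_sub₀ (zero_lt_one.trans hz).ne', zpow_natCast, zpow_natCast]

end Valuation

/-- Evaluation of a bivariate polynomial over `K` at a point `(z, x)` of an extension: its inner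
and outer indeterminates are sent to `z` and `x` respectively. -/
def evalAt (K : Type*) {L : Type*} [Field K] [Field L] [Algebra K L] (z x : L) :
    Polynomial (Polynomial K) →+* L :=
  Polynomial.eval₂RingHom (Polynomial.aeval z : Polynomial K →ₐ[K] L).toRingHom x

theorem exists_ringHom_extending {E L M : Type*} [Field E] [Field L] [Field M] [IsAlgClosed M]
    (α : E →+* L) (β : E →+* M) (h : @Algebra.IsAlgebraic E L _ _ α.toAlgebra) :
    ∃ σ : L →+* M, σ.comp α = β := by
  let := α.toAlgebra
  let := β.toAlgebra
  have : Algebra.IsAlgebraic E L := h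
  exact ⟨(IsAlgClosed.lift : L →ₐ[E] M).toRingHom, AlgHom.comp_algebraMap _⟩

theorem exists_algHom_of_irreducible {F L : Type*} [Field F] [Field L] [Algebra F L]
    [IsAlgClosed L] {G : Polynomial (Polynomial F)} (hG : G.Monic) (hirr : Irreducible G)
    {z x z' x' : L} (hz : IsTranscendenceBasis F (fun _ : Unit => z)) (hz' : Transcendental F z')
    (h : evalAt F z x G = 0) (h' : evalAt F z' x' G = 0) :
    ∃ σ : L →ₐ[F] L, σ z = z' ∧ σ x = x' := by
  let E₀ := FractionRing (Polynomial F)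
  let G₀ : Polynomial E₀ := G.map (algebraMap _ E₀)
  have hG₀ : Irreducible G₀ := (hG.irreducible_iff_irreducible_map_fraction_map (K := E₀)).1 hirr
  have : Fact (Irreducible G₀) := ⟨hG₀⟩
  have htz : Transcendental F z := by
    have := hz.1
    exact (algebraicIndependent_unique_type_iff).1 this
  have key : ∀ (u v : L), Transcendental F u → evalAt F u v G = 0 →
      ∃ α : AdjoinRoot G₀ →+* L, (∀ c : F, α (AdjoinRoot.of G₀ (algebraMap (Polynomial F) E₀
        (Polynomial.C c))) = algebraMap F L c) ∧
        α (AdjoinRoot.of G₀ (algebraMap (Polynomial F) E₀ Polynomial.X)) = u ∧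
        α (AdjoinRoot.root G₀) = v := by
    intro u v hu huv
    have hinj : Function.Injective (Polynomial.aeval u : Polynomial F →ₐ[F] L).toRingHom :=
      transcendental_iff_injective.1 hu
    let φ : E₀ →+* L := IsFractionRing.lift hinj
    have hφ : φ.comp (algebraMap (Polynomial F) E₀) =
        (Polynomial.aeval u : Polynomial F →ₐ[F] L).toRingHom := by
      ext1 <;> simp [φ]
      ext; simp
    have hv : G₀.eval₂ φ v = 0 := by
      rw [Polynomial.eval₂_map, hφ]
      exact huv
    refine ⟨AdjoinRoot.lift φ v hv, fun c => ?_, ?_, AdjoinRoot.lift_root hv⟩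
    · rw [AdjoinRoot.lift_of]
      have := congrArg (fun f => f (Polynomial.C c)) hφ
      simpa using this
    · rw [AdjoinRoot.lift_of]
      have := congrArg (fun f => f (Polynomial.X)) hφ
      simpa using this
  obtain ⟨α, hαc, hαz, hαx⟩ := key z x htz h
  obtain ⟨β, hβc, hβz, hβx⟩ := key z' x' hz' h'
  have halg : @Algebra.IsAlgebraic _ L _ _ α.toAlgebra := by
    let := α.toAlgebra
    have := hz.isAlgebraic
    let A := Algebra.adjoin F (Set.range fun _ : Unit => z)
    have hA : ∀ y ∈ A, y ∈ α.range := by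
      intro y hy
      induction hy using Algebra.adjoin_induction with
      | mem y hy => obtain ⟨_, rfl⟩ := hy; exact ⟨_, hαz⟩
      | algebraMap c => exact ⟨_, hαc c⟩
      | add _ _ _ _ h₁ h₂ => exact add_mem h₁ h₂
      | mul _ _ _ _ h₁ h₂ => exact mul_mem h₁ h₂
    let e : AdjoinRoot G₀ ≃+* α.range := RingEquiv.ofBijective α.rangeRestrict
      ⟨α.rangeRestrict.injective, α.rangeRestrict_surjective⟩
    let ι : A →+* AdjoinRoot G₀ := e.symm.toRingHom.comp
      ((A.toSubring.subtype).codRestrict α.range fun y => hA y y.2)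
    have hι : Function.Injective ι := fun a b hab => by
      have := e.symm.injective hab
      exact Subtype.ext (congrArg (fun y : α.range => (y : L)) this)
    refine Algebra.IsAlgebraic.ringHom_of_comp_eq (R := A) (A := L) ι (RingHom.id L) hι
      Function.surjective_id ?_
    ext a
    exact congrArg (fun y : α.range => (y : L)) (e.apply_symm_apply ⟨a, hA a a.2⟩)
  obtain ⟨σ, hσ⟩ := exists_ringHom_extending α β halg
  have hσ' : ∀ y, σ (α y) = β y := fun y => congrArg (fun f => f y) hσ
  refine ⟨{ σ with commutes' := fun c => ?_ }, ?_, ?_⟩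
  · exact (congrArg σ (hαc c).symm).trans ((hσ' _).trans (hβc c))
  · change σ _ = _
    rw [← hβz, ← hσ', hαz]
  · change σ _ = _
    rw [← hβx, ← hσ', hαx]

/-- The difference `(y + 1) ^ t - y ^ t`. -/
def powDiff {L : Type*} [CommRing L] (t : ℕ) (y : L) : L := (y + 1) ^ t - y ^ t

section powDiff

variable {L Γ : Type*} [Field L] [LinearOrderedCommGroupWithZero Γ] (v : Valuation L Γ)
  {p : ℕ} [Fact p.Prime] [CharP L p] {i l : ℕ}

theorem exists_powDiff_eq (hl : 1 < l) {y : L} (hy : 1 < v y) :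
    ∃ r : L, powDiff (p ^ i * l + 1) y = y ^ (p ^ i * l) + l * y ^ (p ^ i * (l - 1) + 1) + r ∧
      v r < v y ^ (p ^ i * (l - 1) + 1) := by
  obtain ⟨m, rfl⟩ : ∃ m, l = m + 2 := ⟨l - 2, by omega⟩
  set q := p ^ i with hq
  have hq2 : 1 ≤ q := Nat.one_le_pow _ _ (Fact.out : p.Prime).pos
  set e : L := ∑ j ∈ Finset.range (m + 1), (y ^ q) ^ j * ((m + 2).choose j : ℕ) with he
  have hexp : (y ^ q + 1) ^ (m + 2) = e + (y ^ q) ^ (m + 1) * ((m + 2 : ℕ) : L) +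
      (y ^ q) ^ (m + 2) := by
    rw [add_pow, Finset.sum_range_succ, Finset.sum_range_succ, Nat.choose_self,
      show (m + 2).choose (m + 1) = m + 2 from Nat.choose_succ_self_right (m + 1)]
    simp [he]
  refine ⟨((m + 2 : ℕ) : L) * (y ^ q) ^ (m + 1) + (y + 1) * e, ?_, ?_⟩
  · rw [powDiff, pow_succ, pow_mul, add_pow_char_pow, one_pow, hexp,
      show m + 2 - 1 = m + 1 by omega, pow_succ y (q * (m + 2)), pow_succ y (q * (m + 1)),
      pow_mul y q (m + 2), pow_mul y q (m + 1)]
    ring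
  · have h1 : v e ≤ v y ^ (q * m) := by
      refine v.map_sum_le fun j hj => ?_
      rw [Finset.mem_range] at hj
      rw [map_mul, ← pow_mul, map_pow]
      calc _ ≤ v y ^ (q * j) * 1 := mul_le_mul_right (v.map_natCast_le_one _) _
        _ ≤ _ := by
          rw [mul_one]
          exact pow_le_pow_right₀ hy.le (Nat.mul_le_mul_left _ (by omega))
    rw [show m + 2 - 1 = m + 1 by omega]
    have h2 : v y ^ (q * (m + 1)) < v y ^ (q * (m + 1) + 1) :=
      pow_lt_pow_right₀ hy (Nat.lt_succ_self _)
    refine lt_of_le_of_lt (v.map_add_le ?_ ?_) h2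
    · rw [map_mul, ← pow_mul, map_pow]
      calc _ ≤ 1 * v y ^ (q * (m + 1)) := mul_le_mul_left (v.map_natCast_le_one _) _
        _ = _ := one_mul _
    · have h3 : v (y + 1) ≤ v y := v.map_add_le le_rfl (by rw [map_one]; exact hy.le)
      calc v ((y + 1) * e) ≤ v y * v y ^ (q * m) := by rw [map_mul]; gcongr
        _ = v y ^ (q * m + 1) := (pow_succ' _ _).symm
        _ ≤ _ := pow_le_pow_right₀ hy.le (by rw [mul_add]; omega)

theorem map_powDiff (hl : 1 < l) (hi : 1 ≤ i) {y : L} (hy : 1 < v y) :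
    v (powDiff (p ^ i * l + 1) y) = v y ^ (p ^ i * l) := by
  obtain ⟨r, hr, hvr⟩ := exists_powDiff_eq (p := p) (i := i) v hl hy
  have hq2 : 1 < p ^ i := Nat.one_lt_pow (by omega) (Fact.out : p.Prime).one_lt
  have hk : p ^ i * (l - 1) + 1 < p ^ i * l := by
    obtain ⟨m, rfl⟩ : ∃ m, l = m + 1 := ⟨l - 1, by omega⟩
    rw [Nat.add_sub_cancel, mul_add]; omega
  have hlt := pow_lt_pow_right₀ hy hk
  rw [← map_pow v y (p ^ i * l)]
  refine v.map_eq_of_sub_lt ?_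
  rw [hr, add_assoc, add_sub_cancel_left, map_pow]
  refine lt_of_le_of_lt (v.map_add_le ?_ hvr.le) hlt
  rw [map_mul, map_pow]
  calc _ ≤ 1 * v y ^ (p ^ i * (l - 1) + 1) := mul_le_mul_left (v.map_natCast_le_one _) _
    _ = _ := one_mul _

theorem map_eq_of_powDiff_eq (hl : 1 < l) (hi : 1 ≤ i) {y z : L} (hz : 1 < v z)
    (h : powDiff (p ^ i * l + 1) y = powDiff (p ^ i * l + 1) z) : v y = v z := by
  have hvz := map_powDiff (p := p) v hl hi hz
  have hq2 : 0 < p ^ i := Nat.pow_pos (Fact.out : p.Prime).pos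
  have hn : p ^ i * l ≠ 0 := by positivity
  have hy : 1 < v y := by
    by_contra! hy
    have h1 : v (powDiff (p ^ i * l + 1) y) ≤ 1 := by
      refine v.map_sub_le ?_ ?_
      · rw [map_pow]
        exact pow_le_one₀ zero_le (v.map_add_le hy v.map_one.le)
      · rw [map_pow]
        exact pow_le_one₀ zero_le hy
    rw [h, hvz] at h1
    exact (one_lt_pow₀ hz hn).not_ge h1
  have := map_powDiff (p := p) v hl hi hy
  rw [h, hvz] at this
  exact ((pow_left_inj₀ zero_le zero_le hn).1 this).symm

variable {ζ z y : L}

theorem pow_ne_one_of_pow_sub_one_ne_one {q : ℕ} (hq : 1 ≤ q) (hl : 1 < l) (hζ : ζ ^ l = 1)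
    (hζq : ζ ^ (q - 1) ≠ 1) : ζ ^ (q * (l - 1) + 1) ≠ 1 := by
  intro h
  apply hζq
  have : ζ ^ (q * (l - 1) + 1) * ζ ^ (q - 1) = 1 := by
    rw [← pow_add, show q * (l - 1) + 1 + (q - 1) = l * q by
      obtain ⟨m, rfl⟩ : ∃ m, l = m + 1 := ⟨l - 1, by omega⟩
      rw [Nat.add_sub_cancel, add_mul, mul_comm]; omega, pow_mul, hζ, one_pow]
  rwa [h, one_mul] at this

/-- Near the direction of a root of unity `ζ` of order prime to `p ^ i - 1`, the polynomial
`powDiff` has exact growth. -/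
theorem map_powDiff_mul_sub (hl : 1 < l) (hvl : v (l : L) = 1) (hz : 1 < v z)
    (hζ : ζ ^ l = 1)
    (hζk : v (ζ ^ (p ^ i * (l - 1) + 1) - 1) = 1) :
    v (powDiff (p ^ i * l + 1) (ζ * z) - powDiff (p ^ i * l + 1) z) =
      v z ^ (p ^ i * (l - 1) + 1) := by
  have hvζ : v ζ = 1 := by
    have := congrArg v hζ
    rw [map_pow, map_one] at this
    exact (pow_eq_one_iff_of_nonneg zero_le (by omega)).1 this
  have hvζz : v (ζ * z) = v z := by rw [map_mul, hvζ, one_mul]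
  obtain ⟨r, hr, hvr⟩ := exists_powDiff_eq (p := p) (i := i) v hl hz
  obtain ⟨r', hr', hvr'⟩ := exists_powDiff_eq (p := p) (i := i) v hl (y := ζ * z) (by rwa [hvζz])
  rw [hvζz] at hvr'
  set k := p ^ i * (l - 1) + 1
  have hmain : v ((l : L) * (ζ ^ k - 1) * z ^ k) = v z ^ k := by
    rw [map_mul, map_mul, hvl, hζk, map_pow, one_mul, one_mul]
  rw [← hmain]
  refine v.map_eq_of_sub_lt ?_
  rw [hmain, hr, hr', mul_pow ζ z (p ^ i * l), mul_comm (p ^ i) l, pow_mul ζ, hζ, one_pow, mul_pow,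
    show 1 * z ^ (l * p ^ i) + ↑l * (ζ ^ k * z ^ k) + r' - (z ^ (l * p ^ i) + ↑l * z ^ k + r) -
      ↑l * (ζ ^ k - 1) * z ^ k = r' - r by ring]
  exact v.map_sub_lt hvr' hvr

theorem map_sub_mul_pow_eq (hl : 1 < l) (hi : 1 ≤ i) (hvl : v (l : L) = 1) (hz : 1 < v z)
    (hζ : ζ ^ l = 1) (hζk : v (ζ ^ (p ^ i * (l - 1) + 1) - 1) = 1)
    (h : powDiff (p ^ i * l + 1) y = powDiff (p ^ i * l + 1) z) (hyz : v (y - ζ * z) < v z) :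
    v (y - ζ * z) ^ (p ^ i) = v z := by
  have hvζ : v ζ = 1 := by
    have := congrArg v hζ
    rw [map_pow, map_one] at this
    exact (pow_eq_one_iff_of_nonneg zero_le (by omega)).1 this
  have hvζz : v (ζ * z) = v z := by rw [map_mul, hvζ, one_mul]
  have hvy := map_eq_of_powDiff_eq (p := p) v hl hi hz h
  have hpow : v (y ^ l - z ^ l) = v (y - ζ * z) * v z ^ (l - 1) := by
    obtain ⟨m, rfl⟩ : ∃ m, l = m + 1 := ⟨l - 1, by omega⟩
    have := v.map_pow_sub_pow_eq hvy hvζz hyz m hvl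
    rwa [mul_pow, hζ, one_mul] at this
  obtain ⟨r, hr, hvr⟩ := exists_powDiff_eq (p := p) (i := i) v hl hz
  obtain ⟨r', hr', hvr'⟩ := exists_powDiff_eq (p := p) (i := i) v hl (y := y) (by rwa [hvy])
  rw [hvy] at hvr'
  have hyk := v.map_pow_sub_pow_lt hvy hvζz hyz (p ^ i * (l - 1))
  set k := p ^ i * (l - 1) + 1 with hk
  have hmain : v ((l : L) * (ζ ^ k - 1) * z ^ k) = v z ^ k := by
    rw [map_mul, map_mul, hvl, hζk, map_pow, one_mul, one_mul]
  have hq : v (-(y ^ l - z ^ l) ^ p ^ i) = v z ^ k := by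
    rw [← hmain]
    refine v.map_eq_of_sub_lt ?_
    rw [hmain, sub_pow_char_pow, ← pow_mul, ← pow_mul, mul_comm l]
    rw [hr, hr'] at h
    rw [show -(y ^ (p ^ i * l) - z ^ (p ^ i * l)) - ↑l * (ζ ^ k - 1) * z ^ k =
      l * (y ^ k - (ζ * z) ^ k) + (r' - r) by rw [mul_pow]; linear_combination -h]
    refine v.map_add_lt ?_ (v.map_sub_lt hvr' hvr)
    rwa [map_mul, hvl, one_mul]
  rw [v.map_neg, map_pow, hpow, mul_pow, ← pow_mul, mul_comm (l - 1), hk, pow_succ'] at hq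
  exact mul_right_cancel₀ (pow_ne_zero _ (zero_lt_one.trans hz).ne') hq

end powDiff

section powDiff

theorem eval_powDiff_X {R : Type*} [CommRing R] (t : ℕ) (b : R) :
    (powDiff t (Polynomial.X : Polynomial R)).eval b = powDiff t b := by
  simp [powDiff]

theorem map_powDiff_X {R S : Type*} [CommRing R] [CommRing S] (f : R →+* S) (t : ℕ) :
    (powDiff t (Polynomial.X : Polynomial R)).map f = powDiff t Polynomial.X := by
  simp [powDiff]

theorem powDiff_sub_eq_prod {L : Type*} [Field L] {t : ℕ} {s : L} {Ω : Finset L}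
    (hΩ : powDiff (t) Polynomial.X - Polynomial.C s =
      ∏ y ∈ Ω, (Polynomial.X - Polynomial.C y)) (b : L) :
    powDiff (t) b - s = ∏ y ∈ Ω, (b - y) := by
  have := congrArg (Polynomial.eval b) hΩ
  simpa [Polynomial.eval_prod, eval_powDiff_X] using this

theorem powDiff_eq_iff_mem {L : Type*} [Field L] {t : ℕ} {s : L} {Ω : Finset L}
    (hΩ : powDiff (t) Polynomial.X - Polynomial.C s =
      ∏ y ∈ Ω, (Polynomial.X - Polynomial.C y)) {b : L} :
    powDiff (t) b = s ↔ b ∈ Ω := by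
  rw [← sub_eq_zero, powDiff_sub_eq_prod hΩ, Finset.prod_eq_zero_iff]
  simp [sub_eq_zero]

variable {K L Γ : Type*} [Field K] [Field L] [Algebra K L] [LinearOrderedCommGroupWithZero Γ]
  (v : Valuation L Γ) {p : ℕ} [Fact p.Prime] [CharP L p] {i l : ℕ} {s : L} {Ω : Finset L}

variable {ζ z : L}

theorem map_prod_sub_root_mul_pow [DecidableEq L] (hl : 1 < l) (hi : 1 ≤ i) (hvl : v (l : L) = 1)
    (hz : 1 < v z) (hζ : ζ ^ l = 1) (hζk : v (ζ ^ (p ^ i * (l - 1) + 1) - 1) = 1)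
    (hzs : powDiff (p ^ i * l + 1) z = s) {S : Finset L}
    (hS : ∀ y ∈ S, powDiff (p ^ i * l + 1) y = s) :
    v (∏ y ∈ S, (ζ * z - y)) ^ p ^ i = v z ^ ({y ∈ S | v (y - ζ * z) < v z}.card +
      p ^ i * (S.card - {y ∈ S | v (y - ζ * z) < v z}.card)) := by
  have hvζ : v ζ = 1 := by
    have := congrArg v hζ
    rw [map_pow, map_one] at this
    exact (pow_eq_one_iff_of_nonneg zero_le (by omega)).1 this
  refine v.map_prod_sub_pow S (ζ * z) (fun y hy => ?_) fun y hy hlt => ?_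
  · refine v.map_sub_le ?_ (by rw [map_mul, hvζ, one_mul])
    exact (map_eq_of_powDiff_eq (p := p) v hl hi hz ((hS y hy).trans hzs.symm)).le
  · exact map_sub_mul_pow_eq v hl hi hvl hz hζ hζk ((hS y hy).trans hzs.symm) hlt

theorem card_filter_map_sub_root_mul_lt [DecidableEq L] (hl : 1 < l) (hi : 1 ≤ i)
    (hvl : v (l : L) = 1) (hz : 1 < v z) (hζ : ζ ^ l = 1)
    (hζk : v (ζ ^ (p ^ i * (l - 1) + 1) - 1) = 1)
    (hΩ : powDiff (p ^ i * l + 1) Polynomial.X - Polynomial.C s =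
      ∏ y ∈ Ω, (Polynomial.X - Polynomial.C y))
    (hcard : Ω.card = p ^ i * l) (hzΩ : z ∈ Ω) :
    {y ∈ Ω | v (y - ζ * z) < v z}.card = p ^ i := by
  have hq : 1 < p ^ i := Nat.one_lt_pow (by omega) (Fact.out : p.Prime).one_lt
  have hzs := (powDiff_eq_iff_mem hΩ).2 hzΩ
  have h1 := map_prod_sub_root_mul_pow v hl hi hvl hz hζ hζk hzs (S := Ω)
    fun y hy => (powDiff_eq_iff_mem hΩ).2 hy
  rw [← powDiff_sub_eq_prod hΩ, ← hzs, map_powDiff_mul_sub v hl hvl hz hζ hζk, ← pow_mul,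
    hcard] at h1
  have h2 := pow_right_injective₀ (zero_lt_one.trans hz) hz.ne' h1
  have hle : {y ∈ Ω | v (y - ζ * z) < v z}.card ≤ p ^ i * l := by
    rw [← hcard]; exact Finset.card_filter_le _ _
  generalize {y ∈ Ω | v (y - ζ * z) < v z}.card = m at h2 hle
  generalize p ^ i = q at *
  obtain ⟨k, rfl⟩ : ∃ k, l = k + 1 := ⟨l - 1, by omega⟩
  rw [Nat.add_sub_cancel] at h2
  zify [hle] at h2
  have h3 : ((q : ℤ) - 1) * (m - q) = 0 := by linear_combination h2
  rcases mul_eq_zero.1 h3 with h | h <;> omega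

theorem evalAt_eq_zero_of_map_sub_lt [IsAlgClosed L] (hl : 1 < l) (hi : 1 ≤ i)
    (hv : ∀ c : K, c ≠ 0 → v (algebraMap K L c) = 1) (hvl : v (l : L) = 1) (hz : 1 < v z)
    {ζ : K} (hζ : ζ ^ l = 1) (hζk : ζ ^ (p ^ i * (l - 1) + 1) ≠ 1)
    (hΩ : powDiff (p ^ i * l + 1) Polynomial.X - Polynomial.C s =
      ∏ y ∈ Ω, (Polynomial.X - Polynomial.C y))
    (hcard : Ω.card = p ^ i * l) (hzΩ : z ∈ Ω) {x x' : L} (hx : x ∈ Ω) (hx' : x' ∈ Ω)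
    (hxz : v (x - algebraMap K L ζ * z) < v z) (hxz' : v (x' - algebraMap K L ζ * z) < v z)
    {R : Polynomial (Polynomial K)} (hR : evalAt K z x R = 0) : evalAt K z x' R = 0 := by
  classical
  have hζ' : algebraMap K L ζ ^ l = 1 := by rw [← map_pow, hζ, map_one]
  have hζk' : v (algebraMap K L ζ ^ (p ^ i * (l - 1) + 1) - 1) = 1 := by
    rw [← map_pow, ← map_one (algebraMap K L), ← map_sub]
    exact hv _ (sub_ne_zero.2 hζk)
  have hq : 0 < p ^ i := Nat.pow_pos (Fact.out : p.Prime).pos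
  have hzs := (powDiff_eq_iff_mem hΩ).2 hzΩ
  let E := IntermediateField.adjoin K {z}
  let z₀ : E := IntermediateField.AdjoinSimple.gen K z
  let P : Polynomial E := powDiff (p ^ i * l + 1) Polynomial.X -
    Polynomial.C (powDiff (p ^ i * l + 1) z₀)
  have hP : P.map (algebraMap E L) = ∏ y ∈ Ω, (Polynomial.X - Polynomial.C y) := by
    rw [← hΩ, ← hzs, Polynomial.map_sub, map_powDiff_X, Polynomial.map_C]
    simp [powDiff, z₀]
  have hP0 : P.map (algebraMap E L) ≠ 0 := by
    rw [hP]; exact (Polynomial.monic_prod_X_sub_C _ _).ne_zero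
  have hPx : Polynomial.aeval x P = 0 := by
    rw [← Polynomial.eval_map_algebraMap, hP, Polynomial.eval_prod]
    exact Finset.prod_eq_zero hx (by simp)
  have hint : IsIntegral E x := by
    refine IsAlgebraic.isIntegral ⟨P, ?_, hPx⟩
    rintro h
    simp [h] at hP0
  set M := minpoly E x with hM
  have hMP : M.map (algebraMap E L) ∣ P.map (algebraMap E L) :=
    Polynomial.map_dvd _ (minpoly.dvd E x hPx)
  have hPr : (P.map (algebraMap E L)).roots = Ω.val := by
    rw [hP]; exact Polynomial.roots_prod_X_sub_C Ω
  have hMr : (M.map (algebraMap E L)).roots ≤ Ω.val := hPr ▸ Polynomial.roots.le_of_dvd hP0 hMP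
  let S : Finset L := ⟨(M.map (algebraMap E L)).roots, Multiset.nodup_of_le hMr Ω.nodup⟩
  have hSΩ : S ⊆ Ω := Finset.val_le_iff.1 hMr
  have hMS : M.map (algebraMap E L) = ∏ y ∈ S, (Polynomial.X - Polynomial.C y) :=
    (IsAlgClosed.splits _).eq_prod_roots_of_monic ((minpoly.monic hint).map _)
  have hmem : ∀ y, y ∈ S ↔ Polynomial.aeval y M = 0 := by
    intro y
    rw [← Polynomial.eval_map_algebraMap, hMS, Polynomial.eval_prod, Finset.prod_eq_zero_iff]
    simp [sub_eq_zero]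
  have hval : algebraMap E L (M.eval (algebraMap K E ζ * z₀)) =
      ∏ y ∈ S, (algebraMap K L ζ * z - y) := by
    have := congrArg (Polynomial.eval (algebraMap E L (algebraMap K E ζ * z₀))) hMS
    rw [Polynomial.eval_map_apply, Polynomial.eval_prod] at this
    simpa [z₀] using this
  have hne : ∏ y ∈ S, (algebraMap K L ζ * z - y) ≠ 0 := by
    rw [Finset.prod_ne_zero_iff]
    intro y hy h
    have h1 := map_powDiff_mul_sub v hl hvl hz hζ' hζk'
    rw [hzs, sub_eq_zero.1 h, (powDiff_eq_iff_mem hΩ).2 (hSΩ hy), sub_self, map_zero] at h1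
    exact (pow_pos (zero_lt_one.trans hz) _).ne h1
  obtain ⟨d, hd⟩ := v.exists_map_eq_zpow_of_mem_adjoin hv hz
    (hval ▸ (M.eval (algebraMap K E ζ * z₀)).2) hne
  have hpow := map_prod_sub_root_mul_pow v hl hi hvl hz hζ' hζk' hzs (S := S)
    fun y hy => (powDiff_eq_iff_mem hΩ).2 (hSΩ hy)
  have hcardΩ := card_filter_map_sub_root_mul_lt v hl hi hvl hz hζ' hζk' hΩ hcard hzΩ
  have hxS : x ∈ S := (hmem x).2 (minpoly.aeval E x)
  have hdvd : p ^ i ∣ {y ∈ S | v (y - algebraMap K L ζ * z) < v z}.card := by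
    rw [hd, ← zpow_natCast, ← zpow_mul, ← zpow_natCast] at hpow
    have := zpow_right_injective₀ (zero_lt_one.trans hz) hz.ne' hpow
    rw [← Int.natCast_dvd_natCast]
    rw [Nat.cast_add, Nat.cast_mul] at this
    exact (Int.dvd_add_left ⟨_, rfl⟩).1 ⟨d, by rw [← this, mul_comm]⟩
  have hsub : {y ∈ S | v (y - algebraMap K L ζ * z) < v z} ⊆
      {y ∈ Ω | v (y - algebraMap K L ζ * z) < v z} := Finset.filter_subset_filter _ hSΩ
  have hpos : 0 < {y ∈ S | v (y - algebraMap K L ζ * z) < v z}.card :=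
    Finset.card_pos.2 ⟨x, Finset.mem_filter.2 ⟨hxS, hxz⟩⟩
  have heq := Finset.eq_of_subset_of_card_le hsub (hcardΩ.le.trans (Nat.le_of_dvd hpos hdvd))
  have hxS' : x' ∈ S := by
    have : x' ∈ {y ∈ Ω | v (y - algebraMap K L ζ * z) < v z} := Finset.mem_filter.2 ⟨hx', hxz'⟩
    rw [← heq] at this
    exact (Finset.mem_filter.1 this).1
  let ev : Polynomial K →+* E := (Polynomial.aeval z₀ : Polynomial K →ₐ[K] E).toRingHom
  have hev : ∀ y, evalAt K z y R = Polynomial.aeval y (R.map ev) := by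
    intro y
    rw [Polynomial.aeval_def, Polynomial.eval₂_map]
    have : (algebraMap E L).comp ev = (Polynomial.aeval z : Polynomial K →ₐ[K] L).toRingHom := by
      ext <;> simp [ev, z₀]
    rw [this]
    rfl
  rw [hev] at hR ⊢
  obtain ⟨Q, hQ⟩ := minpoly.dvd E x hR
  rw [hQ, map_mul, ← hM, (hmem x').1 hxS', zero_mul]

end powDiff

theorem monic_powDiff_X {R : Type*} [CommRing R] {p : ℕ} [Fact p.Prime] [CharP R p] {i l : ℕ}
    (hi : 1 ≤ i) : (powDiff (p ^ i * l + 1) (Polynomial.X : Polynomial R)).Monic ∧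
      (powDiff (p ^ i * l + 1) (Polynomial.X : Polynomial R)).natDegree = p ^ i * l := by
  have : Nontrivial R := CharP.nontrivial_of_char_ne_one (Fact.out : p.Prime).one_lt.ne'
  set f := powDiff (p ^ i * l + 1) (Polynomial.X : Polynomial R) with hf
  have hcoeff : ∀ n, f.coeff n = ((p ^ i * l + 1).choose n : R) -
      if n = p ^ i * l + 1 then 1 else 0 := fun n => by
    rw [hf, powDiff, Polynomial.coeff_sub, Polynomial.coeff_X_add_one_pow, Polynomial.coeff_X_pow]
  have hdeg : f.natDegree ≤ p ^ i * l := by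
    rw [Polynomial.natDegree_le_iff_coeff_eq_zero]
    intro n hn
    rw [hcoeff]
    rcases (Nat.succ_le_of_lt hn).eq_or_lt with rfl | hlt
    · simp
    · rw [if_neg (by omega), Nat.choose_eq_zero_of_lt (by omega)]
      simp
  have hlead : f.coeff (p ^ i * l) = 1 := by
    rw [hcoeff, if_neg (by omega), Nat.choose_succ_self_right]
    have : p ^ i = p * p ^ (i - 1) := by rw [← pow_succ', Nat.sub_add_cancel hi]
    simp [this]
  refine ⟨Polynomial.monic_of_natDegree_le_of_coeff_eq_one _ hdeg hlead,
    le_antisymm hdeg (Polynomial.le_natDegree_of_ne_zero ?_)⟩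
  rw [hlead]
  exact one_ne_zero

theorem exists_powDiff_sub_eq_prod {F L : Type*} [Field F] [Field L] [Algebra F L] [IsAlgClosed L]
    {p : ℕ} [Fact p.Prime] [CharP F p] {i l : ℕ} (hi : 1 ≤ i) (hl : 1 < l) {x : L}
    (hx : Transcendental F x) : ∃ Ω : Finset L,
      powDiff (p ^ i * l + 1) Polynomial.X - Polynomial.C (powDiff (p ^ i * l + 1) x) =
        ∏ y ∈ Ω, (Polynomial.X - Polynomial.C y) ∧
      Ω.card = p ^ i * l ∧ ∀ z ∈ Ω, Transcendental F z := by
  have : CharP L p := charP_of_injective_algebraMap (algebraMap F L).injective p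
  have hq : 0 < p ^ i := Nat.pow_pos (Fact.out : p.Prime).pos
  have hql : p ^ i * l ≠ 0 := by positivity
  obtain ⟨hmF, hdF⟩ := monic_powDiff_X (R := F) (p := p) (l := l) hi
  obtain ⟨hmL, hdL⟩ := monic_powDiff_X (R := L) (p := p) (l := l) hi
  set f : Polynomial L := powDiff (p ^ i * l + 1) Polynomial.X -
    Polynomial.C (powDiff (p ^ i * l + 1) x) with hf
  have hfm : f.Monic := hmL.sub_of_left <| by
    rw [Polynomial.degree_eq_natDegree hmL.ne_zero, hdL]
    exact Polynomial.degree_C_le.trans_lt (by exact_mod_cast Nat.pos_of_ne_zero hql)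
  have hfd : f.natDegree = p ^ i * l := by
    rw [hf, Polynomial.natDegree_sub_C, hdL]
  have haeval : ∀ (t : ℕ) (y : L), Polynomial.aeval y (powDiff t (Polynomial.X : Polynomial F)) =
      powDiff t y := fun t y => by simp [powDiff]
  have htr : ∀ y, f.eval y = 0 → Transcendental F y := by
    intro y hy hay
    rw [hf, Polynomial.eval_sub, eval_powDiff_X, Polynomial.eval_C, sub_eq_zero, ← haeval,
      ← haeval] at hy
    have h1 : Transcendental F (Polynomial.aeval x (powDiff (p ^ i * l + 1)
        (Polynomial.X : Polynomial F))) := by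
      refine hx.aeval _ (by rwa [hdF]) ?_
      rw [hmF.leadingCoeff]
      exact one_mem _
    rw [← hy] at h1
    exact (transcendental_aeval_iff.1 h1).1 hay
  have hder : Polynomial.derivative f = (powDiff (p ^ i * l) (Polynomial.X : Polynomial F)).map
      (algebraMap F L) := by
    have : p ^ i = p * p ^ (i - 1) := by rw [← pow_succ', Nat.sub_add_cancel hi]
    rw [map_powDiff_X, hf, powDiff, powDiff, powDiff]
    simp [Polynomial.derivative_pow, this]
  have hsep : f.Separable := by
    rw [Polynomial.separable_def,
      Polynomial.isCoprime_iff_aeval_ne_zero_of_isAlgClosed L L]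
    intro y
    by_contra! h
    refine htr y (by simpa using h.1) ⟨powDiff (p ^ i * l) Polynomial.X, ?_, ?_⟩
    · intro h0
      have := congrArg (Polynomial.eval 0) h0
      rw [eval_powDiff_X] at this
      simp [powDiff, hql] at this
    · rw [← Polynomial.eval_map_algebraMap, ← hder]
      simpa using h.2
  have hsplit : f.Splits := IsAlgClosed.splits f
  refine ⟨⟨f.roots, Polynomial.nodup_roots hsep⟩, hsplit.eq_prod_roots_of_monic hfm, ?_, ?_⟩
  · rw [Finset.card_mk, ← hsplit.natDegree_eq_card_roots, hfd]
  · intro z hz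
    exact htr z (Polynomial.isRoot_of_mem_roots hz)

theorem IsTranscendenceBasis.of_transcendental {F L : Type*} [Field F] [Field L] [Algebra F L]
    {x z : L} (hx : IsTranscendenceBasis F (fun _ : Unit => x)) (hz : Transcendental F z) :
    IsTranscendenceBasis F (fun _ : Unit => z) := by
  have hz' : AlgebraicIndependent F (fun _ : Unit => z) := algebraicIndependent_unique_type_iff.2 hz
  exact hz'.isTranscendenceBasis_of_lift_trdeg_le_of_finite hx.lift_cardinalMk_eq_trdeg.ge

/-- Two points `x`, `y` are related at `z` if `(z, x)` and `(z, y)` satisfy the same algebraic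
relations over `K`. -/
def SameRelations (K : Type*) {L : Type*} [Field K] [Field L] [Algebra K L] (z x y : L) : Prop :=
  ∀ R : Polynomial (Polynomial K), evalAt K z x R = 0 ↔ evalAt K z y R = 0

section SameRelations

variable {K L : Type*} [Field K] [Field L] [Algebra K L]

theorem SameRelations.equivalence (z : L) : Equivalence (SameRelations K z) where
  refl _ _ := Iff.rfl
  symm h R := (h R).symm
  trans h h' R := (h R).trans (h' R)

theorem SameRelations.eq_of_self {z y : L} (h : SameRelations K z z y) : y = z := by
  have := (h (Polynomial.X - Polynomial.C Polynomial.X)).1 (by simp [evalAt])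
  simpa [evalAt, sub_eq_zero] using this

theorem SameRelations.map {F : Type*} [Field F] [Algebra F K] [Algebra F L] [IsScalarTower F K L]
    [Normal F K] (σ : L →ₐ[F] L) {z x y : L} (h : SameRelations K z x y) :
    SameRelations K (σ z) (σ x) (σ y) := by
  intro R
  let θ : K ≃ₐ[F] K := σ.restrictNormal' K
  let R' := R.map (Polynomial.mapRingHom (θ.symm : K →+* K))
  have hθ : ∀ c, σ (algebraMap K L (θ.symm c)) = algebraMap K L c := fun c => by
    rw [← AlgHom.restrictNormal_commutes σ K]
    exact congrArg _ (θ.apply_symm_apply c)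
  have key : ∀ w, σ (evalAt K z w R') = evalAt K (σ z) (σ w) R := by
    intro w
    have : (σ : L →+* L).comp ((evalAt K z w).comp (Polynomial.mapRingHom
        (Polynomial.mapRingHom (θ.symm : K →+* K)))) = evalAt K (σ z) (σ w) := by
      ext c
      · simp [evalAt, hθ]
      · simp [evalAt]
      · simp [evalAt]
    exact congrArg (fun f => f R) this
  rw [← key, ← key, map_eq_zero σ, map_eq_zero σ]
  exact h R'

theorem exists_not_sameRelations [IsAlgClosed L] {P Q : Polynomial (Polynomial K)} (hP : P.Monic)
    (hQ : Q.Monic) (hPd : P.natDegree ≠ 0) (hQd : Q.natDegree ≠ 0) {z : L} {Ω : Finset L}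
    (h : (Polynomial.X - Polynomial.C z) *
        (P * Q).map (Polynomial.aeval z : Polynomial K →ₐ[K] L).toRingHom =
      ∏ y ∈ Ω, (Polynomial.X - Polynomial.C y)) :
    ∃ x ∈ Ω, ∃ y ∈ Ω, x ≠ z ∧ y ≠ z ∧ ¬ SameRelations K z x y := by
  set φ := (Polynomial.aeval z : Polynomial K →ₐ[K] L).toRingHom with hφ
  have hroot : ∀ {f : Polynomial (Polynomial K)}, f.Monic → f.natDegree ≠ 0 →
      ∃ x : L, (f.map φ).eval x = 0 := fun {f} hf hd =>
    IsAlgClosed.exists_root _ fun h0 => hd <| by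
      rw [← hf.natDegree_map φ]
      exact Polynomial.natDegree_eq_zero_iff_degree_le_zero.2 h0.le
  obtain ⟨x, hx⟩ := hroot hP hPd
  obtain ⟨y, hy⟩ := hroot hQ hQd
  rw [Polynomial.map_mul] at h
  have hsep : ((Polynomial.X - Polynomial.C z) * (P.map φ * Q.map φ)).Separable := by
    rw [h]
    exact Polynomial.separable_prod_X_sub_C_iff'.2 fun _ _ _ _ h => h
  have hmem : ∀ w, (P.map φ * Q.map φ).eval w = 0 → w ∈ Ω ∧ w ≠ z := by
    intro w hw
    constructor
    · have := congrArg (Polynomial.eval w) h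
      rw [Polynomial.eval_mul, hw, mul_zero, Polynomial.eval_prod, eq_comm,
        Finset.prod_eq_zero_iff] at this
      simpa [sub_eq_zero] using this
    · rintro rfl
      obtain ⟨a, b, hab⟩ := hsep.isCoprime
      have := congrArg (Polynomial.eval w) hab
      simp only [Polynomial.eval_add, Polynomial.eval_mul (p := a), Polynomial.eval_mul (p := b),
        hw] at this
      simp at this
  obtain ⟨hxΩ, hxz⟩ := hmem x (by rw [Polynomial.eval_mul, hx, zero_mul])
  obtain ⟨hyΩ, hyz⟩ := hmem y (by rw [Polynomial.eval_mul, hy, mul_zero])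
  refine ⟨x, hxΩ, y, hyΩ, hxz, hyz, fun hrel => ?_⟩
  have hPy : (P.map φ).eval y = 0 := by
    rw [Polynomial.eval_map] at hx ⊢
    exact (hrel P).1 hx
  obtain ⟨a, b, hab⟩ := hsep.of_mul_right.isCoprime
  have := congrArg (Polynomial.eval y) hab
  simp [hPy, hy] at this

end SameRelations

theorem exists_valuationSubring_one_lt {F L : Type*} [Field F] [Field L] [Algebra F L]
    {x : L} (hx : Transcendental F x) : ∃ V : ValuationSubring L,
      (∀ c : L, IsAlgebraic F c → c ≠ 0 → V.valuation c = 1) ∧ 1 < V.valuation x := by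
  have hxR : x ∉ (integralClosure F L).toSubring := fun h =>
    hx (isAlgebraic_iff_isIntegral.2 h)
  have : IsIntegrallyClosedIn (integralClosure F L).toSubring L :=
    inferInstanceAs (IsIntegrallyClosedIn (integralClosure F L) L)
  obtain ⟨V, hV, hxV⟩ := Subring.exists_le_valuationSubring_of_isIntegrallyClosedIn hxR
  have hle : ∀ c : L, IsAlgebraic F c → V.valuation c ≤ 1 := fun c hc =>
    (V.valuation_le_one_iff c).2 (hV hc.isIntegral)
  refine ⟨V, fun c hc hc0 => le_antisymm (hle c hc) ?_, ?_⟩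
  · have := hle c⁻¹ hc.inv
    rw [map_inv₀] at this
    exact (inv_le_one₀ ((Valuation.pos_iff _).2 hc0)).1 this
  · rw [← not_le, V.valuation_le_one_iff]
    exact hxV

theorem le_two_mul_card_filter_pow_ne_one {K : Type*} [Field K] [IsAlgClosed K] {l m : ℕ}
    [DecidableEq K] (hl : (l : K) ≠ 0) (h : l.gcd m < l) :
    l ≤ 2 * {ζ ∈ Polynomial.nthRootsFinset l (1 : K) | ζ ^ m ≠ 1}.card := by
  have : NeZero (l : K) := ⟨hl⟩
  have hl0 : 0 < l := by omega
  obtain ⟨ξ, hξ⟩ := HasEnoughRootsOfUnity.exists_primitiveRoot K l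
  have hcard := hξ.card_nthRootsFinset
  have hd0 : 0 < l.gcd m := Nat.gcd_pos_of_pos_left _ hl0
  have hsub : {ζ ∈ Polynomial.nthRootsFinset l (1 : K) | ζ ^ m = 1} ⊆
      Polynomial.nthRootsFinset (l.gcd m) (1 : K) := by
    intro ζ hζ
    rw [Finset.mem_filter, Polynomial.mem_nthRootsFinset hl0] at hζ
    rw [Polynomial.mem_nthRootsFinset hd0]
    exact pow_gcd_eq_one.2 hζ
  have hle : (Polynomial.nthRootsFinset (l.gcd m) (1 : K)).card ≤ l.gcd m := by
    rw [Polynomial.nthRootsFinset_def]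
    exact (Multiset.toFinset_card_le _).trans (Polynomial.card_nthRoots _ _)
  have hcard' := Finset.card_le_card hsub
  have hadd := Finset.card_filter_add_card_filter_not (s := Polynomial.nthRootsFinset l (1 : K))
    (fun ζ => ζ ^ m = 1)
  have htwo : 2 * l.gcd m ≤ l := by
    obtain ⟨k, hk⟩ := Nat.gcd_dvd_left l m
    have : 2 ≤ k := by
      by_contra! hk2
      interval_cases k <;> omega
    calc 2 * l.gcd m ≤ k * l.gcd m := Nat.mul_le_mul_right _ this
      _ = l := by rw [mul_comm]; exact hk.symm
  simp only [ne_eq]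
  omega

theorem exists_card_le_two_mul_card_filter_sameRelations {K L Γ : Type*} [Field K] [Field L]
    [Algebra K L] [IsAlgClosed K] [IsAlgClosed L] [LinearOrderedCommGroupWithZero Γ]
    (v : Valuation L Γ) {p : ℕ} [Fact p.Prime] [CharP L p] {i l : ℕ} {s : L} {Ω : Finset L}
    [∀ z x y : L, Decidable (SameRelations K z x y)]
    (hi : 1 ≤ i) (hl : 1 < l) (hlp : (l : K) ≠ 0) (hgcd : l.gcd (p ^ i - 1) < l)
    (hv : ∀ c : K, c ≠ 0 → v (algebraMap K L c) = 1)
    (hΩ : powDiff (p ^ i * l + 1) Polynomial.X - Polynomial.C s =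
      ∏ y ∈ Ω, (Polynomial.X - Polynomial.C y))
    (hcard : Ω.card = p ^ i * l) {x : L} (hxΩ : x ∈ Ω) (hx : 1 < v x) :
    ∃ a ∈ Ω, ∃ b ∈ Ω, a ≠ b ∧ Ω.card ≤ 2 * {z ∈ Ω | SameRelations K z a b}.card := by
  classical
  have hvl : v (l : L) = 1 := by
    rw [← map_natCast (algebraMap K L)]
    exact hv _ hlp
  have hmem := fun {z} => powDiff_eq_iff_mem hΩ (b := z)
  have hvΩ : ∀ z ∈ Ω, v z = v x := fun z hz =>
    map_eq_of_powDiff_eq (p := p) v hl hi hx ((hmem.2 hz).trans (hmem.2 hxΩ).symm)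
  let Z : Finset K := {ζ ∈ Polynomial.nthRootsFinset l (1 : K) | ζ ^ (p ^ i - 1) ≠ 1}
  have hZcard : l ≤ 2 * Z.card := le_two_mul_card_filter_pow_ne_one hlp hgcd
  have hZ : ∀ ζ ∈ Z, ζ ^ l = 1 ∧ ζ ^ (p ^ i - 1) ≠ 1 := fun ζ hζ => by
    rwa [Finset.mem_filter, Polynomial.mem_nthRootsFinset (by omega)] at hζ
  have hq : 1 < p ^ i := Nat.one_lt_pow (by omega) (Fact.out : p.Prime).one_lt
  let near (z : L) (ζ : K) : Finset L := {y ∈ Ω | v (y - algebraMap K L ζ * z) < v z}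
  have hpow : ∀ ζ : K, ζ ^ l = 1 → ζ ^ (p ^ i - 1) ≠ 1 → ζ ^ (p ^ i * (l - 1) + 1) ≠ 1 :=
    fun ζ h h' => pow_ne_one_of_pow_sub_one_ne_one hq.le hl h h'
  have hnear : ∀ z ∈ Ω, ∀ ζ ∈ Z, (near z ζ).card = p ^ i := by
    intro z hz ζ hζ
    refine card_filter_map_sub_root_mul_lt v hl hi hvl (by rwa [hvΩ z hz]) ?_ ?_ hΩ hcard hz
    · rw [← map_pow, (hZ ζ hζ).1, map_one]
    · rw [← map_pow, ← map_one (algebraMap K L), ← map_sub]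
      exact hv _ (sub_ne_zero.2 (hpow ζ (hZ ζ hζ).1 (hZ ζ hζ).2))
  obtain ⟨ζ₀, hζ₀⟩ : Z.Nonempty := Finset.card_pos.1 (by omega)
  obtain ⟨a, ha, b, hb, hab⟩ := Finset.one_lt_card.1 (hq.trans_eq (hnear x hxΩ ζ₀ hζ₀).symm)
  obtain ⟨haΩ, hax⟩ := Finset.mem_filter.1 ha
  obtain ⟨hbΩ, hbx⟩ := Finset.mem_filter.1 hb
  have hba : v (b - a) < v x := by
    have := v.map_sub_lt hbx hax
    rwa [sub_sub_sub_cancel_right] at this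
  refine ⟨a, haΩ, b, hbΩ, hab, ?_⟩
  have hsub : Z.biUnion (near a) ⊆ {z ∈ Ω | SameRelations K z a b} := by
    intro z hz
    obtain ⟨ζ, hζ, hz⟩ := Finset.mem_biUnion.1 hz
    obtain ⟨hzΩ, hza⟩ := Finset.mem_filter.1 hz
    rw [hvΩ a haΩ] at hza
    obtain ⟨hζl, hζq⟩ := hZ ζ hζ
    have hζ0 : ζ ≠ 0 := by
      rintro rfl
      rw [zero_pow (by omega)] at hζl
      exact zero_ne_one hζl
    have hζl' : ζ⁻¹ ^ l = 1 := by rw [inv_pow, hζl, inv_one]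
    have hζq' : ζ⁻¹ ^ (p ^ i * (l - 1) + 1) ≠ 1 := by
      refine hpow _ hζl' ?_
      rw [inv_pow]
      exact fun h => hζq (inv_eq_one.1 h)
    have haz : v (a - algebraMap K L ζ⁻¹ * z) < v x := by
      have hζL : algebraMap K L ζ ≠ 0 := by simpa using hζ0
      have : a - algebraMap K L ζ⁻¹ * z = -(algebraMap K L ζ⁻¹ * (z - algebraMap K L ζ * a)) := by
        rw [map_inv₀]
        field_simp
        ring
      rwa [this, v.map_neg, map_mul, hv _ (inv_ne_zero hζ0), one_mul]
    have hbz : v (b - algebraMap K L ζ⁻¹ * z) < v x := by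
      have := v.map_add_lt hba haz
      rwa [sub_add_sub_cancel] at this
    rw [← hvΩ z hzΩ] at haz hbz
    have hz1 : 1 < v z := by rwa [hvΩ z hzΩ]
    refine Finset.mem_filter.2 ⟨hzΩ, fun R => ⟨?_, ?_⟩⟩
    · exact evalAt_eq_zero_of_map_sub_lt v hl hi hv hvl hz1 hζl' hζq' hΩ hcard hzΩ haΩ hbΩ haz hbz
    · exact evalAt_eq_zero_of_map_sub_lt v hl hi hv hvl hz1 hζl' hζq' hΩ hcard hzΩ hbΩ haΩ hbz haz
  have hdisj : ((Z : Set K).PairwiseDisjoint (near a)) := by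
    intro ζ _ η _ hne
    rw [Function.onFun, Finset.disjoint_left]
    intro z hz hz'
    have h1 := v.map_sub_lt (Finset.mem_filter.1 hz').2 (Finset.mem_filter.1 hz).2
    rw [sub_sub_sub_cancel_left, ← sub_mul, ← map_sub, map_mul, hv _ (sub_ne_zero.2 hne),
      one_mul] at h1
    exact h1.false
  have hle := Finset.card_le_card hsub
  rw [Finset.card_biUnion hdisj, Finset.sum_congr rfl (hnear a haΩ), Finset.sum_const,
    smul_eq_mul] at hle
  calc Ω.card = p ^ i * l := hcard
    _ ≤ p ^ i * (2 * Z.card) := Nat.mul_le_mul_left _ hZcard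
    _ = 2 * (Z.card * p ^ i) := by ring
    _ ≤ _ := Nat.mul_le_mul_left _ hle

theorem irreducible_map_of_irreducible {F K L : Type*} [Field F] [Field K] [Field L] [Algebra F K]
    [Algebra K L] [Algebra F L] [IsScalarTower F K L] [IsAlgClosed K] [IsAlgClosed L] [Normal F K]
    {p : ℕ} [Fact p.Prime] [CharP F p] {i l : ℕ} (hi : 1 ≤ i) (hl : 1 < l) (hlp : ¬ p ∣ l)
    (hgcd : l.gcd (p ^ i - 1) < l) {x₀ : L} (hx₀ : IsTranscendenceBasis F fun _ : Unit => x₀)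
    {G : Polynomial (Polynomial F)}
    (hG : powDiff (p ^ i * l + 1) Polynomial.X -
      Polynomial.C (powDiff (p ^ i * l + 1) Polynomial.X) =
        (Polynomial.X - Polynomial.C Polynomial.X) * G) (hirr : Irreducible G) :
    Irreducible (G.map (Polynomial.mapRingHom (algebraMap F K))) := by
  classical
  have : CharP K p := charP_of_injective_algebraMap (algebraMap F K).injective p
  have : CharP L p := charP_of_injective_algebraMap (algebraMap F L).injective p
  have hx₀t : Transcendental F x₀ := algebraicIndependent_unique_type_iff.1 hx₀.1
  obtain ⟨Ω, hΩ, hcard, htr⟩ := exists_powDiff_sub_eq_prod hi hl hx₀t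
  have hmem := fun {z} => powDiff_eq_iff_mem hΩ (b := z)
  have hq : 1 < p ^ i := Nat.one_lt_pow (by omega) (Fact.out : p.Prime).one_lt
  have hql : 2 * 2 ≤ p ^ i * l := Nat.mul_le_mul hq hl
  obtain ⟨hm, hd⟩ := monic_powDiff_X (R := Polynomial F) (p := p) (l := l) hi
  have hfm : (powDiff (p ^ i * l + 1) Polynomial.X -
      Polynomial.C (powDiff (p ^ i * l + 1) (Polynomial.X : Polynomial F))).Monic :=
    hm.sub_of_left <| by
      rw [Polynomial.degree_eq_natDegree hm.ne_zero, hd]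
      exact Polynomial.degree_C_le.trans_lt (by exact_mod_cast (by omega : 0 < p ^ i * l))
  have hGm : G.Monic := by
    rw [hG] at hfm
    exact (Polynomial.monic_X_sub_C _).of_mul_monic_left hfm
  have hGd : G.natDegree + 1 = p ^ i * l := by
    have := congrArg Polynomial.natDegree hG
    rw [Polynomial.natDegree_sub_C, hd, (Polynomial.monic_X_sub_C _).natDegree_mul hGm,
      Polynomial.natDegree_X_sub_C] at this
    omega
  have hprod : ∀ z ∈ Ω, (Polynomial.X - Polynomial.C z) *
      G.map (Polynomial.aeval z : Polynomial F →ₐ[F] L).toRingHom =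
        ∏ y ∈ Ω, (Polynomial.X - Polynomial.C y) := by
    intro z hz
    have := congrArg (Polynomial.map (Polynomial.aeval z : Polynomial F →ₐ[F] L).toRingHom) hG
    rw [Polynomial.map_mul, Polynomial.map_sub, Polynomial.map_sub, map_powDiff_X,
      Polynomial.map_C, Polynomial.map_C, Polynomial.map_X] at this
    rw [← hΩ, ← hmem.2 hz]
    simpa [powDiff] using this.symm
  have hroot : ∀ z ∈ Ω, ∀ x ∈ Ω, z ≠ x → evalAt F z x G = 0 := by
    intro z hz x hx hzx
    have := congrArg (Polynomial.eval x) (hprod z hz)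
    rw [Polynomial.eval_mul, Polynomial.eval_prod, Finset.prod_eq_zero hx (by simp), mul_eq_zero,
      Polynomial.eval_map] at this
    refine this.resolve_left ?_
    simpa [sub_eq_zero] using hzx.symm
  have htrans : ∀ z ∈ Ω, ∀ x ∈ Ω, z ≠ x → ∀ z' ∈ Ω, ∀ x' ∈ Ω, z' ≠ x' →
      ∃ σ : L → L, Function.Injective σ ∧ (∀ a ∈ Ω, σ a ∈ Ω) ∧ σ z = z' ∧ σ x = x' ∧
        ∀ a b c, SameRelations K a b c → SameRelations K (σ a) (σ b) (σ c) := by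
    intro z hz x hx hzx z' hz' x' hx' hzx'
    obtain ⟨σ, hσz, hσx⟩ := exists_algHom_of_irreducible hGm hirr
      (hx₀.of_transcendental (htr z hz)) (htr z' hz') (hroot z hz x hx hzx)
      (hroot z' hz' x' hx' hzx')
    have hσ : ∀ y, σ (powDiff (p ^ i * l + 1) y) = powDiff (p ^ i * l + 1) (σ y) := fun y => by
      simp [powDiff]
    refine ⟨σ, σ.injective, fun a ha => ?_, hσz, hσx, fun a b c h => h.map σ⟩
    rw [← hmem, ← hσ, (hmem.2 ha).trans (hmem.2 hz).symm, hσ, hσz]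
    exact hmem.2 hz'
  by_contra hred
  have hGKm := hGm.map (Polynomial.mapRingHom (algebraMap F K))
  have hne : G.map (Polynomial.mapRingHom (algebraMap F K)) ≠ 1 := by
    intro h
    have := hGm.natDegree_map (Polynomial.mapRingHom (algebraMap F K))
    rw [h, Polynomial.natDegree_one] at this
    omega
  rw [hGKm.irreducible_iff_natDegree] at hred
  push Not at hred
  obtain ⟨P, Q, hP, hQ, hPQ, hPd, hQd⟩ := hred hne
  have hsplit : ∀ z ∈ Ω, ∃ x ∈ Ω, ∃ y ∈ Ω, x ≠ z ∧ y ≠ z ∧ ¬ SameRelations K z x y := by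
    intro z hz
    refine exists_not_sameRelations hP hQ hPd hQd ?_
    rw [hPQ, Polynomial.map_map, ← hprod z hz]
    congr 2
    ext <;> simp [← IsScalarTower.algebraMap_apply]
  obtain ⟨V, hV, hVx⟩ := exists_valuationSubring_one_lt hx₀t
  have hlK : (l : K) ≠ 0 := by rwa [Ne, CharP.cast_eq_zero_iff K p]
  obtain ⟨a, ha, b, hb, hab, hle⟩ := exists_card_le_two_mul_card_filter_sameRelations (K := K)
    V.valuation hi hl hlK hgcd (fun c hc => hV _
      ((Algebra.IsAlgebraic.isAlgebraic (R := F) c).algebraMap) (by simpa using hc))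
    hΩ hcard (hmem.1 rfl) hVx
  exact hle.not_gt (two_mul_card_filter_rel_lt Ω (SameRelations K)
    SameRelations.equivalence (fun _ _ h => h.eq_of_self) htrans hsplit ha hb hab)

/-- Bivariate polynomials as polynomials in `X 0` with coefficients polynomials in `X 1`. -/
def toPolynomialEquiv (R : Type*) [CommRing R] :
    MvPolynomial (Fin 2) R ≃+* Polynomial (Polynomial R) :=
  RingEquiv.ofRingHom
    (eval₂Hom (Polynomial.C.comp Polynomial.C) ![Polynomial.X, Polynomial.C Polynomial.X])
    (Polynomial.eval₂RingHom (Polynomial.eval₂RingHom C (X 1)) (X 0))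
    (by ext <;> simp)
    (by
      refine MvPolynomial.ringHom_ext (by simp) fun i => ?_
      fin_cases i <;> simp)

theorem toPolynomialEquiv_X_zero {R : Type*} [CommRing R] :
    toPolynomialEquiv R (X 0) = Polynomial.X := by
  simp [toPolynomialEquiv]

theorem toPolynomialEquiv_X_one {R : Type*} [CommRing R] :
    toPolynomialEquiv R (X 1) = Polynomial.C Polynomial.X := by
  simp [toPolynomialEquiv]

theorem toPolynomialEquiv_map {R S : Type*} [CommRing R] [CommRing S] (f : R →+* S)
    (P : MvPolynomial (Fin 2) R) :
    toPolynomialEquiv S (map f P) = (toPolynomialEquiv R P).map (Polynomial.mapRingHom f) := by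
  have : (toPolynomialEquiv S).toRingHom.comp (map f) =
      (Polynomial.mapRingHom (Polynomial.mapRingHom f)).comp (toPolynomialEquiv R).toRingHom := by
    refine MvPolynomial.ringHom_ext (by simp [toPolynomialEquiv]) fun i => ?_
    fin_cases i <;> simp [toPolynomialEquiv]
  exact congrArg (fun g => g P) this

theorem exists_isAlgClosed_isTranscendenceBasis (F : Type) [Field F] :
    ∃ (L : Type) (_ : Field L) (_ : Algebra F L) (x : L), IsAlgClosed L ∧
      IsTranscendenceBasis F fun _ : Unit => x := by
  let E := FractionRing (Polynomial F)
  refine ⟨AlgebraicClosure E, inferInstance, inferInstance,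
    algebraMap (Polynomial F) (AlgebraicClosure E) Polynomial.X, inferInstance, ?_⟩
  have : FaithfulSMul (Polynomial F) (AlgebraicClosure E) := by
    rw [faithfulSMul_iff_algebraMap_injective,
      IsScalarTower.algebraMap_eq (Polynomial F) E (AlgebraicClosure E)]
    exact (algebraMap E _).injective.comp (IsFractionRing.injective (Polynomial F) E)
  have : Algebra.IsAlgebraic (Polynomial F) E := IsLocalization.isAlgebraic _ (nonZeroDivisors _)
  have : Algebra.IsAlgebraic (Polynomial F) (AlgebraicClosure E) :=
    Algebra.IsAlgebraic.trans (Polynomial F) E (AlgebraicClosure E)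
  exact (IsTranscendenceBasis.polynomial Unit F).algebraMap_comp

/-- Case (B.1), assuming `g_t` irreducible over `F_p`: suppose `t = p^i·ℓ + 1`
with `ℓ > 1` and `gcd(ℓ, p^i - 1) < ℓ`. If (`p ≥ 5`, `i ≥ 1`) or
(`p = 3`, `i ≥ 2`), then `g_t` is absolutely irreducible. -/
theorem gt_abs_irred_case_B1_of_irred
    (p t : ℕ) [Fact p.Prime] (hp2 : p ≠ 2) (ht : 3 ≤ t) (hpt : ¬ p ∣ t)
    (g : MvPolynomial (Fin 2) (ZMod p))
    (hg : ((X 0 + 1) ^ t - X 0 ^ t - (X 1 + 1) ^ t + X 1 ^ t : MvPolynomial (Fin 2) (ZMod p))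
        = (X 0 - X 1) * g)
    (i l : ℕ) (hi : 1 ≤ i) (hl1 : 1 < l) (hlodd : Odd l) (hlp : ¬ p ∣ l)
    (htval : t = p ^ i * l + 1)
    (hgcd : Nat.gcd l (p ^ i - 1) < l)
    (hirr : Irreducible g)
    (hcases : (5 ≤ p ∧ 1 ≤ i) ∨ (p = 3 ∧ 2 ≤ i)) :
    Irreducible (MvPolynomial.map (algebraMap (ZMod p) (AlgebraicClosure (ZMod p))) g) := by
  obtain ⟨L, _, _, x, _, hx⟩ := exists_isAlgClosed_isTranscendenceBasis (ZMod p)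
  let := (IsAlgClosed.lift : AlgebraicClosure (ZMod p) →ₐ[ZMod p] L).toAlgebra
  have : IsScalarTower (ZMod p) (AlgebraicClosure (ZMod p)) L :=
    .of_algebraMap_eq' (AlgHom.comp_algebraMap _).symm
  subst htval
  rw [← MulEquiv.irreducible_iff (toPolynomialEquiv (AlgebraicClosure (ZMod p))),
    toPolynomialEquiv_map]
  refine irreducible_map_of_irreducible hi hl1 hlp hgcd hx ?_
    ((MulEquiv.irreducible_iff (toPolynomialEquiv (ZMod p))).2 hirr)
  have := congrArg (toPolynomialEquiv (ZMod p)) hg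
  simp only [map_sub, map_add, map_mul, map_pow, map_one, toPolynomialEquiv_X_zero,
    toPolynomialEquiv_X_one] at this
  rw [← this]
  simp [powDiff]
  ring
end
end

section
/- Suppose t = p^i·ℓ + 1 where i ≥ 1, ℓ ≥ 3 is odd and not divisible by p, ℓ divides p^i − 1, and ℓ < p^i − 1. If g_t(x,y) is irreducible in F_p[x,y], then the image of g_t in F̄_p[x,y] is irreducible, i.e. g_t is absolutely irreducible. -/
open MvPolynomial

noncomputable section

theorem half_card_add_three_le_card_moved_of_two_homogeneous
    {V C : Type*} [Fintype V] [DecidableEq V] [DecidableEq C] (c : V → V → C)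
    (htrans : ∀ x x' w w' : V, x ≠ x' → w ≠ w' → ∃ θ : V → V, Function.Injective θ ∧
      θ x = w ∧ θ x' = w' ∧ ∀ a b d e, c (θ a) (θ b) = c (θ d) (θ e) → c a b = c d e)
    (hdiag : ∀ z x, z ≠ x → c z z ≠ c z x)
    (hne : ∃ z x x', z ≠ x ∧ z ≠ x' ∧ c z x ≠ c z x')
    (σ : V → V) (hσ : ∀ a b, c (σ a) (σ b) = c a b) (hmove : ∃ x, σ x ≠ x) :
    Fintype.card V + 3 ≤ 2 * (Finset.univ.filter fun y => σ y ≠ y).card := by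
  classical
  obtain ⟨z₀, x₀, x₁, hzx₀, hzx₁, hc⟩ := hne
  obtain ⟨y, hy⟩ := hmove
  -- count, for each pair of points, the points distinguishing them
  let D : V → V → ℕ := fun x x' => (Finset.univ.filter fun z => c z x ≠ c z x').card
  let M : V → V → ℕ := fun z x => (Finset.univ.filter fun x' => c z x ≠ c z x').card
  have hDle : ∀ x x' w w' : V, x ≠ x' → w ≠ w' → D x x' ≤ D w w' := by
    intro x x' w w' h h'
    obtain ⟨θ, hθ, rfl, rfl, hθc⟩ := htrans x x' w w' h h'
    refine Finset.card_le_card_of_injOn θ ?_ hθ.injOn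
    intro z hz
    simp only [Finset.coe_filter, Finset.mem_univ, true_and, Set.mem_ofPred_eq] at hz ⊢
    exact fun hh => hz (hθc _ _ _ _ hh)
  have hMle : ∀ x x' w w' : V, x ≠ x' → w ≠ w' → M x x' ≤ M w w' := by
    intro x x' w w' h h'
    obtain ⟨θ, hθ, rfl, rfl, hθc⟩ := htrans x x' w w' h h'
    refine Finset.card_le_card_of_injOn θ ?_ hθ.injOn
    intro z hz
    simp only [Finset.coe_filter, Finset.mem_univ, true_and, Set.mem_ofPred_eq] at hz ⊢
    exact fun hh => hz (hθc _ _ _ _ hh)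
  have hD : ∀ x x', x ≠ x' → D x x' = D y (σ y) := fun x x' h =>
    le_antisymm (hDle _ _ _ _ h hy.symm) (hDle _ _ _ _ hy.symm h)
  have hM : ∀ x x', x ≠ x' → M x x' = M z₀ x₀ := fun x x' h =>
    le_antisymm (hMle _ _ _ _ h hzx₀) (hMle _ _ _ _ hzx₀ h)
  have hDσ : D y (σ y) ≤ (Finset.univ.filter fun y => σ y ≠ y).card := by
    refine Finset.card_le_card fun z hz => ?_
    simp only [Finset.mem_filter, Finset.mem_univ, true_and] at hz ⊢
    intro h
    exact hz (by rw [← hσ z y, h])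
  have hDself : ∀ x, D x x = 0 := fun x => by simp [D]
  have hMself : ∀ x, M x x = Fintype.card V - 1 := fun x => by
    rw [← Finset.card_univ, ← Finset.card_erase_of_mem (Finset.mem_univ x)]
    refine congrArg Finset.card (Finset.ext fun x' => ?_)
    simp only [Finset.mem_filter, Finset.mem_univ, true_and, Finset.mem_erase, and_true]
    exact ⟨fun h h' => h (by rw [h']), fun h => hdiag x x' h.symm⟩
  have hsum : ∑ x, ∑ x', D x x' = ∑ z, ∑ x, M z x := by
    simp only [D, M, Finset.card_filter]
    rw [Finset.sum_comm' (t' := Finset.univ) (s' := fun _ => Finset.univ) (by simp)]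
    have : ∀ x' : V, ∑ x, ∑ z, (if c z x ≠ c z x' then 1 else 0)
        = ∑ z, ∑ x, (if c z x ≠ c z x' then 1 else 0) := fun x' => Finset.sum_comm
    simp only [this]
    rw [Finset.sum_comm]
    refine Finset.sum_congr rfl fun z _ => Finset.sum_comm
  have hsplit : ∀ (f : V → V → ℕ) (s d : ℕ), (∀ x, f x x = s) → (∀ x x', x ≠ x' → f x x' = d) →
      ∑ x, ∑ x', f x x' = Fintype.card V * (s + (Fintype.card V - 1) * d) := by
    intro f s d hs hd
    have : ∀ x, ∑ x', f x x' = s + (Fintype.card V - 1) * d := by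
      intro x
      rw [← Finset.add_sum_erase _ _ (Finset.mem_univ x), hs,
        Finset.sum_congr rfl (fun x' hx' => hd x x' (Finset.ne_of_mem_erase hx').symm)]
      simp [Finset.card_erase_of_mem]
    simp [this]
  rw [hsplit D _ _ hDself hD, hsplit M _ _ hMself hM] at hsum
  have hclass : Fintype.card V + 1 ≤ 2 * M z₀ x₀ := by
    have h1 : Finset.univ ⊆ ((Finset.univ.filter fun x' => c z₀ x₀ ≠ c z₀ x').erase z₀ ∪
        (Finset.univ.filter fun x' => c z₀ x₁ ≠ c z₀ x').erase z₀) ∪ {z₀} := by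
      intro v _
      by_cases hv : v = z₀
      · simp [hv]
      · by_cases hv' : c z₀ x₀ = c z₀ v
        · simp [hv, ← hv', Ne.symm hc]
        · simp [hv, hv']
    have h2 := Finset.card_le_card h1
    have h3 := Finset.card_union_le ((Finset.univ.filter fun x' => c z₀ x₀ ≠ c z₀ x').erase z₀ ∪
        (Finset.univ.filter fun x' => c z₀ x₁ ≠ c z₀ x').erase z₀) {z₀}
    have h4 := Finset.card_union_le ((Finset.univ.filter fun x' => c z₀ x₀ ≠ c z₀ x').erase z₀)
        ((Finset.univ.filter fun x' => c z₀ x₁ ≠ c z₀ x').erase z₀)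
    have m0 : z₀ ∈ Finset.univ.filter fun x' => c z₀ x₀ ≠ c z₀ x' := by
      simpa using (hdiag _ _ hzx₀).symm
    have m1 : z₀ ∈ Finset.univ.filter fun x' => c z₀ x₁ ≠ c z₀ x' := by
      simpa using (hdiag _ _ hzx₁).symm
    have e0 := Finset.card_erase_add_one m0
    have e1 := Finset.card_erase_add_one m1
    have hM1 : M z₀ x₁ = M z₀ x₀ := hM _ _ hzx₁
    simp only [M] at hM1 ⊢
    simp only [Finset.card_singleton, Finset.card_univ] at h2 h3
    omega
  have hcard : 2 ≤ Fintype.card V := Fintype.one_lt_card_iff.2 ⟨z₀, x₀, hzx₀⟩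
  have hfin : D y (σ y) = 1 + M z₀ x₀ := by
    have h1 := Nat.eq_of_mul_eq_mul_left (by omega) hsum
    have h2 : (Fintype.card V - 1) * D y (σ y) = (Fintype.card V - 1) * (1 + M z₀ x₀) := by
      rw [mul_add, mul_one]; omega
    exact Nat.eq_of_mul_eq_mul_left (by omega) h2
  omega

theorem MvPolynomial.dvd_of_irreducible_of_aeval_eq_zero {F Ω : Type*} [Field F] [Field Ω]
    [Algebra F Ω] {x y : Ω} (hx : Transcendental F x) {g u : MvPolynomial (Fin 2) F}
    (hg : Irreducible g) (hgx : aeval ![x, y] g = 0) (hu : aeval ![x, y] u = 0) : g ∣ u := by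
  rw [← Ideal.mem_span_singleton]
  by_contra hmem
  let I : Ideal (MvPolynomial (Fin 2) F) := RingHom.ker (aeval ![x, y] : _ →ₐ[F] Ω)
  have hI : I.IsPrime := RingHom.ker_isPrime _
  have hP : (Ideal.span {g}).IsPrime :=
    (Ideal.span_singleton_prime hg.ne_zero).2 hg.prime
  have h1 : (⊥ : Ideal (MvPolynomial (Fin 2) F)) < Ideal.span {g} :=
    bot_lt_iff_ne_bot.2 (by simpa using hg.ne_zero)
  have h2 : Ideal.span {g} < I := by
    refine lt_of_le_of_ne ((Ideal.span_singleton_le_iff_mem _).2 hgx) fun h => hmem ?_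
    rw [h]; exact hu
  have hmax : I.IsMaximal := by
    by_contra hnm
    obtain ⟨m, hm, hIm⟩ := Ideal.exists_le_maximal I hI.ne_top
    have h3 : I < m := lt_of_le_of_ne hIm fun h => hnm (h ▸ hm)
    let s : LTSeries (PrimeSpectrum (MvPolynomial (Fin 2) F)) :=
      { length := 3
        toFun := ![⟨⊥, Ideal.isPrime_bot⟩, ⟨_, hP⟩, ⟨_, hI⟩, ⟨m, hm.isPrime⟩]
        step := by
          intro i
          fin_cases i
          · exact h1
          · exact h2
          · exact h3 }
    have h4 : (3 : WithBot ℕ∞) ≤ ringKrullDim (MvPolynomial (Fin 2) F) :=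
      Order.LTSeries.length_le_krullDim s
    rw [MvPolynomial.ringKrullDim_of_isNoetherianRing, ringKrullDim_eq_zero_of_field] at h4
    simp at h4
    exact absurd h4 (by decide)
  let := Ideal.Quotient.field I
  have hfin : Module.Finite F (MvPolynomial (Fin 2) F ⧸ I) :=
    finite_of_finite_type_of_isJacobsonRing _ _
  have halg : IsAlgebraic F (Ideal.Quotient.mk I (X 0)) :=
    Algebra.IsAlgebraic.isAlgebraic _
  apply hx
  have := halg.algHom (Ideal.kerLiftAlg (aeval ![x, y] : _ →ₐ[F] Ω))
  simpa [I] using this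

theorem IsAlgClosed.exists_injective_ringHom_extending {R S M : Type*} [CommRing R] [CommRing S]
    [IsDomain S] [Field M] [IsAlgClosed M] [Algebra R S] [FaithfulSMul R S]
    [Algebra.IsIntegral R S] (φ : R →+* M) (hφ : Function.Injective φ) :
    ∃ ψ : S →+* M, Function.Injective ψ ∧ ∀ r, ψ (algebraMap R S r) = φ r := by
  let := φ.toAlgebra
  have hd : IsDomain R := (FaithfulSMul.algebraMap_injective R S).isDomain (algebraMap R S)
  have : FaithfulSMul R M := (faithfulSMul_iff_algebraMap_injective R M).2 hφ
  have : Algebra.IsAlgebraic R S := Algebra.IsIntegral.isAlgebraic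
  let ψ : S →ₐ[R] M := IsAlgClosed.lift
  refine ⟨ψ, ?_, fun r => ψ.commutes r⟩
  refine (RingHom.injective_iff_ker_eq_bot _).2 (Ideal.eq_bot_of_comap_eq_bot (R := R) ?_)
  rw [RingHom.comap_ker]
  have : (ψ : S →+* M).comp (algebraMap R S) = φ := RingHom.ext fun r => ψ.commutes r
  rw [this]
  exact (RingHom.injective_iff_ker_eq_bot _).1 hφ

theorem MvPolynomial.exists_ringHom_of_irreducible {F Ω : Type*} [Field F] [Field Ω]
    [IsAlgClosed Ω] [Algebra F Ω] {x x' w w' : Ω} (hx : Transcendental F x)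
    (hw : Transcendental F w) {g : MvPolynomial (Fin 2) F} (hg : Irreducible g)
    (hgx : aeval ![x, x'] g = 0) (hgw : aeval ![w, w'] g = 0) :
    ∃ (S : Subring Ω) (ψ : S →+* Ω), Function.Injective ψ ∧
      (∀ u : MvPolynomial (Fin 2) F, ∃ h : aeval ![x, x'] u ∈ S, ψ ⟨_, h⟩ = aeval ![w, w'] u) ∧
      ∀ (z : Ω) (q : Polynomial (MvPolynomial (Fin 2) F)), q.Monic →
        q.eval₂ (aeval ![x, x'] : MvPolynomial (Fin 2) F →ₐ[F] Ω).toRingHom z = 0 → z ∈ S := by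
  let Q := MvPolynomial (Fin 2) F ⧸ Ideal.span {g}
  have key : ∀ a b : Ω, Transcendental F a → aeval ![a, b] g = 0 →
      ∃ φ : Q →+* Ω, Function.Injective φ ∧ ∀ u, φ (Ideal.Quotient.mk _ u) = aeval ![a, b] u := by
    intro a b ha hab
    refine ⟨Ideal.Quotient.lift _ (aeval ![a, b] : MvPolynomial (Fin 2) F →ₐ[F] Ω).toRingHom ?_,
      ?_, fun u => Ideal.Quotient.lift_mk _ _ _⟩
    · intro u hu
      obtain ⟨v, rfl⟩ := Ideal.mem_span_singleton.1 hu
      simp [hab]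
    · refine RingHom.lift_injective_of_ker_le_ideal _ _ fun u hu => ?_
      exact Ideal.mem_span_singleton.2 (dvd_of_irreducible_of_aeval_eq_zero ha hg hab hu)
  obtain ⟨φ, hφ, hφu⟩ := key x x' hx hgx
  obtain ⟨φ', hφ', hφu'⟩ := key w w' hw hgw
  let := φ.toAlgebra
  have : FaithfulSMul Q Ω := (faithfulSMul_iff_algebraMap_injective Q Ω).2 hφ
  have : FaithfulSMul Q (integralClosure Q Ω) :=
    (faithfulSMul_iff_algebraMap_injective _ _).2 fun r r' h => hφ (congrArg Subtype.val h)
  obtain ⟨ψ, hψ, hψr⟩ := IsAlgClosed.exists_injective_ringHom_extending (R := Q)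
    (S := integralClosure Q Ω) φ' hφ'
  refine ⟨(integralClosure Q Ω).toSubring, ψ, hψ, fun u => ⟨?_, ?_⟩, fun z q hq hz => ?_⟩
  · rw [← hφu]
    exact (integralClosure Q Ω).algebraMap_mem _
  · rw [← hφu', ← hψr]
    congr 1
    exact Subtype.ext (hφu u).symm
  · refine ⟨q.map (Ideal.Quotient.mk _), hq.map _, ?_⟩
    rw [Polynomial.eval₂_map]
    rw [← hz]
    congr 1
    exact RingHom.ext hφu

theorem MvPolynomial.irreducible_map_of_few_moved_roots {F k Ω : Type*} [Field F] [Field k]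
    [Field Ω] [Algebra F k] [Algebra k Ω] [Algebra F Ω] [IsScalarTower F k Ω] [IsAlgClosed Ω]
    [Normal F k] [DecidableEq Ω] {P : Polynomial F} (hP : P.Monic) {g : MvPolynomial (Fin 2) F}
    (hg : Polynomial.aeval (X 0) P - Polynomial.aeval (X 1) P = (X 0 - X 1) * g)
    (hirr : Irreducible g) {T : Ω} (hT : Transcendental F T) (s : Finset Ω)
    (hs : ∀ x, x ∈ s ↔ Polynomial.aeval x P = T) (hcard : s.card = P.natDegree)
    (σ : Ω →ₐ[k] Ω) (hσT : σ T = T) (hmove : ∃ x ∈ s, σ x ≠ x)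
    (hfew : 2 * (s.filter fun y => σ y ≠ y).card < P.natDegree + 3) :
    Irreducible (map (algebraMap F k) g) := by
  classical
  have hdeg : 0 < P.natDegree := by
    obtain ⟨x, hx, -⟩ := hmove
    rw [← hcard]; exact Finset.card_pos.2 ⟨x, hx⟩
  have htr : ∀ x ∈ s, Transcendental F x := by
    intro x hx halg
    refine hT ?_
    rw [← (hs x).1 hx]
    exact IsIntegral.isAlgebraic (adjoin_le_integralClosure halg.isIntegral
      (Polynomial.aeval_mem_adjoin_singleton F x))
  have hgz : ∀ x ∈ s, ∀ y ∈ s, x ≠ y → aeval ![x, y] g = 0 := by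
    intro x hx y hy hxy
    have h := congrArg (aeval ![x, y]) hg
    simp only [map_sub, map_mul, ← Polynomial.aeval_algHom_apply, aeval_X, Matrix.cons_val_zero,
      Matrix.cons_val_one, (hs x).1 hx, (hs y).1 hy, sub_self] at h
    exact (mul_eq_zero.1 h.symm).resolve_left (sub_ne_zero.2 hxy)
  let c : s → s → Set (MvPolynomial (Fin 2) k) := fun z x => {u | aeval ![z.1, x.1] u = 0}
  have hσs : ∀ x ∈ s, σ x ∈ s := by
    intro x hx
    have h := (hs x).1 hx
    rw [hs, ← hσT, ← h]
    exact Polynomial.aeval_algHom_apply (σ.restrictScalars F) x P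
  have htrans : ∀ x x' w w' : s, x ≠ x' → w ≠ w' → ∃ θ : s → s, Function.Injective θ ∧
      θ x = w ∧ θ x' = w' ∧ ∀ a b d e, c (θ a) (θ b) = c (θ d) (θ e) → c a b = c d e := by
    intro x x' w w' hxx' hww'
    obtain ⟨S, ψ, hψ, hev, hmem⟩ := exists_ringHom_of_irreducible (htr x x.2) (htr w w.2) hirr
      (hgz x x.2 x' x'.2 (Subtype.coe_ne_coe.2 hxx')) (hgz w w.2 w' w'.2 (Subtype.coe_ne_coe.2 hww'))
    have hFS : ∀ r : F, algebraMap F Ω r ∈ S := fun r => by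
      obtain ⟨h, -⟩ := hev (C r)
      simpa using h
    have hψF : ∀ r : F, ψ ⟨_, hFS r⟩ = algebraMap F Ω r := fun r => by
      obtain ⟨h, h'⟩ := hev (C r)
      simpa using h'
    have hsS : ∀ z ∈ s, z ∈ S := by
      intro z hz
      refine hmem z (P.map C - Polynomial.C (Polynomial.aeval (X 0) P)) ?_ ?_
      · refine (hP.map _).sub_of_left (lt_of_le_of_lt Polynomial.degree_C_le ?_)
        rw [hP.degree_map, Polynomial.degree_eq_natDegree hP.ne_zero]
        exact_mod_cast hdeg
      · rw [Polynomial.eval₂_sub, Polynomial.eval₂_map, Polynomial.eval₂_C, sub_eq_zero]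
        have h1 : (aeval ![x.1, x'.1] : MvPolynomial (Fin 2) F →ₐ[F] Ω).toRingHom.comp C
            = algebraMap F Ω := RingHom.ext fun r => by simp
        rw [h1, ← Polynomial.aeval_def, (hs z).1 hz, ← (hs x).1 x.2]
        change _ = aeval ![x.1, x'.1] (Polynomial.aeval (X 0) P)
        rw [← Polynomial.aeval_algHom_apply]
        simp
    have hkS : ∀ a : k, algebraMap k Ω a ∈ S := by
      intro a
      refine hmem _ ((minpoly F a).map C)
        ((minpoly.monic (Normal.isIntegral inferInstance a)).map _) ?_
      rw [Polynomial.eval₂_map]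
      have h1 : (aeval ![x.1, x'.1] : MvPolynomial (Fin 2) F →ₐ[F] Ω).toRingHom.comp C
          = algebraMap F Ω := RingHom.ext fun r => by simp
      rw [h1, ← Polynomial.aeval_def, Polynomial.aeval_algebraMap_apply, minpoly.aeval, map_zero]
    let jF : F →+* S := (algebraMap F Ω).codRestrict S hFS
    let jk : k →+* S := (algebraMap k Ω).codRestrict S hkS
    let ψk : k →ₐ[F] Ω :=
      { ψ.comp jk with
        commutes' := fun r => by
          rw [← hψF r]
          exact congrArg ψ (Subtype.ext (IsScalarTower.algebraMap_apply F k Ω r).symm) }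
    let τ : k →ₐ[F] k := ψk.restrictNormal k
    have hτ : ∀ a, algebraMap k Ω (τ a) = ψ (jk a) := fun a => ψk.restrictNormal_commutes k a
    have hθmem : ∀ z : s, ψ ⟨z.1, hsS z z.2⟩ ∈ s := by
      intro z
      have hTψ : ∀ y : s, Polynomial.aeval (ψ ⟨y.1, hsS y y.2⟩) P
          = ψ (Polynomial.eval₂ jF ⟨y.1, hsS y y.2⟩ P) := by
        intro y
        rw [Polynomial.hom_eval₂, Polynomial.aeval_def]
        congr 1
        exact RingHom.ext fun r => (hψF r).symm
      have hTS : ∀ y : s, (Polynomial.eval₂ jF ⟨y.1, hsS y y.2⟩ P : S).1 = T := by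
        intro y
        rw [← (hs y).1 y.2, ← Subring.subtype_apply, Polynomial.hom_eval₂, Polynomial.aeval_def]
        rfl
      have hx0 : ψ ⟨x.1, hsS x x.2⟩ = w := by
        obtain ⟨h, h'⟩ := hev (X 0)
        simpa using h'
      rw [hs, hTψ, ← (hs w).1 w.2, ← hx0, hTψ]
      exact congrArg ψ (Subtype.ext ((hTS z).trans (hTS x).symm))
    have hkey : ∀ (a b : s) (u : MvPolynomial (Fin 2) k), aeval ![a.1, b.1] u = 0 ↔
        aeval ![ψ ⟨a.1, hsS a a.2⟩, ψ ⟨b.1, hsS b b.2⟩] (map (τ : k →+* k) u) = 0 := by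
      intro a b u
      let v : Fin 2 → S := ![⟨a.1, hsS a a.2⟩, ⟨b.1, hsS b b.2⟩]
      have h1 : aeval ![a.1, b.1] u = (eval₂Hom jk v u : S).1 := by
        refine Eq.trans ?_ (map_eval₂Hom jk v S.subtype u).symm
        rw [aeval_def, coe_eval₂Hom]
        congr 1
        ext i
        fin_cases i <;> rfl
      have h2 : aeval ![ψ ⟨a.1, hsS a a.2⟩, ψ ⟨b.1, hsS b b.2⟩] (map (τ : k →+* k) u)
          = ψ (eval₂Hom jk v u) := by
        refine Eq.trans ?_ (map_eval₂Hom jk v ψ u).symm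
        rw [aeval_def, eval₂_map, coe_eval₂Hom]
        congr 1
        · exact RingHom.ext hτ
        · ext i
          fin_cases i <;> rfl
      rw [h1, h2, map_eq_zero_iff ψ hψ, ZeroMemClass.coe_eq_zero]
    refine ⟨fun z => ⟨_, hθmem z⟩, ?_, ?_, ?_, ?_⟩
    · intro a b hab
      have := hψ (congrArg Subtype.val hab)
      exact Subtype.ext (Subtype.mk.inj this)
    · obtain ⟨h, h'⟩ := hev (X 0)
      exact Subtype.ext (by simpa using h')
    · obtain ⟨h, h'⟩ := hev (X 1)
      exact Subtype.ext (by simpa using h')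
    · intro a b d e h
      ext u
      have := Set.ext_iff.1 h (map (τ : k →+* k) u)
      simp only [c, Set.mem_ofPred_eq] at this ⊢
      rw [hkey, hkey, this]
  have hdiag : ∀ z x : s, z ≠ x → c z z ≠ c z x := by
    intro z x hzx h
    have : (X 0 - X 1 : MvPolynomial (Fin 2) k) ∈ c z x := by rw [← h]; simp [c]
    simp only [c, Set.mem_ofPred_eq, map_sub, aeval_X, Matrix.cons_val_zero, Matrix.cons_val_one,
      sub_eq_zero] at this
    exact hzx (Subtype.ext this)
  obtain ⟨x₀, hx₀, hmx₀⟩ := hmove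
  by_contra hred
  have hne : ∃ z x x' : s, z ≠ x ∧ z ≠ x' ∧ c z x ≠ c z x' := by
    obtain ⟨z, hz⟩ : ∃ z : s, z = ⟨x₀, hx₀⟩ := ⟨_, rfl⟩
    obtain ⟨y, hy⟩ : ∃ y : s, z ≠ y :=
      ⟨⟨_, hσs x₀ hx₀⟩, fun h => hmx₀ (congrArg Subtype.val (hz ▸ h)).symm⟩
    by_contra! hall
    have hgk : ∀ x : s, z ≠ x → aeval ![z.1, x.1] (map (algebraMap F k) g) = 0 := by
      intro x hx
      rw [aeval_map_algebraMap]
      exact hgz z z.2 x x.2 (Subtype.coe_ne_coe.2 hx)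
    have hnu : ¬ IsUnit (map (algebraMap F k) g) := fun h =>
      (h.map (aeval ![z.1, y.1] : MvPolynomial (Fin 2) k →ₐ[k] Ω)).ne_zero (hgk y hy)
    have hab : ∃ a b, map (algebraMap F k) g = a * b ∧ ¬ IsUnit a ∧ ¬ IsUnit b := by
      by_contra! h
      exact hred ⟨hnu, fun a b e => or_iff_not_imp_left.2 fun ha => h a b e ha⟩
    let E : MvPolynomial (Fin 2) k →ₐ[k] Polynomial Ω := aeval ![Polynomial.C z.1, Polynomial.X]
    have hEdeg : ∀ u, (E u).natDegree ≤ u.totalDegree := by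
      intro u
      have h := aeval_natDegree_le (map (algebraMap k Ω) u) (Finset.sup_mono (support_map_subset _ u))
        ![Polynomial.C z.1, Polynomial.X] (n := 1) (fun i => by fin_cases i <;> simp)
      rwa [aeval_map_algebraMap, mul_one] at h
    have hEeval : ∀ u x, (E u).eval x = aeval ![z.1, x] u := by
      intro u x
      have : ((Polynomial.aeval x : Polynomial Ω →ₐ[Ω] Ω).restrictScalars k).comp E
          = aeval ![z.1, x] := by
        ext i
        fin_cases i <;> simp [E]
      rw [← this]
      simp
    have hX : 1 ≤ (X 0 - X 1 : MvPolynomial (Fin 2) k).totalDegree := by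
      refine le_trans ?_ (hEdeg _)
      have : E (X 0 - X 1) = - (Polynomial.X - Polynomial.C z.1) := by simp [E]
      rw [this, Polynomial.natDegree_neg, Polynomial.natDegree_X_sub_C]
    have hfk : Polynomial.aeval (X 0 : MvPolynomial (Fin 2) k) P - Polynomial.aeval (X 1) P
        = (X 0 - X 1) * map (algebraMap F k) g := by
      have h := congrArg (mapAlgHom (Algebra.ofId F k)) hg
      simp only [map_sub, map_mul, ← Polynomial.aeval_algHom_apply] at h
      simpa using h
    have hE0 : E (map (algebraMap F k) g) ≠ 0 := by
      intro h0
      have h := congrArg (E.restrictScalars F) hfk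
      simp only [map_sub, map_mul, ← Polynomial.aeval_algHom_apply] at h
      simp only [AlgHom.restrictScalars_apply, h0, mul_zero] at h
      have e0 : E (X 0) = Polynomial.C z.1 := by simp [E]
      have e1 : E (X 1) = Polynomial.X := by simp [E]
      rw [e0, e1, sub_eq_zero] at h
      have h1 := congrArg Polynomial.natDegree h
      rw [Polynomial.aeval_X_left_eq_map, hP.natDegree_map] at h1
      have h2 : Polynomial.aeval (Polynomial.C z.1) P = Polynomial.C (Polynomial.aeval z.1 P) :=
        Polynomial.aeval_algebraMap_apply (Polynomial Ω) z.1 P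
      rw [h2, Polynomial.natDegree_C] at h1
      omega
    have htd : (map (algebraMap F k) g).totalDegree + 1 ≤ P.natDegree := by
      have h1 : ∀ i, (Polynomial.aeval (X i : MvPolynomial (Fin 2) k) P).totalDegree
          ≤ P.natDegree := by
        intro i
        rw [Polynomial.aeval_eq_sum_range]
        refine totalDegree_finsetSum_le fun j hj => ?_
        refine (totalDegree_smul_le _ _).trans ?_
        rw [totalDegree_X_pow]
        exact Nat.lt_succ_iff.1 (Finset.mem_range.1 hj)
      have h2 := (totalDegree_sub _ _).trans (max_le (h1 0) (h1 1))
      rw [hfk, totalDegree_mul_of_isDomain] at h2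
      · omega
      · intro h; simp [h] at hX
      · intro h; exact hE0 (by rw [h, map_zero])
    have main : ∀ a b, map (algebraMap F k) g = a * b → ¬ IsUnit b →
        ¬ aeval ![z.1, y.1] a = 0 := by
      intro a b hgab hb ha
      have hab0 : a * b ≠ 0 := fun h => hE0 (by rw [hgab, h, map_zero])
      have ha0 : E a ≠ 0 := fun h => hE0 (by rw [hgab, map_mul, h, zero_mul])
      have h1 : (s.erase z.1).card ≤ (E a).natDegree := by
        refine Polynomial.card_le_degree_of_subset_roots fun x hx => ?_
        obtain ⟨hxz, hxs⟩ := Finset.mem_erase.1 hx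
        rw [Polynomial.mem_roots ha0, Polynomial.IsRoot.def, hEeval]
        have h2 : a ∈ c z y := ha
        rw [hall z y ⟨x, hxs⟩ hy (fun h => hxz (congrArg Subtype.val h).symm)] at h2
        exact h2
      rw [Finset.card_erase_of_mem z.2, hcard] at h1
      have h2 := hEdeg a
      have h3 := totalDegree_mul_of_isDomain (left_ne_zero_of_mul hab0) (right_ne_zero_of_mul hab0)
      rw [← hgab] at h3
      have h4 : b.totalDegree = 0 := by omega
      rw [totalDegree_eq_zero_iff_eq_C] at h4
      have hb0 := right_ne_zero_of_mul hab0
      rw [h4] at hb hb0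
      exact hb ((isUnit_iff_ne_zero.2 fun h => hb0 (by rw [h, C_0])).map C)
    obtain ⟨a, b, hgab, hua, hub⟩ := hab
    have h := hgk y hy
    rw [hgab, map_mul, mul_eq_zero] at h
    rcases h with h | h
    · exact main a b hgab hub h
    · exact main b a (hgab.trans (mul_comm a b)) hua h
  have := half_card_add_three_le_card_moved_of_two_homogeneous c htrans hdiag hne
    (fun z => ⟨σ z, hσs z z.2⟩) (fun a b => ?_) ⟨⟨x₀, hx₀⟩, fun h => hmx₀ (congrArg Subtype.val h)⟩
  · rw [Fintype.card_coe, hcard] at this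
    have hc : (Finset.univ.filter fun y : s => (⟨σ y, hσs y y.2⟩ : s) ≠ y).card
        = (s.filter fun y => σ y ≠ y).card := by
      rw [← Finset.card_map (Function.Embedding.subtype _)]
      congr 1
      ext v
      simp
      constructor
      · rintro ⟨hv, h⟩; exact ⟨h, hv⟩
      · rintro ⟨hv, h⟩; exact ⟨h, hv⟩
    omega
  · ext u
    simp only [c, Set.mem_ofPred_eq]
    have : aeval ![σ a, σ b] u = σ (aeval ![a.1, b.1] u) := by
      rw [← AlgHom.comp_apply]
      congr 1
      ext i
      fin_cases i <;> simp
    rw [this, map_eq_zero]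

theorem PowerSeries.transcendental_C_add_X {k : Type*} [Field k] (c : k) :
    Transcendental k (PowerSeries.C c + PowerSeries.X : PowerSeries k) := by
  intro h
  have hX : IsAlgebraic k (PowerSeries.X : PowerSeries k) := by
    have := h.sub (isAlgebraic_algebraMap (R := k) (A := PowerSeries k) c)
    rwa [PowerSeries.algebraMap_apply, Algebra.algebraMap_self, RingHom.id_apply,
      add_sub_cancel_left] at this
  obtain ⟨q, hq, hqX⟩ := hX
  refine hq (Polynomial.coe_injective k ?_)
  rw [Polynomial.coe_zero, ← hqX]
  have : (Polynomial.coeToPowerSeries.algHom (R := k) k) = Polynomial.aeval PowerSeries.X := by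
    ext
    simp
  rw [← this]
  simp

theorem PowerSeries.exists_isRoot_of_simple_root {k : Type*} [Field k] {P : Polynomial k}
    (hP : P.Monic) (hdeg : 0 < P.natDegree) (c : k) {β : k} (hβ : P.eval β = c)
    (hβ' : P.derivative.eval β ≠ 0) :
    ∃ r : PowerSeries k, Polynomial.aeval r P = PowerSeries.C c + PowerSeries.X ∧
      PowerSeries.constantCoeff r = β := by
  have hens : HenselianRing (PowerSeries k) (Ideal.span {(PowerSeries.X : PowerSeries k)}) :=
    inferInstance
  have heval : ∀ Q : Polynomial k, (Q.map (PowerSeries.C (R := k))).eval (PowerSeries.C β)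
      = PowerSeries.C (Q.eval β) := fun Q => by
    rw [Polynomial.eval_map, Polynomial.eval₂_at_apply]
  obtain ⟨r, hr, hrβ⟩ := hens.is_henselian
    (P.map (PowerSeries.C (R := k)) - Polynomial.C (PowerSeries.C c + PowerSeries.X))
    (by
      refine (hP.map _).sub_of_left (lt_of_le_of_lt Polynomial.degree_C_le ?_)
      rw [hP.degree_map, Polynomial.degree_eq_natDegree hP.ne_zero]
      exact_mod_cast hdeg)
    (PowerSeries.C β)
    (by
      rw [Polynomial.eval_sub, Polynomial.eval_C, heval, hβ, sub_add_cancel_left]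
      exact neg_mem (Ideal.mem_span_singleton_self _))
    (by
      rw [Polynomial.derivative_sub, Polynomial.derivative_C, sub_zero, Polynomial.derivative_map,
        heval]
      exact ((isUnit_iff_ne_zero.2 hβ').map _).map _)
  refine ⟨r, ?_, ?_⟩
  · rw [Polynomial.IsRoot, Polynomial.eval_sub, Polynomial.eval_C, sub_eq_zero,
      Polynomial.eval_map] at hr
    exact hr
  · rw [Ideal.mem_span_singleton, PowerSeries.X_dvd_iff] at hrβ
    simpa [sub_eq_zero] using hrβ

theorem PowerSeries.not_X_dvd_sub_of_double_root {k : Type*} [Field k] {P : Polynomial k} {a : k}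
    (hP : P - Polynomial.C (P.eval a) ≠ 0) (ha : P.derivative.eval a = 0) {r : PowerSeries k}
    (hr : Polynomial.aeval r P = PowerSeries.C (P.eval a) + PowerSeries.X) :
    ¬ PowerSeries.X ∣ r - PowerSeries.C a := by
  rintro ⟨m, hm⟩
  have h2 : 1 < (P - Polynomial.C (P.eval a)).rootMultiplicity a := by
    rw [Polynomial.one_lt_rootMultiplicity_iff_isRoot hP]
    simp [Polynomial.IsRoot, ha]
  obtain ⟨Q, hQ⟩ := (Polynomial.le_rootMultiplicity_iff hP).1 h2
  have h3 := congrArg (Polynomial.aeval r) hQ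
  simp only [map_sub, map_mul, map_pow, Polynomial.aeval_X, Polynomial.aeval_C, hr,
    PowerSeries.algebraMap_apply, Algebra.algebraMap_self, RingHom.id_apply,
    add_sub_cancel_left, hm] at h3
  have h4 := congrArg (PowerSeries.coeff 1) h3
  rw [PowerSeries.coeff_one_X, Nat.succ_eq_add_one, mul_pow, mul_assoc, pow_succ, pow_one] at h4
  rw [mul_assoc, show (1:ℕ) = 0 + 1 from rfl, PowerSeries.coeff_succ_X_mul] at h4
  simp at h4

theorem PowerSeries.exists_algEquiv_moving_root {k : Type*} [Field k] [IsAlgClosed k]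
 {P : Polynomial k}
    (hP : P.Monic) (hP' : P.derivative ≠ 0) {a : k} (ha : P.derivative.eval a = 0)
    (U : Finset k) (hU : ∀ β ∈ U, P.eval β = P.eval a ∧ P.derivative.eval β ≠ 0)
    {T : AlgebraicClosure (FractionRing (PowerSeries k))}
    (hT : T = algebraMap (PowerSeries k) _ (PowerSeries.C (P.eval a) + PowerSeries.X)) :
    Transcendental k T ∧ ∃ s : Finset (AlgebraicClosure (FractionRing (PowerSeries k))),
      (∀ x, x ∈ s ↔ Polynomial.aeval x P = T) ∧ s.card = P.natDegree ∧
      ∃ σ : AlgebraicClosure (FractionRing (PowerSeries k)) ≃ₐ[FractionRing (PowerSeries k)]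
          AlgebraicClosure (FractionRing (PowerSeries k)),
        (∃ x ∈ s, σ x ≠ x) ∧ ∃ V ⊆ s, V.card = U.card ∧ ∀ x ∈ V, σ x = x := by
  classical
  let A := PowerSeries k
  let L := FractionRing A
  let Ω := AlgebraicClosure L
  have hinj : Function.Injective (algebraMap A Ω) := by
    rw [IsScalarTower.algebraMap_eq A L Ω]
    exact (algebraMap L Ω).injective.comp (IsFractionRing.injective A L)
  have hdeg : 0 < P.natDegree := by
    refine Nat.pos_of_ne_zero fun h => hP' ?_
    rw [Polynomial.eq_C_of_natDegree_eq_zero h, Polynomial.derivative_C]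
  have hTtr : Transcendental k T := by
    rw [hT]
    exact (transcendental_algebraMap_iff hinj).2 (transcendental_C_add_X _)
  let PL : Polynomial L := P.map (algebraMap k L) -
    Polynomial.C (algebraMap A L (PowerSeries.C (P.eval a) + PowerSeries.X))
  let PΩ : Polynomial Ω := P.map (algebraMap k Ω) - Polynomial.C T
  have hPLΩ : PL.map (algebraMap L Ω) = PΩ := by
    simp only [PL, PΩ, Polynomial.map_sub, Polynomial.map_C, Polynomial.map_map, hT]
    rfl
  have hCT : (Polynomial.C T).degree < (P.map (algebraMap k Ω)).degree := by
    refine lt_of_le_of_lt Polynomial.degree_C_le ?_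
    rw [hP.degree_map, Polynomial.degree_eq_natDegree hP.ne_zero]
    exact_mod_cast hdeg
  have hPΩ : PΩ.Monic := (hP.map _).sub_of_left hCT
  have hnat : PΩ.natDegree = P.natDegree := by
    rw [Polynomial.natDegree_sub_C, hP.natDegree_map]
  have hsplits : PΩ.Splits := IsAlgClosed.splits _
  have hroot : ∀ x, PΩ.IsRoot x ↔ Polynomial.aeval x P = T := by
    intro x
    rw [Polynomial.IsRoot, Polynomial.eval_sub, Polynomial.eval_C, sub_eq_zero,
      Polynomial.eval_map_algebraMap]
  have hnodup : PΩ.roots.Nodup := by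
    rw [Multiset.nodup_iff_count_le_one]
    intro x
    rw [Polynomial.count_roots]
    by_contra! h
    rw [Polynomial.one_lt_rootMultiplicity_iff_isRoot hPΩ.ne_zero, hroot] at h
    have hx : IsAlgebraic k x := by
      refine ⟨P.derivative, hP', ?_⟩
      have := h.2
      rwa [Polynomial.IsRoot, Polynomial.derivative_sub, Polynomial.derivative_C, sub_zero,
        Polynomial.derivative_map, Polynomial.eval_map_algebraMap] at this
    refine hTtr ?_
    rw [← h.1]
    exact IsIntegral.isAlgebraic (adjoin_le_integralClosure hx.isIntegral
      (Polynomial.aeval_mem_adjoin_singleton k x))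
  have hsep : PL.Separable := by
    rw [← Polynomial.separable_map (algebraMap L Ω), hPLΩ]
    exact (Polynomial.nodup_roots_iff_of_splits hPΩ.ne_zero hsplits).1 hnodup
  let s : Finset Ω := PΩ.roots.toFinset
  have hs : ∀ x, x ∈ s ↔ Polynomial.aeval x P = T := by
    intro x
    rw [Multiset.mem_toFinset, Polynomial.mem_roots hPΩ.ne_zero, hroot]
  have hcard : s.card = P.natDegree := by
    rw [Multiset.toFinset_card_of_nodup hnodup, ← hnat, hsplits.natDegree_eq_card_roots]
  refine ⟨hTtr, s, hs, hcard, ?_⟩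
  obtain ⟨x, hxs, hxL⟩ : ∃ x ∈ s, x ∉ Set.range (algebraMap L Ω) := by
    by_contra! hall
    have hA : ∀ x : s, ∃ r : A, algebraMap A Ω r = x := by
      intro x
      obtain ⟨y, hy⟩ := hall x x.2
      have hyint : IsIntegral A y := by
        rw [← isIntegral_algebraMap_iff (algebraMap L Ω).injective (B := Ω), hy]
        refine ⟨P.map (algebraMap k A) - Polynomial.C (PowerSeries.C (P.eval a) + PowerSeries.X),
          (hP.map _).sub_of_left (lt_of_le_of_lt Polynomial.degree_C_le ?_), ?_⟩
        · rw [hP.degree_map, Polynomial.degree_eq_natDegree hP.ne_zero]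
          exact_mod_cast hdeg
        · rw [Polynomial.eval₂_sub, Polynomial.eval₂_C, ← hT, Polynomial.eval₂_map,
            ← IsScalarTower.algebraMap_eq, ← Polynomial.aeval_def, (hs x).1 x.2, sub_self]
      obtain ⟨r, hr⟩ := IsIntegrallyClosed.isIntegral_iff.1 hyint
      exact ⟨r, by rw [IsScalarTower.algebraMap_apply A L Ω, hr, hy]⟩
    choose r hr using hA
    have hprod : ∏ x : s, (PowerSeries.C a - r x) = -PowerSeries.X := by
      apply hinj
      have h1 : PΩ.eval (algebraMap k Ω a) = -algebraMap A Ω PowerSeries.X := by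
        rw [Polynomial.eval_sub, Polynomial.eval_C, Polynomial.eval_map_algebraMap,
          Polynomial.aeval_algebraMap_apply, hT, map_add, Polynomial.coe_aeval_eq_eval]
        have : algebraMap A Ω (PowerSeries.C (P.eval a)) = algebraMap k Ω (P.eval a) :=
          (IsScalarTower.algebraMap_apply k A Ω _).symm
        rw [this, sub_add_cancel_left]
      rw [map_neg, ← h1, hsplits.eq_prod_roots_of_monic hPΩ, Polynomial.eval_multiset_prod,
        map_prod, Multiset.map_map]
      have h2 : ∀ x : s, algebraMap A Ω (PowerSeries.C a - r x) = algebraMap k Ω a - x := fun x => by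
        rw [map_sub, hr]
        congr 1
      simp only [h2]
      rw [Finset.prod_coe_sort s fun x => algebraMap k Ω a - x, Finset.prod,
        Multiset.toFinset_val, hnodup.dedup]
      congr 2
      ext x
      simp
    have hdvd : (PowerSeries.X : A) ∣ ∏ x : s, (PowerSeries.C a - r x) := by
      rw [hprod]; exact (dvd_neg).2 dvd_rfl
    obtain ⟨x, -, hx⟩ := (PowerSeries.X_prime.dvd_finsetProd_iff _).1 hdvd
    refine not_X_dvd_sub_of_double_root ?_ ha (r := r x) ?_ (by rwa [← dvd_neg, neg_sub])
    · intro h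
      rw [sub_eq_zero] at h
      rw [h, Polynomial.natDegree_C] at hdeg
      exact lt_irrefl _ hdeg
    · apply hinj
      rw [← Polynomial.aeval_algebraMap_apply, hr, ← hT]
      exact (hs x).1 x.2
  have hxroot : Polynomial.aeval x PL = 0 := by
    rw [← Polynomial.eval_map_algebraMap, hPLΩ]
    exact (hroot x).2 ((hs x).1 hxs)
  have hxsep : IsSeparable L x := hsep.of_dvd (minpoly.dvd L x hxroot)
  obtain ⟨y, hyx, hy⟩ := (notMem_iff_exists_ne_and_isConjRoot hxsep (IsAlgClosed.splits _)).1
    (fun h => hxL (Algebra.mem_bot.1 h))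
  obtain ⟨σ, hσ⟩ := hy.symm.exists_algEquiv
  refine ⟨σ, ⟨x, hxs, ?_⟩, ?_⟩
  · rw [hσ]; exact hyx.symm
  have hlift : ∀ β : U, ∃ r : A, Polynomial.aeval r P = PowerSeries.C (P.eval a) + PowerSeries.X ∧
      PowerSeries.constantCoeff r = β := fun β =>
    exists_isRoot_of_simple_root hP hdeg _ (hU β β.2).1 (hU β β.2).2
  choose r hr hrβ using hlift
  have hrinj : Function.Injective fun β : U => algebraMap A Ω (r β) := fun β β' h =>
    Subtype.ext (by rw [← hrβ β, ← hrβ β', hinj h])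
  refine ⟨Finset.univ.map ⟨_, hrinj⟩, fun x hx => ?_, by simp, fun x hx => ?_⟩
  · obtain ⟨β, -, rfl⟩ := Finset.mem_map.1 hx
    rw [hs]
    exact (Polynomial.aeval_algebraMap_apply Ω (r β) P).trans (by rw [hr, hT])
  · obtain ⟨β, -, rfl⟩ := Finset.mem_map.1 hx
    change σ (algebraMap A Ω (r β)) = algebraMap A Ω (r β)
    rw [IsScalarTower.algebraMap_apply A L Ω, AlgEquiv.commutes]

section
open Polynomial

theorem Polynomial.natDegree_X_add_one_pow_sub_X_pow_le {K : Type*} [CommRing K] (m : ℕ) :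
    ((X + 1) ^ (m + 1) - X ^ (m + 1) : K[X]).natDegree ≤ m := by
  rw [natDegree_le_iff_coeff_eq_zero]
  intro N hN
  rw [coeff_sub, coeff_X_add_one_pow, coeff_X_pow]
  rcases (Nat.succ_le_of_lt hN).eq_or_lt with h | h
  · simp [← h]
  · rw [Nat.choose_eq_zero_of_lt h]
    simp [h.ne']

theorem Polynomial.coeff_X_add_one_pow_sub_X_pow {K : Type*} [CommRing K] (m : ℕ) :
    ((X + 1) ^ (m + 1) - X ^ (m + 1) : K[X]).coeff m = m + 1 := by
  rw [coeff_sub, coeff_X_add_one_pow, coeff_X_pow]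
  simp

theorem Polynomial.nodup_roots_X_add_one_pow_sub_X_pow {K : Type*} [Field K] {m : ℕ}
    (hm : ((m + 1 : ℕ) : K) ≠ 0) : ((X + 1) ^ (m + 1) - X ^ (m + 1) : K[X]).roots.Nodup := by
  classical
  have h0 : ((X + 1) ^ (m + 1) - X ^ (m + 1) : K[X]) ≠ 0 := fun h => hm (by
    have := coeff_X_add_one_pow_sub_X_pow (K := K) m
    rw [h, coeff_zero] at this
    exact_mod_cast this.symm)
  rw [Multiset.nodup_iff_count_le_one]
  intro b
  rw [count_roots]
  by_contra! h
  rw [one_lt_rootMultiplicity_iff_isRoot h0] at h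
  obtain ⟨h1, h2⟩ := h
  have e1 : (b + 1) ^ (m + 1) = b ^ (m + 1) := by
    simpa [IsRoot, sub_eq_zero] using h1
  have e2 : (b + 1) ^ m = b ^ m := by
    have h3 : ((m + 1 : ℕ) : K) * ((b + 1) ^ m - b ^ m) = 0 := by
      have := h2
      simp only [IsRoot, derivative_sub, derivative_pow, derivative_add, derivative_X,
        derivative_one, eval_sub, eval_mul, eval_pow, eval_add, eval_X, eval_one, eval_C] at this
      simpa [mul_sub] using this
    exact sub_eq_zero.1 ((mul_eq_zero.1 h3).resolve_left hm)
  rw [pow_succ, pow_succ, e2, mul_add, mul_one, add_eq_left] at e1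
  have hb := eq_zero_of_pow_eq_zero e1
  have hb1 := eq_zero_of_pow_eq_zero (e2.trans e1)
  simp [hb] at hb1

theorem Polynomial.rootMultiplicity_sub_C_le {K : Type*} [Field K] [DecidableEq K] {P A : K[X]}
    {q : ℕ} (hA : A.roots.Nodup) (hPA : derivative P = A ^ q) (hA0 : A ≠ 0) (c b : K) :
    (P - C c).rootMultiplicity b ≤ q + 1 := by
  have hne : derivative (P - C c) ≠ 0 := by
    rw [derivative_sub, derivative_C, sub_zero, hPA]
    exact pow_ne_zero q hA0
  have h1 := rootMultiplicity_sub_one_le_derivative_rootMultiplicity_of_ne_zero (P - C c) b hne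
  rw [derivative_sub, derivative_C, sub_zero, hPA, ← count_roots, ← count_roots, roots_pow,
    Multiset.count_nsmul] at h1
  have h2 := Multiset.nodup_iff_count_le_one.1 hA b
  rw [← count_roots]
  have := Nat.mul_le_mul_left q h2
  omega

theorem Polynomial.derivative_X_add_one_pow_sub_X_pow {K : Type*} [Field K] (p : ℕ)
    [Fact p.Prime] [CharP K p] {i : ℕ} (hi : 1 ≤ i) (l : ℕ) :
    derivative ((X + 1) ^ (p ^ i * l + 1) - X ^ (p ^ i * l + 1) : K[X])
      = ((X + 1) ^ l - X ^ l) ^ p ^ i := by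
  have : ((p ^ i * l : ℕ) : K) = 0 := by
    rw [CharP.cast_eq_zero_iff K p]
    exact (dvd_pow_self p (by omega)).mul_right l
  rw [sub_pow_expChar_pow (p := p)]
  simp only [derivative_sub, derivative_pow, derivative_add, derivative_X, derivative_one]
  rw [Nat.cast_add, this]
  simp [← pow_mul, mul_comm l]

/-- The critical points of `(X + 1) ^ t - X ^ t` lying over a given critical value make up at most
half of all critical points, because `b ↦ -1 - b` permutes critical points and negates values. -/
theorem Polynomial.two_mul_card_critical_fiber_le {K : Type*} [Field K] [DecidableEq K]
    {m q : ℕ} (hm : Even m) (hmK : ((m + 1 : ℕ) : K) ≠ 0) (hq : Odd q) (h2 : (2 : K) ≠ 0) {a : K}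
    (B : Finset K)
    (hB : ∀ b ∈ B, (b + 1) ^ (m + 1) = b ^ (m + 1) ∧
      (b + 1) ^ (q * (m + 1) + 1) - b ^ (q * (m + 1) + 1) = a) :
    2 * B.card ≤ m := by
  have h0 : ((X + 1) ^ (m + 1) - X ^ (m + 1) : K[X]) ≠ 0 := fun h => hmK (by
    have := coeff_X_add_one_pow_sub_X_pow (K := K) m
    rw [h, coeff_zero] at this
    exact_mod_cast this.symm)
  have hl : Odd (m + 1) := hm.add_one
  have ht : Even (q * (m + 1) + 1) := (hq.mul hl).add_one
  have hneg : ∀ b : K, -1 - b + 1 = -b := fun b => by ring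
  have hneg' : ∀ b : K, -1 - b = -(b + 1) := fun b => by ring
  have hdisj : Disjoint B (B.image fun b => -1 - b) := by
    rw [Finset.disjoint_left]
    intro b hb hb'
    obtain ⟨b', hb'', rfl⟩ := Finset.mem_image.1 hb'
    have e1 := (hB _ hb).2
    obtain ⟨e3, e2⟩ := hB _ hb''
    rw [hneg, hneg', ht.neg_pow, ht.neg_pow, ← neg_sub, e2] at e1
    have ha : a = 0 := by
      have : 2 * a = 0 := by linear_combination -e1
      exact (mul_eq_zero.1 this).resolve_left h2
    have e4 : b' ^ (q * (m + 1)) = 0 := by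
      rw [ha, pow_succ, pow_succ, mul_comm q, pow_mul, pow_mul, e3] at e2
      rw [mul_comm q, pow_mul]
      linear_combination e2
    have e5 : b' = 0 := eq_zero_of_pow_eq_zero e4
    rw [e5] at e3
    simp at e3
  have hsub : B ∪ (B.image fun b => -1 - b) ⊆
      ((X + 1) ^ (m + 1) - X ^ (m + 1) : K[X]).roots.toFinset := by
    intro b hb
    rw [Multiset.mem_toFinset, mem_roots h0]
    simp only [IsRoot, eval_sub, eval_pow, eval_add, eval_X, eval_one, sub_eq_zero]
    rcases Finset.mem_union.1 hb with hb | hb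
    · exact (hB b hb).1
    · obtain ⟨b', hb', rfl⟩ := Finset.mem_image.1 hb
      rw [hneg, hneg', hl.neg_pow, hl.neg_pow, (hB b' hb').1]
  have h3 := Finset.card_le_card hsub
  rw [Finset.card_union_of_disjoint hdisj, Finset.card_image_of_injective _
    (fun b b' h => by simpa using h)] at h3
  have h4 := (Multiset.toFinset_card_le _).trans
    ((card_roots' _).trans (natDegree_X_add_one_pow_sub_X_pow_le (K := K) m))
  omega

/-- If the derivative of `P` is the `q`-th power of a polynomial with simple roots, then a fibre of
`P` contains at least `deg P - (q + 1) * r` simple points, where `r` is the number of critical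
points in it. -/
theorem Polynomial.exists_simple_and_critical_points {K : Type*} [Field K] [IsAlgClosed K]
    [DecidableEq K] {P A : K[X]} {q : ℕ} (hdeg : 0 < P.natDegree)
    (hA : A.roots.Nodup) (hA0 : A ≠ 0) (hPA : derivative P = A ^ q) (c : K) :
    ∃ U B : Finset K, (∀ β ∈ U, P.eval β = c ∧ P.derivative.eval β ≠ 0) ∧
      (∀ β ∈ B, P.eval β = c ∧ A.eval β = 0) ∧ P.natDegree ≤ U.card + (q + 1) * B.card := by
  have hPc : P - C c ≠ 0 := fun h => by
    rw [sub_eq_zero.1 h, natDegree_C] at hdeg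
    exact lt_irrefl _ hdeg
  let S := (P - C c).roots.toFinset
  have hS : ∀ β ∈ S, P.eval β = c := fun β hβ => by
    rw [Multiset.mem_toFinset, mem_roots hPc] at hβ
    simpa [IsRoot, sub_eq_zero] using hβ
  refine ⟨S.filter fun β => A.eval β ≠ 0, S.filter fun β => ¬ A.eval β ≠ 0, fun β hβ => ?_,
    fun β hβ => ?_, ?_⟩
  · obtain ⟨h1, h2⟩ := Finset.mem_filter.1 hβ
    exact ⟨hS β h1, by rw [hPA, eval_pow]; exact pow_ne_zero _ h2⟩
  · obtain ⟨h1, h2⟩ := Finset.mem_filter.1 hβ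
    exact ⟨hS β h1, not_not.1 h2⟩
  · have h1 : P.natDegree = ∑ β ∈ S, (P - C c).roots.count β := by
      rw [Multiset.toFinset_sum_count_eq, ← (IsAlgClosed.splits (P - C c)).natDegree_eq_card_roots,
        natDegree_sub_C]
    rw [h1, ← Finset.sum_filter_add_sum_filter_not S fun β => A.eval β ≠ 0]
    refine add_le_add ?_ ?_
    · rw [Finset.card_eq_sum_ones]
      refine Finset.sum_le_sum fun β hβ => ?_
      rw [count_roots]
      by_contra! h
      rw [one_lt_rootMultiplicity_iff_isRoot hPc] at h
      have h2 := h.2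
      rw [derivative_sub, derivative_C, sub_zero, hPA, IsRoot, eval_pow] at h2
      exact (Finset.mem_filter.1 hβ).2 (eq_zero_of_pow_eq_zero h2)
    · rw [mul_comm, ← smul_eq_mul]
      refine Finset.sum_le_card_nsmul _ _ _ fun β _ => ?_
      rw [count_roots]
      exact rootMultiplicity_sub_C_le hA hPA hA0 c β

end

/-- Case (B.2), assuming `g_t` irreducible over `F_p`: suppose `t = p^i·ℓ + 1`
with `ℓ ∣ p^i - 1` and `ℓ < p^i - 1`. Then `g_t` is absolutely irreducible. -/
theorem gt_abs_irred_case_B2_of_irred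
    (p t : ℕ) [Fact p.Prime] (hp2 : p ≠ 2) (ht : 3 ≤ t) (hpt : ¬ p ∣ t)
    (g : MvPolynomial (Fin 2) (ZMod p))
    (hg : ((X 0 + 1) ^ t - X 0 ^ t - (X 1 + 1) ^ t + X 1 ^ t : MvPolynomial (Fin 2) (ZMod p))
        = (X 0 - X 1) * g)
    (i l : ℕ) (hi : 1 ≤ i) (hl3 : 3 ≤ l) (hlodd : Odd l) (hlp : ¬ p ∣ l)
    (htval : t = p ^ i * l + 1)
    (hdvd : l ∣ p ^ i - 1) (hlt : l < p ^ i - 1)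
    (hirr : Irreducible g) :
    Irreducible (MvPolynomial.map (algebraMap (ZMod p) (AlgebraicClosure (ZMod p))) g) := by
  classical
  let F := ZMod p
  let k := AlgebraicClosure F
  let Ω := AlgebraicClosure (FractionRing (PowerSeries k))
  have : CharP k p := charP_of_injective_algebraMap (algebraMap F k).injective p
  have hp : p.Prime := Fact.out
  obtain ⟨m, rfl⟩ : ∃ m, l = m + 1 := ⟨l - 1, by omega⟩
  have hm : Even m := by
    rcases hlodd with ⟨r, hr⟩
    exact ⟨r, by omega⟩
  have hmk : ((m + 1 : ℕ) : k) ≠ 0 := by rwa [Ne, CharP.cast_eq_zero_iff k p]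
  have h2k : (2 : k) ≠ 0 := by
    have : ((2 : ℕ) : k) ≠ 0 := by
      rw [Ne, CharP.cast_eq_zero_iff k p]
      exact fun h => hp2 ((Nat.prime_dvd_prime_iff_eq hp Nat.prime_two).1 h)
    exact_mod_cast this
  have hq : Odd (p ^ i) := (hp.odd_of_ne_two hp2).pow
  have hcast : ∀ (K : Type) [Field K] [CharP K p], ((p ^ i * (m + 1) : ℕ) : K) = 0 := fun K _ _ => by
    rw [CharP.cast_eq_zero_iff K p]
    exact (dvd_pow_self p (by omega)).mul_right _
  let P : Polynomial F := (Polynomial.X + 1) ^ t - Polynomial.X ^ t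
  let Pk : Polynomial k := (Polynomial.X + 1) ^ t - Polynomial.X ^ t
  let A : Polynomial k := (Polynomial.X + 1) ^ (m + 1) - Polynomial.X ^ (m + 1)
  have hPk : P.map (algebraMap F k) = Pk := by simp [P, Pk]
  have hcoeff : P.coeff (p ^ i * (m + 1)) = 1 := by
    simp only [P, htval, Polynomial.coeff_X_add_one_pow_sub_X_pow]
    rw [hcast F, zero_add]
  have hle : P.natDegree ≤ p ^ i * (m + 1) := by
    simp only [P, htval]
    exact Polynomial.natDegree_X_add_one_pow_sub_X_pow_le _
  have hP : P.Monic := Polynomial.monic_of_natDegree_le_of_coeff_eq_one _ hle hcoeff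
  have hdeg : P.natDegree = p ^ i * (m + 1) :=
    le_antisymm hle (Polynomial.le_natDegree_of_ne_zero (by rw [hcoeff]; exact one_ne_zero))
  have hPkm : Pk.Monic := hPk ▸ hP.map _
  have hdegk : Pk.natDegree = p ^ i * (m + 1) := by rw [← hPk, hP.natDegree_map, hdeg]
  have hAcoeff : A.coeff m ≠ 0 := by
    rw [Polynomial.coeff_X_add_one_pow_sub_X_pow]
    exact_mod_cast hmk
  have hA0 : A ≠ 0 := fun h => hAcoeff (by rw [h, Polynomial.coeff_zero])
  have hAdeg : A.degree ≠ 0 := fun h => by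
    have h1 := Polynomial.le_natDegree_of_ne_zero hAcoeff
    have h2 : A.natDegree = 0 := Polynomial.natDegree_eq_of_degree_eq_some h
    omega
  have hder : Pk.derivative = A ^ p ^ i := by
    simp only [Pk, A, htval]
    exact Polynomial.derivative_X_add_one_pow_sub_X_pow p hi _
  obtain ⟨a, ha⟩ := IsAlgClosed.exists_root A hAdeg
  have ha' : Pk.derivative.eval a = 0 := by
    rw [hder, Polynomial.eval_pow, ha.eq_zero, zero_pow (pow_pos hp.pos i).ne']
  have hqpos : 0 < p ^ i := pow_pos hp.pos i
  obtain ⟨U, B, hU, hB, hUB⟩ := Polynomial.exists_simple_and_critical_points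
    (P := Pk) (by rw [hdegk]; positivity)
    (Polynomial.nodup_roots_X_add_one_pow_sub_X_pow hmk) hA0 hder (Pk.eval a)
  have hBm : 2 * B.card ≤ m := by
    refine Polynomial.two_mul_card_critical_fiber_le hm hmk hq h2k (a := Pk.eval a) B fun b hb => ?_
    obtain ⟨h1, h2⟩ := hB b hb
    refine ⟨by simpa [A, sub_eq_zero] using h2, ?_⟩
    rw [← htval, ← h1]
    simp [Pk]
  obtain ⟨hT, s, hs, hcard, σ, hmove, V, hVs, hVU, hVσ⟩ :=
    PowerSeries.exists_algEquiv_moving_root hPkm (by rw [hder]; exact pow_ne_zero _ hA0) ha' U hU rfl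
  have haeval : ∀ x : MvPolynomial (Fin 2) F, Polynomial.aeval x P = (x + 1) ^ t - x ^ t :=
    fun x => by simp [P]
  refine irreducible_map_of_few_moved_roots hP (g := g) ?_ hirr
    (hT.restrictScalars (algebraMap F k).injective) s (fun x => ?_) ?_
    ((σ : Ω →ₐ[FractionRing (PowerSeries k)] Ω).restrictScalars k) ?_ hmove ?_
  · rw [haeval, haeval, ← hg]
    ring
  · rw [hs, ← hPk, Polynomial.aeval_map_algebraMap]
  · rw [hcard, hdeg, hdegk]
  · rw [IsScalarTower.algebraMap_apply (PowerSeries k) (FractionRing (PowerSeries k)) Ω]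
    exact σ.commutes _
  · have hsub : (s.filter fun y => σ y ≠ y) ⊆ s \ V := fun x hx => by
      obtain ⟨h1, h2⟩ := Finset.mem_filter.1 hx
      exact Finset.mem_sdiff.2 ⟨h1, fun h => h2 (hVσ x h)⟩
    have h3 := Finset.card_le_card hsub
    rw [Finset.card_sdiff_of_subset hVs, hVU, hcard, hdegk] at h3
    rw [hdegk] at hUB
    rw [hdeg]
    have h4 : 2 * (s.filter fun y => σ y ≠ y).card ≤ (p ^ i + 1) * m := by
      have := Nat.mul_le_mul_left (p ^ i + 1) hBm
      have h5 : (p ^ i + 1) * (2 * B.card) = 2 * ((p ^ i + 1) * B.card) := by ring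
      omega
    refine lt_of_le_of_lt h4 ?_
    have h6 : (p ^ i + 1) * m = p ^ i * m + m := by ring
    have h7 : p ^ i * (m + 1) = p ^ i * m + p ^ i := by ring
    omega
end
end

section
/- Let K be a finite subfield of F̄_p containing F_p, and let G_t(X,Y,Z) ∈ F_p[X,Y,Z] be the homogenization of g_t(x,y). Suppose there is a point P = (a,b,c) ∈ K³, (a,b,c) ≠ (0,0,0), with G_t(P) = 0 at which at least one of the three partial derivatives of G_t does not vanish (i.e., P is a nonsingular K-rational point of the projective curve G_t = 0). Then there exists a nonconstant homogeneous polynomial H(X,Y,Z) ∈ K[X,Y,Z] dividing G_t whose image in F̄_p[X,Y,Z] is irreducible. -/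
open MvPolynomial

noncomputable section

namespace MvPolynomial

variable {σ R : Type*}

/-- The ring homomorphism `f ↦ ∑ d, f_d T ^ d` recording the homogeneous components `f_d` of a
polynomial as the coefficients of a univariate polynomial. -/
def gradingHom [CommRing R] : MvPolynomial σ R →ₐ[R] Polynomial (MvPolynomial σ R) :=
  aeval fun i => Polynomial.C (X i) * Polynomial.X

theorem gradingHom_monomial [CommRing R] (m : σ →₀ ℕ) (r : R) :
    gradingHom (monomial m r) = Polynomial.C (monomial m r) * Polynomial.X ^ m.degree := by
  rw [gradingHom, aeval_monomial, monomial_eq]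
  simp only [mul_pow, Finsupp.prod, Finset.prod_mul_distrib, map_mul, map_prod, map_pow,
    Finset.prod_pow_eq_pow_sum, Finsupp.degree_apply]
  rw [mul_assoc]
  rfl

theorem coeff_gradingHom [CommRing R] (f : MvPolynomial σ R) (d : ℕ) :
    (gradingHom f).coeff d = homogeneousComponent d f := by
  induction f using MvPolynomial.induction_on' with
  | monomial m r =>
    rw [gradingHom_monomial, Polynomial.coeff_C_mul_X_pow,
      homogeneousComponent_of_mem (isHomogeneous_monomial r rfl)]
  | add f g hf hg => rw [map_add, Polynomial.coeff_add, hf, hg, map_add]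

theorem IsHomogeneous.gradingHom_eq [CommRing R] {f : MvPolynomial σ R} {n : ℕ}
    (hf : f.IsHomogeneous n) : gradingHom f = Polynomial.C f * Polynomial.X ^ n := by
  ext1 d
  rw [coeff_gradingHom, Polynomial.coeff_C_mul_X_pow, homogeneousComponent_of_mem hf]

theorem isHomogeneous_of_natTrailingDegree_gradingHom [CommRing R] {f : MvPolynomial σ R}
    (h : (gradingHom f).natTrailingDegree = (gradingHom f).natDegree) :
    f.IsHomogeneous (gradingHom f).natDegree := by
  intro m hm
  have hc : (gradingHom f).coeff m.degree ≠ 0 := fun h0 => by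
    rw [coeff_gradingHom] at h0
    apply hm
    have := congrArg (coeff m) h0
    rwa [coeff_homogeneousComponent, if_pos rfl, coeff_zero] at this
  rw [show Finsupp.weight 1 m = m.degree from
    (DFunLike.congr_fun Finsupp.degree_eq_weight_one m).symm]
  exact le_antisymm (Polynomial.le_natDegree_of_ne_zero hc)
    (h ▸ Polynomial.natTrailingDegree_le_of_ne_zero hc)

/-- A divisor of a nonzero homogeneous polynomial over a domain is homogeneous. -/
theorem IsHomogeneous.exists_isHomogeneous_of_dvd [CommRing R] [IsDomain R]
    {f h : MvPolynomial σ R} {n : ℕ} (hf : f.IsHomogeneous n) (hf0 : f ≠ 0) (hd : h ∣ f) :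
    ∃ d, h.IsHomogeneous d := by
  obtain ⟨k, rfl⟩ := hd
  have e : gradingHom h * gradingHom k = Polynomial.C (h * k) * Polynomial.X ^ n := by
    rw [← map_mul, hf.gradingHom_eq]
  have hne : gradingHom h * gradingHom k ≠ 0 := by
    rw [e]
    exact mul_ne_zero (Polynomial.C_ne_zero.2 hf0) (pow_ne_zero _ Polynomial.X_ne_zero)
  obtain ⟨h1, h2⟩ := mul_ne_zero_iff.1 hne
  have e1 := congrArg Polynomial.natDegree e
  have e2 := congrArg Polynomial.natTrailingDegree e
  rw [Polynomial.natDegree_mul h1 h2, Polynomial.natDegree_C_mul_X_pow _ _ hf0] at e1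
  rw [Polynomial.natTrailingDegree_mul h1 h2, Polynomial.C_mul_X_pow_eq_monomial,
    Polynomial.natTrailingDegree_monomial hf0] at e2
  have l1 := (gradingHom h).natTrailingDegree_le_natDegree
  have l2 := (gradingHom k).natTrailingDegree_le_natDegree
  exact ⟨_, isHomogeneous_of_natTrailingDegree_gradingHom (by omega)⟩

theorem totalDegree_pos_of_irreducible {F : Type*} [Field F] {f : MvPolynomial σ F}
    (hf : Irreducible f) : 0 < f.totalDegree := by
  by_contra h
  have hC := totalDegree_eq_zero_iff_eq_C.1 (Nat.eq_zero_of_not_pos h)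
  have h0 : coeff 0 f ≠ 0 := fun h0 => hf.ne_zero (by rw [hC, h0, C_0])
  exact hf.not_isUnit (by rw [hC]; exact (isUnit_iff_ne_zero.2 h0).map C)

/-- The derivatives of a multiple of two polynomials vanishing at `P` vanish at `P`, so the
irreducible factors through a nonsingular zero of a polynomial are unique up to association. -/
theorem associated_of_dvd_of_eval_eq_zero {F : Type*} [Field F] {f h k : MvPolynomial σ F}
    {P : σ → F} {j : σ} (hj : eval P (pderiv j f) ≠ 0) (hh : Irreducible h) (hk : Irreducible k)
    (hhf : h ∣ f) (hkf : k ∣ f) (hhP : eval P h = 0) (hkP : eval P k = 0) : Associated h k := by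
  by_contra hna
  obtain ⟨u, rfl⟩ := hhf
  rcases hk.prime.dvd_or_dvd hkf with hd | ⟨v, rfl⟩
  · exact hna (hk.associated_of_dvd hh hd).symm
  · exact hj (by simp [Derivation.leibniz, hhP, hkP])

theorem exists_irreducible_dvd_of_eval_eq_zero {F : Type*} [Field F] {f : MvPolynomial σ F}
    {P : σ → F} (hf : f ≠ 0) (hP : eval P f = 0) :
    ∃ h, Irreducible h ∧ h ∣ f ∧ eval P h = 0 := by
  obtain ⟨s, hs, u, rfl⟩ := WfDvdMonoid.exists_factors f hf
  have hu : eval P (u : MvPolynomial σ F) ≠ 0 := (u.isUnit.map (eval P)).ne_zero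
  rw [map_mul, mul_eq_zero, or_iff_left hu, map_multiset_prod, Multiset.prod_eq_zero_iff,
    Multiset.mem_map] at hP
  obtain ⟨h, hmem, h0⟩ := hP
  exact ⟨h, hs h hmem, (Multiset.dvd_prod hmem).mul_right _, h0⟩

/-- Over a Galois extension `L / K`, a polynomial defined over `K` with a nonsingular `K`-rational
zero has an `L`-irreducible factor defined over `K`. -/
theorem exists_irreducible_dvd_of_nonsingular {K L : Type*} [Field K] [Field L] [Algebra K L]
    [IsGalois K L] {f : MvPolynomial σ L} (hf : ∀ τ : L ≃ₐ[K] L, map (τ : L →+* L) f = f)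
    {P : σ → L} (hP : ∀ (τ : L ≃ₐ[K] L) i, τ (P i) = P i) (hfP : eval P f = 0)
    {j : σ} (hj : eval P (pderiv j f) ≠ 0) :
    ∃ h : MvPolynomial σ L, (∀ m, h.coeff m ∈ Set.range (algebraMap K L)) ∧
      h ∣ f ∧ Irreducible h := by
  have hf0 : f ≠ 0 := by
    rintro rfl
    simp at hj
  obtain ⟨k, hk, hkf, hkP⟩ := exists_irreducible_dvd_of_eval_eq_zero hf0 hfP
  obtain ⟨m₀, hm₀⟩ := ne_zero_iff.1 hk.ne_zero
  have hu : IsUnit (C (coeff m₀ k)⁻¹ : MvPolynomial σ L) :=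
    (isUnit_iff_ne_zero.2 (inv_ne_zero hm₀)).map C
  set h := C (coeff m₀ k)⁻¹ * k with hh_def
  have hh : Irreducible h := (irreducible_isUnit_mul hu).2 hk
  have hhf : h ∣ f := (hu.mul_left_dvd).2 hkf
  have hhP : eval P h = 0 := by rw [hh_def, map_mul, hkP, mul_zero]
  have hm1 : coeff m₀ h = 1 := by rw [hh_def, coeff_C_mul, inv_mul_cancel₀ hm₀]
  refine ⟨h, fun m => ?_, hhf, hh⟩
  rw [InfiniteGalois.mem_range_algebraMap_iff_fixed]
  intro τ
  have hτP : eval P (map (τ : L →+* L) h) = 0 := by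
    have e := map_eval (τ : L →+* L) P h
    rwa [hhP, map_zero, show (τ : L →+* L) ∘ P = P from _root_.funext (hP τ), eq_comm] at e
  have hτ : Irreducible (map (τ : L →+* L) h) :=
    (MulEquiv.irreducible_iff (mapEquiv σ (τ : L ≃+* L))).2 hh
  have hτf : map (τ : L →+* L) h ∣ f := by
    have := map_dvd (map (σ := σ) (τ : L →+* L)) hhf
    rwa [hf τ] at this
  obtain ⟨u, hu⟩ := associated_of_dvd_of_eval_eq_zero hj hh hτ hhf hτf hhP hτP
  obtain ⟨r, -, hr⟩ := isUnit_iff_eq_C_of_isReduced.1 u.isUnit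
  rw [hr, mul_comm] at hu
  have h1 := congrArg (coeff m₀) hu
  rw [coeff_C_mul, coeff_map, hm1, mul_one, map_one] at h1
  have h2 := congrArg (coeff m) hu
  rw [coeff_C_mul, coeff_map, h1, one_mul] at h2
  exact h2.symm

end MvPolynomial

/-- If the projective curve `G_t = 0` (where `G_t` is the homogenization of
`g_t`) has a nonsingular `K`-rational point for a finite subfield `K` of the
algebraic closure of `F_p`, then `G_t` has a nonconstant homogeneous factor
with coefficients in `K` which is irreducible over the algebraic closure. -/
theorem Gt_has_abs_irred_factor_over_K_of_nonsingular_point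
    (p t : ℕ) [Fact p.Prime] (hp2 : p ≠ 2) (ht : 3 ≤ t) (hpt : ¬ p ∣ t)
    (g : MvPolynomial (Fin 2) (ZMod p))
    (hg : ((X 0 + 1) ^ t - X 0 ^ t - (X 1 + 1) ^ t + X 1 ^ t : MvPolynomial (Fin 2) (ZMod p))
        = (X 0 - X 1) * g)
    (G : MvPolynomial (Fin 3) (ZMod p))
    (hGhom : G.IsHomogeneous (t - 2))
    (hGdeh : MvPolynomial.aeval ![X 0, X 1, 1] G = g)
    (K : Subfield (AlgebraicClosure (ZMod p))) (hKfin : (K : Set (AlgebraicClosure (ZMod p))).Finite)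
    (a b c : AlgebraicClosure (ZMod p)) (ha : a ∈ K) (hb : b ∈ K) (hc : c ∈ K)
    (hP0 : ¬ (a = 0 ∧ b = 0 ∧ c = 0))
    (hPG : MvPolynomial.eval ![a, b, c]
        (MvPolynomial.map (algebraMap (ZMod p) (AlgebraicClosure (ZMod p))) G) = 0)
    (hns : ∃ j : Fin 3, MvPolynomial.eval ![a, b, c]
        (MvPolynomial.pderiv j
          (MvPolynomial.map (algebraMap (ZMod p) (AlgebraicClosure (ZMod p))) G)) ≠ 0) :
    ∃ H : MvPolynomial (Fin 3) (AlgebraicClosure (ZMod p)),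
      (∀ m, H.coeff m ∈ K) ∧ 0 < H.totalDegree ∧ (∃ d, H.IsHomogeneous d) ∧
      H ∣ MvPolynomial.map (algebraMap (ZMod p) (AlgebraicClosure (ZMod p))) G ∧
      Irreducible H := by
  obtain ⟨j, hj⟩ := hns
  have : Finite K := hKfin
  have : IsGalois K (AlgebraicClosure (ZMod p)) := by
    have : CharP K p := (algebraMap K (AlgebraicClosure (ZMod p))).charP
      (algebraMap K (AlgebraicClosure (ZMod p))).injective p
    have : Algebra.IsAlgebraic K (AlgebraicClosure (ZMod p)) :=
      ⟨fun x => ((Algebra.IsIntegral.isIntegral (R := ZMod p) x).map_of_comp_eq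
        (ZMod.castHom dvd_rfl K) (RingHom.id _) (Subsingleton.elim _ _)).isAlgebraic⟩
    have : IsAlgClosure K (AlgebraicClosure (ZMod p)) := ⟨inferInstance, inferInstance⟩
    exact {}
  have hfix (τ : AlgebraicClosure (ZMod p) ≃ₐ[K] AlgebraicClosure (ZMod p))
      {x : AlgebraicClosure (ZMod p)} (hx : x ∈ K) : τ x = x := τ.commutes ⟨x, hx⟩
  obtain ⟨H, hHK, hHG, hH⟩ := exists_irreducible_dvd_of_nonsingular (K := K)
    (f := map (algebraMap (ZMod p) (AlgebraicClosure (ZMod p))) G) (P := ![a, b, c])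
    (fun τ => by rw [map_map]; congr 2; exact Subsingleton.elim _ _)
    (fun τ i => by fin_cases i <;> [exact hfix τ ha; exact hfix τ hb; exact hfix τ hc])
    hPG hj
  refine ⟨H, fun m => ?_, totalDegree_pos_of_irreducible hH,
    (hGhom.map _).exists_isHomogeneous_of_dvd ?_ hHG, hHG, hH⟩
  · obtain ⟨y, hy⟩ := hHK m
    exact hy ▸ y.2
  · intro h0
    rw [h0] at hj
    simp at hj
end
end

section
/- Assume t is even and t is congruent to neither 0 nor 1 modulo p. Then the set S_t := {(x,y) ∈ F̄_p × F̄_p : x ≠ y, (x+1)^{t−1} = x^{t−1}, (y+1)^{t−1} = y^{t−1}, x^{t−1} = y^{t−1}} has cardinality at most (t−2)(t−4)/2. -/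
open MvPolynomial

noncomputable section

/-- When `n ≠ 0` in `K`, the equation `(x + 1) ^ n = x ^ n` has at most `n - 1` solutions. -/
theorem exists_finset_add_one_pow_eq_pow {K : Type*} [Field K] {n : ℕ} (hn : (n : K) ≠ 0) :
    ∃ R : Finset K, (∀ x, x ∈ R ↔ (x + 1) ^ n = x ^ n) ∧ R.card ≤ n - 1 := by
  classical
  have hn0 : n ≠ 0 := by
    rintro rfl
    simp at hn
  set f : Polynomial K := (Polynomial.X + 1) ^ n - Polynomial.X ^ n with hf
  have hf0 : f ≠ 0 := by
    intro h
    have hc : f.coeff (n - 1) = n := by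
      rw [hf, Polynomial.coeff_sub, Polynomial.coeff_X_add_one_pow, Polynomial.coeff_X_pow,
        if_neg (by omega), sub_zero, ← Nat.choose_symm (by omega), Nat.sub_sub_self (by omega),
        Nat.choose_one_right]
    rw [h, Polynomial.coeff_zero] at hc
    exact hn hc.symm
  have hdeg : f.natDegree ≤ n - 1 := by
    rw [Polynomial.natDegree_le_iff_coeff_eq_zero]
    intro N hN
    rw [hf, Polynomial.coeff_sub, Polynomial.coeff_X_add_one_pow, Polynomial.coeff_X_pow]
    rcases eq_or_ne N n with rfl | hne
    · simp
    · rw [if_neg hne, Nat.choose_eq_zero_of_lt (by omega)]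
      simp
  refine ⟨f.roots.toFinset, fun x => ?_, ?_⟩
  · rw [Multiset.mem_toFinset, Polynomial.mem_roots hf0]
    simp [Polynomial.IsRoot.def, hf, sub_eq_zero]
  · exact (Multiset.toFinset_card_le _).trans ((Polynomial.card_roots' f).trans hdeg)

/-- If `n` is odd and `R` is the solution set of `(x + 1) ^ n = x ^ n`, then at most half of the
elements of `R` share a given `n`-th power, because `x ↦ -1 - x` preserves `R` and negates
`n`-th powers. -/
theorem two_mul_card_filter_pow_eq_le {K : Type*} [Field K] [DecidableEq K] (h2 : (2 : K) ≠ 0)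
    {n : ℕ} (hn : Odd n) {R : Finset K} (hR : ∀ x, x ∈ R ↔ (x + 1) ^ n = x ^ n) {c : K}
    (hc : c ≠ 0) : 2 * (R.filter fun y => y ^ n = c).card ≤ R.card := by
  set A := R.filter fun y => y ^ n = c with hA
  have hneg : ∀ y ∈ A, (-1 - y) ^ n = -c := by
    intro y hy
    obtain ⟨hyR, hyc⟩ := Finset.mem_filter.1 hy
    rw [show -1 - y = -(y + 1) by ring, hn.neg_pow, (hR y).1 hyR, hyc]
  have hinj : Function.Injective fun y : K => -1 - y := sub_right_injective
  have hdisj : Disjoint A (A.image fun y => -1 - y) := by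
    rw [Finset.disjoint_left]
    intro z hz hz'
    obtain ⟨y, hy, rfl⟩ := Finset.mem_image.1 hz'
    have h : c = -c := (Finset.mem_filter.1 hz).2.symm.trans (hneg y hy)
    have h' : 2 * c = 0 := by linear_combination h
    exact (mul_ne_zero h2 hc) h'
  have hsub : A ∪ A.image (fun y => -1 - y) ⊆ R := by
    refine Finset.union_subset (Finset.filter_subset _ _) fun z hz => ?_
    obtain ⟨y, hy, rfl⟩ := Finset.mem_image.1 hz
    rw [hR, hneg y hy, show -1 - y + 1 = -y by ring, hn.neg_pow, (Finset.mem_filter.1 hy).2]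
  have hcard := Finset.card_le_card hsub
  rw [Finset.card_union_of_disjoint hdisj, Finset.card_image_of_injective _ hinj] at hcard
  omega

/-- If `t` is even and `t ≢ 0, 1 (mod p)`, then the set of singular points of
the curve `g_t = 0` has cardinality at most `(t-2)(t-4)/2`. -/
theorem card_singular_points_le
    (p t : ℕ) [Fact p.Prime] (hp2 : p ≠ 2) (ht : 3 ≤ t) (hpt : ¬ p ∣ t)
    (hte : Even t) (h0 : t % p ≠ 0) (h1 : t % p ≠ 1) :
    ({P : AlgebraicClosure (ZMod p) × AlgebraicClosure (ZMod p) |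
        P.1 ≠ P.2 ∧ (P.1 + 1) ^ (t - 1) = P.1 ^ (t - 1) ∧
        (P.2 + 1) ^ (t - 1) = P.2 ^ (t - 1) ∧
        P.1 ^ (t - 1) = P.2 ^ (t - 1)} : Set _).Finite ∧
    ({P : AlgebraicClosure (ZMod p) × AlgebraicClosure (ZMod p) |
        P.1 ≠ P.2 ∧ (P.1 + 1) ^ (t - 1) = P.1 ^ (t - 1) ∧
        (P.2 + 1) ^ (t - 1) = P.2 ^ (t - 1) ∧
        P.1 ^ (t - 1) = P.2 ^ (t - 1)} : Set _).ncard ≤ (t - 2) * (t - 4) / 2 := by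
  classical
  set K := AlgebraicClosure (ZMod p)
  have hp : p.Prime := Fact.out
  have : CharP K p := charP_of_injective_algebraMap (algebraMap (ZMod p) K).injective p
  have h2 : (2 : K) ≠ 0 := by
    intro h
    have hdvd : p ∣ 2 := (CharP.cast_eq_zero_iff K p 2).1 (by exact_mod_cast h)
    exact hp2 ((Nat.prime_dvd_prime_iff_eq hp Nat.prime_two).1 hdvd)
  have hn : ((t - 1 : ℕ) : K) ≠ 0 := by
    intro h
    obtain ⟨k, hk⟩ := (CharP.cast_eq_zero_iff K p _).1 h
    apply h1
    rw [show t = 1 + p * k by omega, Nat.add_mul_mod_self_left, Nat.mod_eq_of_lt hp.one_lt]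
  have hodd : Odd (t - 1) := Nat.Even.sub_odd (by omega) hte odd_one
  obtain ⟨R, hR, hRcard⟩ := exists_finset_add_one_pow_eq_pow hn
  have hR0 : ∀ x ∈ R, x ≠ 0 := by
    rintro x hx rfl
    have h := (hR 0).1 hx
    rw [zero_add, one_pow, zero_pow (by omega)] at h
    exact one_ne_zero h
  set T : Finset (K × K) := R.biUnion fun x =>
    ((R.filter fun y => y ^ (t - 1) = x ^ (t - 1)).erase x).image (Prod.mk x) with hT
  have hTcard : T.card ≤ R.card * ((t - 4) / 2) := by
    refine Finset.card_biUnion_le_card_mul _ _ _ fun x hx => ?_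
    refine Finset.card_image_le.trans ?_
    rw [Finset.card_erase_of_mem (by simp [hx])]
    have := two_mul_card_filter_pow_eq_le h2 hodd hR (pow_ne_zero (t - 1) (hR0 x hx))
    omega
  have hset : {P : K × K | P.1 ≠ P.2 ∧ (P.1 + 1) ^ (t - 1) = P.1 ^ (t - 1) ∧
      (P.2 + 1) ^ (t - 1) = P.2 ^ (t - 1) ∧ P.1 ^ (t - 1) = P.2 ^ (t - 1)} ⊆
      (T : Set (K × K)) := by
    rintro ⟨x, y⟩ ⟨hxy, hx, hy, hpow⟩
    simp only [hT, Finset.mem_coe, Finset.mem_biUnion, Finset.mem_image, Finset.mem_erase,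
      Finset.mem_filter]
    exact ⟨x, (hR x).2 hx, y, ⟨hxy.symm, (hR y).2 hy, hpow.symm⟩, rfl⟩
  refine ⟨T.finite_toSet.subset hset, ?_⟩
  calc _ ≤ (T : Set (K × K)).ncard := Set.ncard_le_ncard hset T.finite_toSet
    _ = T.card := Set.ncard_coe_finset T
    _ ≤ R.card * ((t - 4) / 2) := hTcard
    _ ≤ (t - 2) * ((t - 4) / 2) := Nat.mul_le_mul_right _ (show R.card ≤ t - 2 by omega)
    _ = (t - 2) * (t - 4) / 2 :=
      (Nat.mul_div_assoc _ (by have := hte.two_dvd; omega)).symm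
end
end

section
/- Assume t is even, t is congruent to neither 0 nor 1 modulo p, and g_t(x,y) is irreducible in F_p[x,y]. Let K be a finite subfield of F̄_p containing F_p, let G_t(X,Y,Z) be the homogenization of g_t, and suppose there is a point P = (a,b,c) ∈ K³, (a,b,c) ≠ (0,0,0), with G_t(P) = 0 at which at least one partial derivative of G_t does not vanish. Then every irreducible factor of the image of g_t in F̄_p[x,y] is a scalar multiple (by an element of F̄_p) of a polynomial with coefficients in K. -/
open MvPolynomial

noncomputable section

theorem Subfield.exists_forall_mem_iff_pow_eq_self {F : Type*} [Field F] (p : ℕ) [Fact p.Prime]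
    [CharP F p] (K : Subfield F) [Finite K] :
    ∃ n : ℕ, 0 < n ∧ ∀ x, x ∈ K ↔ x ^ p ^ n = x := by
  have := Fintype.ofFinite K
  obtain ⟨n, -, hn⟩ := FiniteField.card K p
  refine ⟨n, n.pos, fun x => ?_⟩
  have hsplits : (Polynomial.X ^ Fintype.card K - Polynomial.X : Polynomial K).Splits := by
    rw [Polynomial.splits_iff_card_roots, FiniteField.roots_X_pow_card_sub_X,
      FiniteField.X_pow_card_sub_X_natDegree_eq _ Fintype.one_lt_card]
    rfl
  have h := hsplits.roots_map (Subfield.subtype K)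
  rw [FiniteField.roots_X_pow_card_sub_X] at h
  have hx := h ▸ Multiset.mem_map (b := x)
  rw [← hn]
  simpa [sub_eq_zero, iff_comm, FiniteField.X_pow_card_sub_X_ne_zero F
    (Fintype.one_lt_card (α := K))] using hx

namespace MvPolynomial

/-- The algebra homomorphism `xᵢ ↦ xᵢ T`. -/
def scaleVars (R : Type*) [CommRing R] :
    MvPolynomial (Fin 2) R →ₐ[R] Polynomial (MvPolynomial (Fin 2) R) :=
  aeval fun i => Polynomial.C (X i) * Polynomial.X

/-- The homogenization of a bivariate polynomial, the last of the three variables being the new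
one. -/
def homogenization {R : Type*} [CommRing R] (f : MvPolynomial (Fin 2) R) :
    MvPolynomial (Fin 3) R :=
  (scaleVars R f).reverse.eval₂ (rename (Fin.castSucc : Fin 2 → Fin 3)).toRingHom (X 2)

theorem homogenization_mul {R : Type*} [CommRing R] [IsDomain R] (f g : MvPolynomial (Fin 2) R) :
    homogenization (f * g) = homogenization f * homogenization g := by
  simp [homogenization, Polynomial.eval₂_mul]

theorem homogenization_one {R : Type*} [CommRing R] [Nontrivial R] :
    homogenization (1 : MvPolynomial (Fin 2) R) = 1 := by
  have : (1 : Polynomial (MvPolynomial (Fin 2) R)).reverse = 1 := by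
    rw [← Polynomial.C_1, Polynomial.reverse_C]
  simp [homogenization, this]

theorem scaleVars_map {R S : Type*} [CommRing R] [CommRing S] (φ : R →+* S)
    (f : MvPolynomial (Fin 2) R) :
    scaleVars S (map φ f) = (scaleVars R f).map (map φ) := by
  induction f using MvPolynomial.induction_on with
  | C a => simp [scaleVars, Polynomial.algebraMap_apply, algebraMap_eq]
  | add p q hp hq => simp [hp, hq]
  | mul_X p i hp =>
    rw [map_mul, map_mul, hp, map_mul, Polynomial.map_mul]
    simp [scaleVars]

theorem homogenization_map {R S : Type*} [CommRing R] [CommRing S] (φ : R →+* S)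
    (hφ : Function.Injective φ) (f : MvPolynomial (Fin 2) R) :
    homogenization (map φ f) = map φ (homogenization f) := by
  have h : (map φ).comp (rename (Fin.castSucc : Fin 2 → Fin 3)).toRingHom =
      ((rename (Fin.castSucc : Fin 2 → Fin 3)).toRingHom).comp (map φ) := by
    ext <;> simp
  rw [homogenization, homogenization, scaleVars_map, Polynomial.reverse,
    Polynomial.natDegree_map_eq_of_injective (map_injective φ hφ), Polynomial.reflect_map,
    Polynomial.eval₂_map, Polynomial.hom_eval₂, h, map_X]
  rfl

theorem scaleVars_dehomogenization_monomial {R : Type*} [CommRing R] (m : Fin 3 →₀ ℕ) (r : R) :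
    scaleVars R (aeval ![X 0, X 1, 1] (monomial m r)) =
      Polynomial.C (C r * (X 0 ^ m 0 * X 1 ^ m 1)) * Polynomial.X ^ (m 0 + m 1) := by
  rw [aeval_monomial, Finsupp.prod_fintype _ _ (by simp), Fin.prod_univ_three]
  simp [scaleVars, algebraMap_eq, Polynomial.algebraMap_apply]
  ring

theorem homogenization_dehomogenization {R : Type*} [CommRing R] {n : ℕ}
    {G : MvPolynomial (Fin 3) R} (hG : G.IsHomogeneous n)
    (hn : n ≤ (scaleVars R (aeval ![X 0, X 1, 1] G)).natDegree) :
    homogenization (aeval ![X 0, X 1, 1] G) = G := by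
  have hdeg : ∀ m ∈ G.support, m 0 + m 1 + m 2 = n := fun m hm => by
    have := hG (mem_support_iff.mp hm)
    simpa [Finsupp.weight_apply, Finsupp.sum_fintype, Fin.sum_univ_three] using this
  have hsum : scaleVars R (aeval ![X 0, X 1, 1] G) = ∑ m ∈ G.support,
      Polynomial.C (C (G.coeff m) * (X 0 ^ m 0 * X 1 ^ m 1)) * Polynomial.X ^ (m 0 + m 1) := by
    conv_lhs => rw [G.as_sum]
    simp only [map_sum, scaleVars_dehomogenization_monomial]
  have hle : (scaleVars R (aeval ![X 0, X 1, 1] G)).natDegree ≤ n := by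
    rw [hsum]
    refine Polynomial.natDegree_sum_le_of_forall_le _ _ fun m hm => ?_
    exact (Polynomial.natDegree_C_mul_X_pow_le _ _).trans (by have := hdeg m hm; omega)
  have hreflect : ∀ (s : Finset (Fin 3 →₀ ℕ))
      (F : (Fin 3 →₀ ℕ) → Polynomial (MvPolynomial (Fin 2) R)),
      (∑ m ∈ s, F m).reflect n = ∑ m ∈ s, (F m).reflect n := fun s F => by
    induction s using Finset.cons_induction with
    | empty => simp
    | cons a s ha ih => rw [Finset.sum_cons, Finset.sum_cons, Polynomial.reflect_add, ih]
  rw [homogenization, Polynomial.reverse, hle.antisymm hn, hsum, hreflect,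
    Polynomial.eval₂_finsetSum]
  conv_rhs => rw [G.as_sum]
  refine Finset.sum_congr rfl fun m hm => ?_
  have h2 := hdeg m hm
  rw [Polynomial.reflect_C_mul_X_pow, Polynomial.revAt_le (by omega),
    show n - (m 0 + m 1) = m 2 by omega, Polynomial.eval₂_mul, Polynomial.eval₂_C,
    Polynomial.eval₂_X_pow, monomial_eq, Finsupp.prod_fintype _ _ (by simp), Fin.prod_univ_three]
  simp [mul_assoc]

/-- Two factors of a polynomial cannot both vanish at a nonsingular point. -/
theorem eval_ne_zero_of_mul_of_pderiv_ne_zero {σ R : Type*} [CommRing R] {A B : MvPolynomial σ R}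
    {P : σ → R} {j : σ} (h : eval P (pderiv j (A * B)) ≠ 0) (hA : eval P A = 0) :
    eval P B ≠ 0 := fun hB => h (by simp [hA, hB])

theorem exists_map_eq_of_map_frobenius_eq {σ F : Type*} (p : ℕ) [Fact p.Prime] [Field F]
    [Algebra (ZMod p) F] [CharP F p] {f : MvPolynomial σ F} (hf : map (frobenius F p) f = f) :
    ∃ f₀ : MvPolynomial σ (ZMod p), map (algebraMap (ZMod p) F) f₀ = f := by
  refine mem_range_map_iff_coeffs_subset.mpr fun x hx => ?_
  obtain ⟨m, -, rfl⟩ := mem_coeffs_iff.mp hx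
  have hm : coeff m f ^ p = coeff m f := by
    conv_rhs => rw [← hf, coeff_map, frobenius_def]
  have := (Subfield.mem_bot_iff_pow_eq_self F p).mpr hm
  rw [mem_bot_iff_intCast p] at this
  obtain ⟨n, hn⟩ := this
  exact ⟨n, by simp [← hn]⟩

theorem coeff_iterate_map_frobenius {σ F : Type*} (p : ℕ) [Fact p.Prime] [Field F] [CharP F p]
    (f : MvPolynomial σ F) (n : ℕ) (m : σ →₀ ℕ) :
    coeff m ((map (frobenius F p))^[n] f) = coeff m f ^ p ^ n := by
  induction n with
  | zero => simp
  | succ n ih => rw [Function.iterate_succ_apply', coeff_map, ih, frobenius_def, ← pow_mul, pow_succ]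

theorem map_frobenius_map_algebraMap {σ F : Type*} (p : ℕ) [Fact p.Prime] [Field F]
    [Algebra (ZMod p) F] [CharP F p] (u : MvPolynomial σ (ZMod p)) :
    map (frobenius F p) (map (algebraMap (ZMod p) F) u) = map (algebraMap (ZMod p) F) u := by
  ext m
  rw [coeff_map, coeff_map, frobenius_def, ← map_pow, ZMod.pow_card]

theorem iterate_map_frobenius_dvd {σ F : Type*} (p : ℕ) [Fact p.Prime] [Field F]
    [Algebra (ZMod p) F] [CharP F p] {f : MvPolynomial σ F} {g : MvPolynomial σ (ZMod p)}
    (h : f ∣ map (algebraMap (ZMod p) F) g) (n : ℕ) :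
    (map (frobenius F p))^[n] f ∣ map (algebraMap (ZMod p) F) g := by
  induction n with
  | zero => exact h
  | succ n ih =>
    rw [Function.iterate_succ_apply', ← map_frobenius_map_algebraMap p g]
    exact map_dvd _ ih

theorem irreducible_iterate_map_frobenius {σ F : Type*} (p : ℕ) [Fact p.Prime] [Field F] [CharP F p]
    [PerfectRing F p] {f : MvPolynomial σ F} (hf : Irreducible f) (n : ℕ) :
    Irreducible ((map (frobenius F p))^[n] f) := by
  induction n with
  | zero => exact hf
  | succ n ih =>
    rw [Function.iterate_succ_apply']
    exact (MulEquiv.irreducible_iff (mapEquiv σ (frobeniusEquiv F p))).mpr ih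

theorem eval_homogenization_iterate_map_frobenius {F : Type*} (p : ℕ) [Fact p.Prime] [Field F]
    [CharP F p] (f : MvPolynomial (Fin 2) F) (n : ℕ) {P : Fin 3 → F}
    (hP : eval P (homogenization f) = 0) :
    eval (fun i => P i ^ p ^ n) (homogenization ((map (frobenius F p))^[n] f)) = 0 := by
  induction n with
  | zero => simpa using hP
  | succ n ih =>
    rw [Function.iterate_succ_apply', homogenization_map _ (frobenius F p).injective, eval_map]
    have h := (map_eq_zero (frobenius F p)).mpr ih
    rw [← eval₂_id, hom_eval₂, RingHom.comp_id] at h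
    simpa only [frobenius_def, ← pow_mul, ← pow_succ] using h

theorem isUnit_eval_homogenization {F : Type*} [Field F] {u : MvPolynomial (Fin 2) F}
    (hu : IsUnit u) (P : Fin 3 → F) : IsUnit (eval P (homogenization u)) := by
  obtain ⟨v, hv⟩ := hu.exists_right_inv
  refine IsUnit.of_mul_eq_one (eval P (homogenization v)) ?_
  rw [← map_mul, ← homogenization_mul, hv, homogenization_one, map_one]

theorem exists_irreducible_dvd_of_eval_homogenization_eq_zero {F : Type*} [Field F]
    {f : MvPolynomial (Fin 2) F} (hf : f ≠ 0) {P : Fin 3 → F}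
    (hP : eval P (homogenization f) = 0) :
    ∃ q, Irreducible q ∧ q ∣ f ∧ eval P (homogenization q) = 0 := by
  induction f using WfDvdMonoid.induction_on_irreducible with
  | zero => exact absurd rfl hf
  | unit u hu => exact absurd hP (isUnit_eval_homogenization hu P).ne_zero
  | mul f q hf0 hq ih =>
    rw [homogenization_mul, map_mul, mul_eq_zero] at hP
    rcases hP with hP | hP
    · exact ⟨q, hq, dvd_mul_right _ _, hP⟩
    · obtain ⟨r, hr, hrf, hrP⟩ := ih hf0 hP
      exact ⟨r, hr, hrf.mul_left _, hrP⟩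

theorem eq_of_associated_of_coeff_eq_one {σ F : Type*} [Field F] {f g : MvPolynomial σ F}
    (h : Associated f g) {m : σ →₀ ℕ} (hf : coeff m f = 1) (hg : coeff m g = 1) : f = g := by
  obtain ⟨u, rfl⟩ := h
  obtain ⟨r, -, hr⟩ := isUnit_iff_eq_C_of_isReduced.mp u.isUnit
  rw [hr, mul_comm, coeff_C_mul, hf, mul_one] at hg
  simp [hr, hg]

theorem exists_smul_eq_of_associated {σ F : Type*} [Field F] {f g : MvPolynomial σ F}
    (h : Associated f g) : ∃ r : F, g = r • f := by
  obtain ⟨u, rfl⟩ := h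
  obtain ⟨r, -, hr⟩ := isUnit_iff_eq_C_of_isReduced.mp u.isUnit
  exact ⟨r, by rw [hr, mul_comm, smul_eq_C_mul]⟩

/-- If `g` is irreducible over `𝔽_p`, the irreducible factors of `g` over an extension are
Frobenius conjugate. -/
theorem exists_associated_iterate_map_frobenius {σ F : Type*} (p : ℕ) [Fact p.Prime]
    [Field F] [Algebra (ZMod p) F] [CharP F p] [PerfectRing F p]
    {g : MvPolynomial σ (ZMod p)} (hg : Irreducible g) {f h : MvPolynomial σ F}
    (hf : Irreducible f) (hfg : f ∣ map (algebraMap (ZMod p) F) g) {m : σ →₀ ℕ}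
    (hm : coeff m f = 1) (hper : f ∈ Function.periodicPts (map (frobenius F p)))
    (hh : Irreducible h) (hhg : h ∣ map (algebraMap (ZMod p) F) g) :
    ∃ n, Associated ((map (frobenius F p))^[n] f) h := by
  set Φ : MvPolynomial σ F →+* MvPolynomial σ F := map (frobenius F p)
  have hcoeff (i : ℕ) : coeff m (Φ^[i] f) = 1 := by
    rw [coeff_iterate_map_frobenius, hm, one_pow]
  set d := Function.minimalPeriod Φ f with hd
  have hdpos : 0 < d := Function.minimalPeriod_pos_of_mem_periodicPts hper
  set N := ∏ i ∈ Finset.range d, Φ^[i] f with hN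
  have hNg : N ∣ map (algebraMap (ZMod p) F) g := by
    refine Finset.prod_dvd_of_isRelPrime (fun i hi j hj hij => ?_)
      fun i _ => iterate_map_frobenius_dvd p hfg i
    refine (irreducible_iterate_map_frobenius p hf i).isRelPrime_iff_not_dvd.mpr fun hdiv => hij ?_
    refine Function.iterate_injOn_Iio_minimalPeriod (by simpa using hi) (by simpa using hj) ?_
    exact eq_of_associated_of_coeff_eq_one
      ((irreducible_iterate_map_frobenius p hf i).associated_of_dvd
        (irreducible_iterate_map_frobenius p hf j) hdiv)
      (hcoeff i) (hcoeff j)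
  have hNfix : Φ N = N := by
    have h1 := Finset.prod_range_succ (fun i => Φ^[i] f) d
    rw [Finset.prod_range_succ', hd, Function.iterate_minimalPeriod] at h1
    rw [hN, map_prod]
    simp_rw [← Function.iterate_succ_apply']
    exact mul_right_cancel₀ hf.ne_zero h1
  obtain ⟨N₀, hN₀⟩ := exists_map_eq_of_map_frobenius_eq p hNfix
  obtain ⟨Q, hQ⟩ := hNg
  have hinj : Function.Injective (map (σ := σ) (algebraMap (ZMod p) F)) :=
    map_injective _ (algebraMap (ZMod p) F).injective
  have hg0 : map (algebraMap (ZMod p) F) g ≠ 0 := (map_ne_zero_iff _ hinj).mpr hg.ne_zero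
  have hQfix : Φ Q = Q := by
    refine mul_left_cancel₀ (left_ne_zero_of_mul (hQ ▸ hg0)) ?_
    rw [← hQ, ← map_frobenius_map_algebraMap p g, hQ, map_mul, hNfix]
  obtain ⟨Q₀, hQ₀⟩ := exists_map_eq_of_map_frobenius_eq p hQfix
  have hgmul : g = N₀ * Q₀ := hinj (by rw [hQ, map_mul, hN₀, hQ₀])
  have hNunit : ¬ IsUnit N₀ := fun hu => by
    have := hu.map (map (algebraMap (ZMod p) F))
    rw [hN₀] at this
    exact hf.not_isUnit (isUnit_of_dvd_unit
      (Finset.dvd_prod_of_mem (fun i => Φ^[i] f) (Finset.mem_range.mpr hdpos)) this)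
  have hQunit : IsUnit Q := by
    rw [← hQ₀]
    exact ((hg.isUnit_or_isUnit hgmul).resolve_left hNunit).map _
  have hhN : h ∣ N := by rwa [hQ, hQunit.dvd_mul_right] at hhg
  obtain ⟨i, -, hi⟩ := hh.prime.exists_mem_finset_dvd hhN
  exact ⟨i, (hh.associated_of_dvd (irreducible_iterate_map_frobenius p hf i) hi).symm⟩

theorem natDegree_scaleVars_ge {F : Type*} [Field F] {t : ℕ} (ht : 3 ≤ t) (ht0 : (t : F) ≠ 0)
    {g : MvPolynomial (Fin 2) F}
    (hg : ((X 0 + 1) ^ t - X 0 ^ t - (X 1 + 1) ^ t + X 1 ^ t : MvPolynomial (Fin 2) F)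
      = (X 0 - X 1) * g) :
    t - 2 ≤ (scaleVars F g).natDegree := by
  have h := congrArg (fun f => (scaleVars F f).map (eval ![1, 0])) hg
  simp only [map_add, map_sub, map_mul, map_pow, map_one, scaleVars, aeval_X, Polynomial.map_add,
    Polynomial.map_sub, Polynomial.map_mul, Polynomial.map_pow, Polynomial.map_one,
    Polynomial.map_C, Polynomial.map_X, eval_X, Matrix.cons_val_zero, Matrix.cons_val_one,
    Polynomial.C_0, one_mul, zero_mul, sub_zero, zero_add, one_pow] at h
  have hc := congrArg (fun f => Polynomial.coeff f (t - 1)) h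
  obtain ⟨s, rfl⟩ : ∃ s, t = s + 2 := ⟨t - 2, by omega⟩
  have hs : s ≠ 0 := by omega
  simp [Polynomial.coeff_X_add_one_pow, Polynomial.coeff_X_pow, Polynomial.coeff_one] at hc
  refine (Polynomial.le_natDegree_of_ne_zero (p := (scaleVars F g).map (eval ![1, 0])) ?_).trans
    Polynomial.natDegree_map_le
  change ((scaleVars F g).map (eval ![1, 0])).coeff s ≠ 0
  rw [Polynomial.coeff_map]
  refine ne_of_eq_of_ne hc.symm ?_
  exact_mod_cast ht0

theorem map_algebraMap_dehomogenization {R S : Type*} [CommRing R] [CommRing S] [Algebra R S]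
    (G : MvPolynomial (Fin 3) R) :
    aeval ![X 0, X 1, 1] (map (algebraMap R S) G) =
      map (algebraMap R S) (aeval ![X 0, X 1, (1 : MvPolynomial (Fin 2) R)] G) := by
  induction G using MvPolynomial.induction_on with
  | C a => simp [algebraMap_eq]
  | add p q hp hq => simp only [map_add, hp, hq]
  | mul_X q i hq =>
    simp only [map_mul, hq, map_X, aeval_X]
    fin_cases i <;> simp

/-- If an irreducible `g` over `𝔽_p` has homogenization `G` with a nonsingular point over a finite
field `K`, its irreducible factors are, up to scalars, defined over `K`. -/
theorem exists_smul_coeff_mem_of_nonsingular_point {F : Type*} (p : ℕ) [Fact p.Prime] [Field F]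
    [Algebra (ZMod p) F] [CharP F p] [PerfectRing F p] {g : MvPolynomial (Fin 2) (ZMod p)}
    (hirr : Irreducible g) (K : Subfield F) [Finite K] {P : Fin 3 → F} (hPK : ∀ i, P i ∈ K)
    (hP : eval P (homogenization (map (algebraMap (ZMod p) F) g)) = 0) {j : Fin 3}
    (hj : eval P (pderiv j (homogenization (map (algebraMap (ZMod p) F) g))) ≠ 0)
    {h : MvPolynomial (Fin 2) F} (hh : Irreducible h)
    (hhg : h ∣ map (algebraMap (ZMod p) F) g) :
    ∃ (r : F) (h' : MvPolynomial (Fin 2) F), (∀ m, h'.coeff m ∈ K) ∧ h = r • h' := by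
  have hg0 : map (algebraMap (ZMod p) F) g ≠ 0 :=
    (map_ne_zero_iff _ (map_injective _ (algebraMap (ZMod p) F).injective)).mpr hirr.ne_zero
  obtain ⟨q, hq, hqg, hqP⟩ := exists_irreducible_dvd_of_eval_homogenization_eq_zero hg0 hP
  obtain ⟨m, hm⟩ := ne_zero_iff.mp hq.ne_zero
  obtain ⟨f, hfq, hfm⟩ : ∃ f, Associated q f ∧ coeff m f = 1 := by
    refine ⟨q * C (coeff m q)⁻¹, ?_, by simp [mul_comm q, hm]⟩
    exact (associated_mul_unit_right q _ ((isUnit_iff_ne_zero.mpr (inv_ne_zero hm)).map C))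
  have hf : Irreducible f := hfq.irreducible_iff.mp hq
  have hfg : f ∣ map (algebraMap (ZMod p) F) g := hfq.symm.dvd.trans hqg
  have hfP : eval P (homogenization f) = 0 := by
    obtain ⟨u, rfl⟩ := hfq
    rw [homogenization_mul, map_mul, hqP, zero_mul]
  obtain ⟨n, hn, hK⟩ := K.exists_forall_mem_iff_pow_eq_self p
  have hfix : (map (frobenius F p))^[n] f = f := by
    have hconjP := eval_homogenization_iterate_map_frobenius p f n hfP
    simp only [(hK _).mp (hPK _)] at hconjP
    have hconj := irreducible_iterate_map_frobenius p hf n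
    refine eq_of_associated_of_coeff_eq_one (m := m) ?_
      (by rw [coeff_iterate_map_frobenius, hfm, one_pow]) hfm
    by_contra hassoc
    have hrel : IsRelPrime ((map (frobenius F p))^[n] f) f :=
      hconj.isRelPrime_iff_not_dvd.mpr fun hd => hassoc (hconj.associated_of_dvd hf hd)
    obtain ⟨Q, hQ⟩ := hrel.mul_dvd (iterate_map_frobenius_dvd p hfg n) hfg
    rw [hQ, mul_assoc, homogenization_mul] at hj
    refine eval_ne_zero_of_mul_of_pderiv_ne_zero hj hconjP ?_
    rw [homogenization_mul, map_mul, hfP, zero_mul]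
  obtain ⟨i, hi⟩ := exists_associated_iterate_map_frobenius p hirr hf hfg hfm
    (Function.mk_mem_periodicPts hn hfix) hh hhg
  obtain ⟨r, hr⟩ := exists_smul_eq_of_associated hi
  refine ⟨r, _, fun m => ?_, hr⟩
  rw [coeff_iterate_map_frobenius]
  refine K.pow_mem ((hK _).mpr ?_) _
  rw [← coeff_iterate_map_frobenius, hfix]

end MvPolynomial

/-- Assume `t` even, `t ≢ 0, 1 (mod p)`, `g_t` irreducible over `F_p`, and that
the projective curve `G_t = 0` has a nonsingular `K`-rational point for a
finite subfield `K` of the algebraic closure of `F_p`. Then every irreducible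
factor of `g_t` over the algebraic closure is a scalar multiple of a
polynomial with coefficients in `K`. -/
theorem abs_irred_factors_have_coeffs_in_K
    (p t : ℕ) [Fact p.Prime] (hp2 : p ≠ 2) (ht : 3 ≤ t) (hpt : ¬ p ∣ t)
    (g : MvPolynomial (Fin 2) (ZMod p))
    (hg : ((X 0 + 1) ^ t - X 0 ^ t - (X 1 + 1) ^ t + X 1 ^ t : MvPolynomial (Fin 2) (ZMod p))
        = (X 0 - X 1) * g)
    (hte : Even t) (h0 : t % p ≠ 0) (h1 : t % p ≠ 1)
    (hirr : Irreducible g)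
    (G : MvPolynomial (Fin 3) (ZMod p))
    (hGhom : G.IsHomogeneous (t - 2))
    (hGdeh : MvPolynomial.aeval ![X 0, X 1, 1] G = g)
    (K : Subfield (AlgebraicClosure (ZMod p))) (hKfin : (K : Set (AlgebraicClosure (ZMod p))).Finite)
    (a b c : AlgebraicClosure (ZMod p)) (ha : a ∈ K) (hb : b ∈ K) (hc : c ∈ K)
    (hP0 : ¬ (a = 0 ∧ b = 0 ∧ c = 0))
    (hPG : MvPolynomial.eval ![a, b, c]
        (MvPolynomial.map (algebraMap (ZMod p) (AlgebraicClosure (ZMod p))) G) = 0)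
    (hns : ∃ j : Fin 3, MvPolynomial.eval ![a, b, c]
        (MvPolynomial.pderiv j
          (MvPolynomial.map (algebraMap (ZMod p) (AlgebraicClosure (ZMod p))) G)) ≠ 0) :
    ∀ h : MvPolynomial (Fin 2) (AlgebraicClosure (ZMod p)),
      Irreducible h →
      h ∣ MvPolynomial.map (algebraMap (ZMod p) (AlgebraicClosure (ZMod p))) g →
      ∃ (γ : AlgebraicClosure (ZMod p)) (h' : MvPolynomial (Fin 2) (AlgebraicClosure (ZMod p))),
        (∀ m, h'.coeff m ∈ K) ∧ h = γ • h' := by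
  
  have hhomog : homogenization (map (algebraMap (ZMod p) (AlgebraicClosure (ZMod p))) g) =
      map (algebraMap (ZMod p) (AlgebraicClosure (ZMod p))) G := by
    have hdeg := natDegree_scaleVars_ge
      (g := map (algebraMap (ZMod p) (AlgebraicClosure (ZMod p))) g) ht
      (by rwa [Ne, CharP.cast_eq_zero_iff (AlgebraicClosure (ZMod p)) p])
      (by simpa using congrArg (map (algebraMap (ZMod p) (AlgebraicClosure (ZMod p)))) hg)
    rw [← hGdeh, ← map_algebraMap_dehomogenization] at hdeg ⊢
    exact homogenization_dehomogenization (hGhom.map _) hdeg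
  obtain ⟨j, hj⟩ := hns
  rw [← hhomog] at hPG hj
  have := hKfin.to_subtype
  intro h hh hhg
  exact exists_smul_coeff_mem_of_nonsingular_point p hirr K
    (fun i => by fin_cases i <;> assumption) hPG hj hh hhg
end
end

section
/- Let (α,β) ∈ F̄_p × F̄_p, and write f_t(x+α, y+β) = F_0 + F_1 + F_2 + ⋯ as a sum of homogeneous components F_i of degree i in F̄_p[x,y]. If F_1 = 0 and F_2 = 0 (as polynomials), then t ≡ 0 (mod p) or t ≡ 1 (mod p). -/
open MvPolynomial

noncomputable section

theorem X_add_C_pow_eq_sum_monomial {σ R : Type*} [CommSemiring R] (i : σ) (a : R) (t : ℕ) :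
    (X i + C a : MvPolynomial σ R) ^ t =
      ∑ k ∈ Finset.range (t + 1),
        monomial (Finsupp.single i k) (a ^ (t - k) * (t.choose k : R)) := by
  rw [add_pow]
  refine Finset.sum_congr rfl fun k _ => ?_
  rw [← C_mul_X_pow_eq_monomial, C_mul, C_pow, map_natCast]
  ring

theorem coeff_single_X_add_C_pow {σ R : Type*} [CommSemiring R] (i : σ) (a : R)
    {t n : ℕ} (hn : n ≤ t) :
    coeff (Finsupp.single i n) ((X i + C a : MvPolynomial σ R) ^ t) =
      a ^ (t - n) * (t.choose n : R) := by
  classical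
  rw [X_add_C_pow_eq_sum_monomial, coeff_sum]
  simp only [coeff_monomial, (Finsupp.single_injective i).eq_iff]
  rw [Finset.sum_ite_eq', if_pos (Finset.mem_range.2 (by omega))]

theorem coeff_single_X_add_C_pow_of_ne {σ R : Type*} [CommSemiring R] {i j : σ} (hij : i ≠ j)
    (a : R) (t : ℕ) {n : ℕ} (hn : n ≠ 0) :
    coeff (Finsupp.single i n) ((X j + C a : MvPolynomial σ R) ^ t) = 0 := by
  classical
  rw [X_add_C_pow_eq_sum_monomial, coeff_sum]
  refine Finset.sum_eq_zero fun k _ => ?_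
  rw [coeff_monomial, if_neg]
  intro h
  have h' := DFunLike.congr_fun h i
  rw [Finsupp.single_eq_same, Finsupp.single_eq_of_ne hij] at h'
  exact hn h'.symm

/-- The vanishing of the degree-`n` component of `f_t(x+α, y+β)`, read off at `x ^ n`. -/
theorem sub_pow_mul_choose_eq_zero_of_homogeneousComponent_eq_zero {R : Type*} [CommRing R]
    {t n : ℕ} (hn : n ≠ 0) (hnt : n ≤ t) (α β : R)
    (h : MvPolynomial.homogeneousComponent n
        (((X 0 + C α + 1) ^ t - (X 0 + C α) ^ t - (X 1 + C β + 1) ^ t + (X 1 + C β) ^ t :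
          MvPolynomial (Fin 2) R)) = 0) :
    ((α + 1) ^ (t - n) - α ^ (t - n)) * (t.choose n : R) = 0 := by
  have hc := congrArg (coeff (Finsupp.single 0 n)) h
  have hs (i : Fin 2) (a : R) : (X i + C a + 1 : MvPolynomial (Fin 2) R) = X i + C (a + 1) := by
    rw [C_add, C_1, add_assoc]
  rw [coeff_homogeneousComponent, if_pos (Finsupp.degree_single _ _), hs, hs, coeff_add,
    coeff_sub, coeff_sub, coeff_single_X_add_C_pow _ _ hnt, coeff_single_X_add_C_pow _ _ hnt,
    coeff_single_X_add_C_pow_of_ne (by decide) _ _ hn,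
    coeff_single_X_add_C_pow_of_ne (by decide) _ _ hn, coeff_zero] at hc
  linear_combination hc

/-- If the degree-1 and degree-2 homogeneous components of
`f_t(x+α, y+β)` both vanish, then `t ≡ 0` or `1 (mod p)`. -/
theorem mod_p_of_F1_F2_eq_zero
    (p t : ℕ) [Fact p.Prime] (hp2 : p ≠ 2) (ht : 3 ≤ t) (hpt : ¬ p ∣ t)
    (α β : AlgebraicClosure (ZMod p))
    (h1 : MvPolynomial.homogeneousComponent 1
        (((X 0 + C α + 1) ^ t - (X 0 + C α) ^ t - (X 1 + C β + 1) ^ t + (X 1 + C β) ^ t :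
          MvPolynomial (Fin 2) (AlgebraicClosure (ZMod p)))) = 0)
    (h2 : MvPolynomial.homogeneousComponent 2
        (((X 0 + C α + 1) ^ t - (X 0 + C α) ^ t - (X 1 + C β + 1) ^ t + (X 1 + C β) ^ t :
          MvPolynomial (Fin 2) (AlgebraicClosure (ZMod p)))) = 0) :
    t % p = 0 ∨ t % p = 1 := by
  have hp : p.Prime := Fact.out
  have e1 := sub_pow_mul_choose_eq_zero_of_homogeneousComponent_eq_zero one_ne_zero
    (by omega) α β h1
  have e2 := sub_pow_mul_choose_eq_zero_of_homogeneousComponent_eq_zero two_ne_zero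
    (by omega) α β h2
  right
  by_contra ht1
  have : CharP (AlgebraicClosure (ZMod p)) p := charP_of_injective_algebraMap
    (algebraMap (ZMod p) (AlgebraicClosure (ZMod p))).injective p
  have hpt1 : ¬ p ∣ t - 1 := by
    intro hd
    have hmod : 1 ≡ t [MOD p] := (Nat.modEq_iff_dvd' (by omega)).2 hd
    exact ht1 (Eq.trans hmod.symm (Nat.mod_eq_of_lt hp.one_lt))
  have hch : ¬ p ∣ t.choose 2 := by
    intro hd
    have h2c : t * (t - 1) = t.choose 2 * 2 := by
      rw [Nat.choose_two_right, Nat.div_mul_cancel (Nat.even_mul_pred_self t).two_dvd]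
    rcases hp.dvd_mul.1 (h2c ▸ hd.mul_right 2) with hd | hd
    exacts [hpt hd, hpt1 hd]
  rw [← CharP.cast_eq_zero_iff (AlgebraicClosure (ZMod p)) p] at hpt hch
  rw [Nat.choose_one_right] at e1
  have d1 := sub_eq_zero.1 ((mul_eq_zero.1 e1).resolve_right hpt)
  have d2 := sub_eq_zero.1 ((mul_eq_zero.1 e2).resolve_right hch)
  obtain ⟨m, rfl⟩ : ∃ m, t = m + 3 := ⟨t - 3, by omega⟩
  rw [show m + 3 - 1 = m + 2 by omega] at d1
  rw [show m + 3 - 2 = m + 1 by omega] at d2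
  have hα : α ^ (m + 1) = 0 := by
    linear_combination d1 - (α + 1) * d2
  rw [pow_eq_zero_iff (Nat.succ_ne_zero m)] at hα
  simp [hα] at d2
end
end

section
/- Assume t is even and t is congruent to neither 0 nor 1 modulo p. Let (α,β) ∈ F̄_p × F̄_p be a singular point of f_t, i.e., in the decomposition f_t(x+α, y+β) = F_0 + F_1 + F_2 + ⋯ into homogeneous components one has F_0 = 0 and F_1 = 0. Then F_2 ≠ 0 and F_2 factors in F̄_p[x,y] as a product of two linear forms, neither of which is a scalar multiple of the other. -/
open MvPolynomial

noncomputable section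

/-- The binomial theorem, one homogeneous component at a time. -/
theorem MvPolynomial.homogeneousComponent_X_add_C_pow {σ R : Type*} [CommSemiring R]
    (i : σ) (a : R) (t n : ℕ) :
    homogeneousComponent n ((X i + C a : MvPolynomial σ R) ^ t) =
      C (t.choose n * a ^ (t - n)) * X i ^ n := by
  have hterm (m : ℕ) : homogeneousComponent n
      (X i ^ m * C a ^ (t - m) * (t.choose m : MvPolynomial σ R)) =
      if n = m then C (t.choose m * a ^ (t - m)) * X i ^ m else 0 := by
    have h : X i ^ m * C a ^ (t - m) * (t.choose m : MvPolynomial σ R) =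
        C (t.choose m * a ^ (t - m)) * X i ^ m := by
      simp only [map_mul, map_pow, map_natCast]
      ring
    have hmem : C (t.choose m * a ^ (t - m)) * X i ^ m ∈ homogeneousSubmodule σ R m := by
      rw [mem_homogeneousSubmodule]
      exact (isHomogeneous_X_pow i m).C_mul _
    rw [h, homogeneousComponent_of_mem hmem]
  rw [add_pow, map_sum]
  simp only [hterm, Finset.sum_ite_eq, Finset.mem_range]
  split_ifs with hn
  · rfl
  · simp [Nat.choose_eq_zero_of_lt (show t < n by omega)]

/-- Two consecutive positive powers of `a + 1` and `a` cannot both agree. -/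
theorem add_one_pow_sub_pow_ne_zero {K : Type*} [Field K] {a : K} {m : ℕ} (hm : m ≠ 0)
    (h : (a + 1) ^ (m + 1) = a ^ (m + 1)) : (a + 1) ^ m - a ^ m ≠ 0 := by
  intro h'
  have h2 : (a + 1) ^ m = a ^ m := sub_eq_zero.mp h'
  rw [pow_succ, pow_succ, h2] at h
  have h3 : a ^ m = 0 := by linear_combination h
  have ha : a = 0 := (pow_eq_zero_iff hm).mp h3
  subst ha
  simp [hm] at h2

/-- A nondegenerate diagonal binary quadratic form over an algebraically closed field of
characteristic different from two is a product of two non-proportional linear forms. -/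
theorem exists_linear_factors_of_diagonal {K : Type*} [Field K] [IsAlgClosed K]
    (h2 : (2 : K) ≠ 0) {a b : K} (ha : a ≠ 0) (hb : b ≠ 0) :
    ∃ L₁ L₂ : MvPolynomial (Fin 2) K,
      L₁ ≠ 0 ∧ L₂ ≠ 0 ∧ L₁.IsHomogeneous 1 ∧ L₂.IsHomogeneous 1 ∧
      C a * X 0 ^ 2 - C b * X 1 ^ 2 = L₁ * L₂ ∧
      (∀ γ : K, L₁ ≠ γ • L₂) ∧ (∀ γ : K, L₂ ≠ γ • L₁) := by
  obtain ⟨u, rfl⟩ := IsAlgClosed.exists_pow_nat_eq a (n := 2) (by norm_num)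
  obtain ⟨v, rfl⟩ := IsAlgClosed.exists_pow_nat_eq b (n := 2) (by norm_num)
  have hu : u ≠ 0 := by rintro rfl; simp at ha
  have hv : v ≠ 0 := by rintro rfl; simp at hb
  have key (w : K) (hw : w ≠ 0) (γ : K) :
      (C u * X 0 + C w * X 1 : MvPolynomial (Fin 2) K) ≠
        γ • (C u * X 0 + C (-w) * X 1) := by
    intro h
    have e0 := congrArg (eval ![1, 0]) h
    have e1 := congrArg (eval ![0, 1]) h
    simp [smul_eval] at e0 e1
    have hγ : γ = 1 := mul_right_cancel₀ hu (by linear_combination -e0)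
    subst hγ
    exact mul_ne_zero h2 hw (by linear_combination e1)
  have hhom (w : K) : (C u * X 0 + C w * X 1 : MvPolynomial (Fin 2) K).IsHomogeneous 1 :=
    ((isHomogeneous_X K 0).C_mul u).add ((isHomogeneous_X K 1).C_mul w)
  have hne (w : K) : (C u * X 0 + C w * X 1 : MvPolynomial (Fin 2) K) ≠ 0 := by
    intro h
    have e0 := congrArg (eval ![1, 0]) h
    simp [hu] at e0
  refine ⟨C u * X 0 + C v * X 1, C u * X 0 + C (-v) * X 1, hne v, hne (-v), hhom v, hhom (-v),
    ?_, key v hv, fun γ => ?_⟩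
  · simp only [map_pow, map_neg]
    ring
  · simpa using key (-v) (neg_ne_zero.mpr hv) γ

/-- In case (A) (`t` even, `t ≢ 0, 1 (mod p)`), at any singular point `(α,β)`
of `f_t` the second homogeneous component `F_2` of `f_t(x+α, y+β)` is nonzero
and is a product of two linear forms, neither of which is a scalar multiple of
the other. -/
theorem F2_product_of_two_distinct_lines
    (p t : ℕ) [Fact p.Prime] (hp2 : p ≠ 2) (ht : 3 ≤ t) (hpt : ¬ p ∣ t)
    (hte : Even t) (ht0 : t % p ≠ 0) (ht1 : t % p ≠ 1)
    (α β : AlgebraicClosure (ZMod p))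
    (h0 : MvPolynomial.homogeneousComponent 0
        (((X 0 + C α + 1) ^ t - (X 0 + C α) ^ t - (X 1 + C β + 1) ^ t + (X 1 + C β) ^ t :
          MvPolynomial (Fin 2) (AlgebraicClosure (ZMod p)))) = 0)
    (h1 : MvPolynomial.homogeneousComponent 1
        (((X 0 + C α + 1) ^ t - (X 0 + C α) ^ t - (X 1 + C β + 1) ^ t + (X 1 + C β) ^ t :
          MvPolynomial (Fin 2) (AlgebraicClosure (ZMod p)))) = 0) :
    MvPolynomial.homogeneousComponent 2
        (((X 0 + C α + 1) ^ t - (X 0 + C α) ^ t - (X 1 + C β + 1) ^ t + (X 1 + C β) ^ t :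
          MvPolynomial (Fin 2) (AlgebraicClosure (ZMod p)))) ≠ 0 ∧
    ∃ L₁ L₂ : MvPolynomial (Fin 2) (AlgebraicClosure (ZMod p)),
      L₁ ≠ 0 ∧ L₂ ≠ 0 ∧ L₁.IsHomogeneous 1 ∧ L₂.IsHomogeneous 1 ∧
      MvPolynomial.homogeneousComponent 2
        (((X 0 + C α + 1) ^ t - (X 0 + C α) ^ t - (X 1 + C β + 1) ^ t + (X 1 + C β) ^ t :
          MvPolynomial (Fin 2) (AlgebraicClosure (ZMod p)))) = L₁ * L₂ ∧
      (∀ γ : AlgebraicClosure (ZMod p), L₁ ≠ γ • L₂) ∧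
      (∀ γ : AlgebraicClosure (ZMod p), L₂ ≠ γ • L₁) := by
  have hcomp (n : ℕ) : homogeneousComponent n
      (((X 0 + C α + 1) ^ t - (X 0 + C α) ^ t - (X 1 + C β + 1) ^ t + (X 1 + C β) ^ t :
          MvPolynomial (Fin 2) (AlgebraicClosure (ZMod p)))) =
      C (t.choose n * ((α + 1) ^ (t - n) - α ^ (t - n))) * X 0 ^ n -
        C (t.choose n * ((β + 1) ^ (t - n) - β ^ (t - n))) * X 1 ^ n := by
    have hα : (X 0 + C α + 1 : MvPolynomial (Fin 2) (AlgebraicClosure (ZMod p))) =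
        X 0 + C (α + 1) := by simp [add_assoc]
    have hβ : (X 1 + C β + 1 : MvPolynomial (Fin 2) (AlgebraicClosure (ZMod p))) =
        X 1 + C (β + 1) := by simp [add_assoc]
    rw [hα, hβ]
    rw [map_add, map_sub, map_sub]
    simp only [homogeneousComponent_X_add_C_pow, map_mul, map_sub]
    ring
  have hprime : p.Prime := Fact.out
  have cast_ne {m : ℕ} (hm : ¬ p ∣ m) : (m : AlgebraicClosure (ZMod p)) ≠ 0 := by
    rwa [Ne, CharP.cast_eq_zero_iff _ p]
  have h2 : (2 : AlgebraicClosure (ZMod p)) ≠ 0 := by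
    exact_mod_cast cast_ne fun h => hp2 ((Nat.prime_dvd_prime_iff_eq hprime Nat.prime_two).mp h)
  have ht_ne : (t : AlgebraicClosure (ZMod p)) ≠ 0 := cast_ne hpt
  have hchoose : ((t.choose 2 : ℕ) : AlgebraicClosure (ZMod p)) ≠ 0 := by
    refine cast_ne fun h => ?_
    have hdvd : p ∣ t * (t - 1) := by
      rw [← Nat.div_mul_cancel (Nat.even_mul_pred_self t).two_dvd, ← Nat.choose_two_right]
      exact h.mul_right 2
    rcases hprime.dvd_mul.mp hdvd with h | h
    · exact hpt h
    · have hmod : 1 ≡ t [MOD p] := (Nat.modEq_iff_dvd' (by omega)).mpr h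
      exact ht1 (Eq.trans hmod.symm (Nat.mod_eq_of_lt hprime.one_lt))
  obtain ⟨m, rfl⟩ : ∃ m, t = m + 2 := ⟨t - 2, by omega⟩
  have hm : m ≠ 0 := by omega
  rw [hcomp] at h1
  have hα : (α + 1) ^ (m + 1) = α ^ (m + 1) := by
    have e := congrArg (eval ![1, 0]) h1
    simp only [map_sub, map_mul, eval_C, map_pow, eval_X, Nat.choose_one_right] at e
    simpa [sub_eq_zero, ht_ne, -Nat.cast_add] using e
  have hβ : (β + 1) ^ (m + 1) = β ^ (m + 1) := by
    have e := congrArg (eval ![0, 1]) h1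
    simp only [map_sub, map_mul, eval_C, map_pow, eval_X, Nat.choose_one_right] at e
    simpa [sub_eq_zero, ht_ne, -Nat.cast_add] using e
  obtain ⟨L₁, L₂, hL₁, hL₂, hL⟩ := exists_linear_factors_of_diagonal h2
    (mul_ne_zero hchoose (add_one_pow_sub_pow_ne_zero hm hα))
    (mul_ne_zero hchoose (add_one_pow_sub_pow_ne_zero hm hβ))
  rw [hcomp, Nat.add_sub_cancel]
  exact ⟨hL.2.2.1 ▸ mul_ne_zero hL₁ hL₂, L₁, L₂, hL₁, hL₂, hL⟩
end
end

section
/- Suppose t = p^i·ℓ + 1 where i ≥ 1 and ℓ ≥ 3 is odd and not divisible by p. Then (α,β) ∈ F̄_p × F̄_p is a singular point of f_t (i.e., F_0 = 0 and F_1 = 0 in the decomposition of f_t(x+α, y+β) into homogeneous components) if and only if (α+1)^{p^i ℓ + 1} − α^{p^i ℓ + 1} − (β+1)^{p^i ℓ + 1} + β^{p^i ℓ + 1} = 0, (α+1)^ℓ = α^ℓ, and (β+1)^ℓ = β^ℓ. -/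
open MvPolynomial

noncomputable section

theorem MvPolynomial.homogeneousComponent_zero_eq_zero_iff {σ R : Type*} [CommSemiring R]
    (φ : MvPolynomial σ R) :
    homogeneousComponent 0 φ = 0 ↔ constantCoeff φ = 0 := by
  rw [homogeneousComponent_zero, C_eq_zero, constantCoeff_eq]

theorem MvPolynomial.constantCoeff_pderiv {σ R : Type*} [CommSemiring R]
    (φ : MvPolynomial σ R) (i : σ) :
    constantCoeff (pderiv i φ) = coeff (Finsupp.single i 1) φ := by
  simp [constantCoeff_eq, coeff_pderiv]

theorem MvPolynomial.homogeneousComponent_one_eq_zero_iff {σ R : Type*} [CommSemiring R]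
    (φ : MvPolynomial σ R) :
    homogeneousComponent 1 φ = 0 ↔ ∀ i, constantCoeff (pderiv i φ) = 0 := by
  simp only [constantCoeff_pderiv]
  constructor
  · intro h i
    simpa [coeff_homogeneousComponent] using congrArg (coeff (Finsupp.single i 1)) h
  · intro h
    ext d
    rw [coeff_homogeneousComponent, coeff_zero]
    split_ifs with hd
    · obtain ⟨i, rfl⟩ : d ∈ Set.range fun i : σ ↦ Finsupp.single i 1 :=
        Finsupp.range_single_one ▸ hd
      exact h i
    · rfl

theorem pow_prime_pow_mul_inj {R : Type*} [CommRing R] [IsReduced R] (p : ℕ) [ExpChar R p]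
    (i l : ℕ) (a b : R) : a ^ (p ^ i * l) = b ^ (p ^ i * l) ↔ a ^ l = b ^ l := by
  rw [mul_comm, pow_mul, pow_mul]
  exact (iterateFrobenius_inj R p i).eq_iff

/-- For `t = p^i·ℓ + 1` (case B), `(α,β)` is a singular point of `f_t`
(i.e. `F_0 = F_1 = 0` in the expansion of `f_t(x+α, y+β)`) if and only if
`(α+1)^{p^iℓ+1} - α^{p^iℓ+1} - (β+1)^{p^iℓ+1} + β^{p^iℓ+1} = 0`,
`(α+1)^ℓ = α^ℓ` and `(β+1)^ℓ = β^ℓ`. -/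
theorem singular_point_iff_case_B
    (p t : ℕ) [Fact p.Prime] (hp2 : p ≠ 2) (ht : 3 ≤ t) (hpt : ¬ p ∣ t)
    (i l : ℕ) (hi : 1 ≤ i) (hl3 : 3 ≤ l) (hlodd : Odd l) (hlp : ¬ p ∣ l)
    (htval : t = p ^ i * l + 1)
    (α β : AlgebraicClosure (ZMod p)) :
    (MvPolynomial.homogeneousComponent 0
        (((X 0 + C α + 1) ^ t - (X 0 + C α) ^ t - (X 1 + C β + 1) ^ t + (X 1 + C β) ^ t :
          MvPolynomial (Fin 2) (AlgebraicClosure (ZMod p)))) = 0 ∧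
      MvPolynomial.homogeneousComponent 1
        (((X 0 + C α + 1) ^ t - (X 0 + C α) ^ t - (X 1 + C β + 1) ^ t + (X 1 + C β) ^ t :
          MvPolynomial (Fin 2) (AlgebraicClosure (ZMod p)))) = 0) ↔
    ((α + 1) ^ (p ^ i * l + 1) - α ^ (p ^ i * l + 1)
        - (β + 1) ^ (p ^ i * l + 1) + β ^ (p ^ i * l + 1) = 0 ∧
      (α + 1) ^ l = α ^ l ∧ (β + 1) ^ l = β ^ l) := by
  have hcast : (t : AlgebraicClosure (ZMod p)) = 1 := by
    rw [htval]
    simp [Nat.ne_of_gt hi]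
  rw [MvPolynomial.homogeneousComponent_zero_eq_zero_iff,
    MvPolynomial.homogeneousComponent_one_eq_zero_iff, Fin.forall_fin_two]
  have hsub : t - 1 = p ^ i * l := by omega
  rw [← pow_prime_pow_mul_inj p i l (α + 1) α, ← pow_prime_pow_mul_inj p i l (β + 1) β,
    ← sub_eq_zero (a := (α + 1) ^ (p ^ i * l)), ← sub_eq_zero (a := (β + 1) ^ (p ^ i * l)),
    ← neg_eq_zero (a := (β + 1) ^ (p ^ i * l) - _), ← htval]
  simp [hcast, hsub, sub_eq_add_neg, add_comm]
end
end
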